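/- arXiv:1610.04915 — 10 statements merged into one kernel-verified Lean document; each statement's English description precedes it below -/
import Mathlib

section
/- For every constant δ ∈ (0,1) there exists a constant c > 0 (depending only on δ) such that for every number of sites n ≥ 2 and every buffer size k with ⌊(1−δ)·k⌋ ≥ 1, there exists a request sequence σ on the line of n equidistant sites with OPT(k, σ) > 0 and OPT(⌊(1−δ)·k⌋, σ) ≥ c · min{k, log₂ n} · OPT(k, σ). -/
/-- Distance between two sites on the line of equidistant sites. -/
def natDist (a b : ℕ) : ℕ := max a b - min a b

/-- Total distance traveled by a server starting at site `s` and visiting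
the listed sites in order. -/
def walkCost : ℕ → List ℕ → ℕ
  | _, [] => 0
  | s, x :: xs => natDist s x + walkCost x xs

/-- `π` is a valid service order with buffer size `k` for a sequence of `N` requests:
the request served `t`-th has arrival index `π t`, and `π(t) ≤ t + k - 1` for every `t`
(indices are 0-based here, which yields the same inequality as the 1-based formulation). -/
def IsServiceOrder (k N : ℕ) (π : Equiv.Perm (Fin N)) : Prop :=
  ∀ t : Fin N, (π t : ℕ) ≤ (t : ℕ) + k - 1

/-- The cost of the service order `π` for the request sequence `σ`:
the server starts at site 0 and moves to the requested sites in service order. -/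
def serviceCost (σ : List ℕ) (π : Equiv.Perm (Fin σ.length)) : ℕ :=
  walkCost 0 ((List.finRange σ.length).map fun t => σ.get (π t))

/-- The optimal cost for serving the request sequence `σ` with buffer size `k`. -/
noncomputable def OPT (k : ℕ) (σ : List ℕ) : ℕ :=
  sInf {c | ∃ π : Equiv.Perm (Fin σ.length), IsServiceOrder k σ.length π ∧ serviceCost σ π = c}


namespace RB

/-- location of the `j`-th request -/
def loc (a l K : ℕ) (j : ℕ) : ℕ :=
  if j % (a * l + K) < a * l ∧ 2 ^ (j % (a * l + K) % l) ∣ j / (a * l + K) then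
    j / (a * l + K) + 2 ^ (j % (a * l + K) % l)
  else j / (a * l + K)

lemma loc_le (a l K : ℕ) (hl : 0 < l) (hK : 0 < K) (j : ℕ) (hj : j < 2 ^ l * (a * l + K)) :
    loc a l K j ≤ 2 ^ l := by
  have hP : 0 < a * l + K := by omega
  have hp : j / (a * l + K) < 2 ^ l := by
    rw [Nat.div_lt_iff_lt_mul hP]; exact hj
  unfold loc
  split_ifs with h
  · obtain ⟨m, hm⟩ := h.2
    set i := j % (a * l + K) % l with hi
    have hil : i < l := Nat.mod_lt _ hl
    obtain ⟨e, he⟩ : 2 ^ i ∣ 2 ^ l := pow_dvd_pow 2 hil.le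
    rw [hm] at hp ⊢
    rw [he] at hp ⊢
    have : m < e := lt_of_mul_lt_mul_left hp (Nat.zero_le _)
    calc 2 ^ i * m + 2 ^ i = 2 ^ i * (m + 1) := by ring
      _ ≤ 2 ^ i * e := Nat.mul_le_mul_left _ this
  · exact hp.le

lemma le_loc (a l K j : ℕ) : j / (a * l + K) ≤ loc a l K j := by
  unfold loc
  split_ifs <;> omega

lemma inv_count (a l K : ℕ) (hK : 0 < K) (j : ℕ) :
    ((Finset.range j).filter (fun j' => loc a l K j < loc a l K j')).card ≤ a * l := by
  have hP : 0 < a * l + K := by omega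
  set P := a * l + K with hPdef
  have key : ∀ j' < j, loc a l K j < loc a l K j' →
      j' % P < a * l ∧ j' / P = 2 ^ (j' % P % l) * (j / P / 2 ^ (j' % P % l)) := by
    intro j' hj' hlt
    have h1 := le_loc a l K j
    have h2 : j' / P ≤ j / P := Nat.div_le_div_right hj'.le
    replace hlt : j / P < loc a l K j' := lt_of_le_of_lt h1 hlt
    unfold loc at hlt
    rw [← hPdef] at hlt
    by_cases h : j' % P < a * l ∧ 2 ^ (j' % P % l) ∣ j' / P
    · rw [if_pos h] at hlt
      refine ⟨h.1, ?_⟩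
      obtain ⟨m, hm⟩ := h.2
      have hlt2 : j / P < j' / P + 2 ^ (j' % P % l) := hlt
      rw [hm] at hlt2 h2
      generalize 2 ^ (j' % P % l) = e at *
      rw [hm]
      congr 1
      have he : 0 < e := by
        rcases Nat.eq_zero_or_pos e with h0 | h0
        · subst h0; simp at hlt2
        · exact h0
      symm
      rw [Nat.div_eq_iff he]
      constructor
      · nlinarith
      · nlinarith [Nat.sub_add_cancel (show 1 ≤ m * e + e by omega)]
    · rw [if_neg h] at hlt
      omega
  have : ((Finset.range j).filter (fun j' => loc a l K j < loc a l K j')).card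
      ≤ (Finset.range (a * l)).card := by
    apply Finset.card_le_card_of_injOn (fun j' => j' % P)
    · intro x hx
      simp only [Finset.coe_filter, Finset.mem_range, Set.mem_ofPred_eq] at hx
      simpa using (key x hx.1 hx.2).1
    · intro x hx y hy hxy
      simp only [Finset.coe_filter, Finset.mem_range, Set.mem_ofPred_eq] at hx hy
      have kx := (key x hx.1 hx.2).2
      have ky := (key y hy.1 hy.2).2
      simp only at hxy
      rw [hxy] at kx
      have : x / P = y / P := by rw [kx, ← ky]
      rw [← Nat.div_add_mod x P, ← Nat.div_add_mod y P, this, hxy]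
  simpa using this

lemma walkCost_eq (s : ℕ) (l : List ℕ) :
    walkCost s l = ∑ t ∈ Finset.range l.length,
      natDist ((s :: l).getD t 0) ((s :: l).getD (t + 1) 0) := by
  induction l generalizing s with
  | nil => simp [walkCost]
  | cons x xs ih =>
    rw [walkCost, ih, List.length_cons, Finset.sum_range_succ']
    rw [add_comm]
    simp

/-- positions of the server -/
def pos (σ : List ℕ) (π : Equiv.Perm (Fin σ.length)) (t : ℕ) : ℕ :=
  (0 :: (List.finRange σ.length).map fun t => σ.get (π t)).getD t 0

lemma serviceCost_eq (σ : List ℕ) (π : Equiv.Perm (Fin σ.length)) :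
    serviceCost σ π = ∑ t ∈ Finset.range σ.length, natDist (pos σ π t) (pos σ π (t + 1)) := by
  unfold serviceCost
  rw [walkCost_eq]
  simp [pos]

lemma pos_zero (σ : List ℕ) (π : Equiv.Perm (Fin σ.length)) : pos σ π 0 = 0 := by
  simp [pos]

lemma pos_succ (σ : List ℕ) (π : Equiv.Perm (Fin σ.length)) (t : Fin σ.length) :
    pos σ π (t + 1) = σ.get (π t) := by
  simp [pos]

lemma natDist_ge (a b : ℕ) : a ≤ b + natDist a b := by unfold natDist; omega
lemma natDist_ge' (a b : ℕ) : b ≤ a + natDist a b := by unfold natDist; omega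

lemma walk_ge (w : ℕ → ℕ) (s t : ℕ) (h : s ≤ t) :
    w s + ∑ i ∈ Finset.range s, natDist (w i) (w (i + 1))
      ≤ w t + ∑ i ∈ Finset.range t, natDist (w i) (w (i + 1)) := by
  induction t, h using Nat.le_induction with
  | base => exact le_rfl
  | succ t ht ih =>
    rw [Finset.sum_range_succ]
    have := natDist_ge (w t) (w (t+1))
    omega

lemma walk_ge' (w : ℕ → ℕ) (t : ℕ) :
    w t ≤ w 0 + ∑ i ∈ Finset.range t, natDist (w i) (w (i + 1)) := by
  induction t with
  | zero => simp
  | succ t ih =>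
    rw [Finset.sum_range_succ]
    have := natDist_ge' (w t) (w (t+1))
    omega

lemma walk_mono (w : ℕ → ℕ) (t : ℕ) (h : ∀ i < t, w i ≤ w (i + 1)) :
    w 0 + ∑ i ∈ Finset.range t, natDist (w i) (w (i + 1)) = w t := by
  induction t with
  | zero => simp
  | succ t ih =>
    rw [Finset.sum_range_succ, ← add_assoc, ih (fun i hi => h i (by omega))]
    have := h t (by omega)
    unfold natDist; omega

lemma sort_valid (σ : List ℕ) (k b : ℕ) (hb : b + 1 ≤ k)
    (hinv : ∀ j : Fin σ.length,
      (Finset.univ.filter (fun j' : Fin σ.length => j' < j ∧ σ.get j < σ.get j')).card ≤ b) :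
    IsServiceOrder k σ.length (Tuple.sort σ.get) := by
  intro t
  set π := Tuple.sort σ.get with hπ
  obtain ⟨hm, hst⟩ := (Tuple.eq_sort_iff (f := σ.get) (σ := π)).1 hπ
  have h1 : (Finset.univ.filter (fun j' : Fin σ.length => j' < π t)).card = (π t : ℕ) := by
    rw [← Fin.card_Iio (π t)]; congr 1; ext x; simp
  have h2 : (Finset.univ.filter (fun j' : Fin σ.length => π.symm j' < t)).card = (t : ℕ) := by
    have : (Finset.univ.filter (fun j' : Fin σ.length => π.symm j' < t)) =
        (Finset.univ.filter (fun j' : Fin σ.length => j' < t)).map π.toEmbedding := by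
      ext x
      simp only [Finset.mem_filter, Finset.mem_univ, true_and, Finset.mem_map_equiv]
    rw [this, Finset.card_map, ← Fin.card_Iio t]
    congr 1; ext x; simp
  have h3 : (Finset.univ.filter (fun j' : Fin σ.length => j' < π t)) ⊆
      (Finset.univ.filter (fun j' : Fin σ.length => π.symm j' < t)) ∪
      (Finset.univ.filter (fun j' : Fin σ.length => j' < π t ∧ σ.get (π t) < σ.get j')) := by
    intro x hx
    simp only [Finset.mem_filter, Finset.mem_univ, true_and, Finset.mem_union] at hx ⊢
    by_cases h : π.symm x < t
    · exact Or.inl h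
    · right
      refine ⟨hx, ?_⟩
      have hne : t ≠ π.symm x := by
        rintro rfl
        simp at hx
      have hlt : t < π.symm x := lt_of_le_of_ne (not_lt.1 h) hne
      have hle := hm hlt.le
      simp only [Function.comp, Equiv.apply_symm_apply] at hle
      refine lt_of_le_of_ne hle fun he => ?_
      have := hst t (π.symm x) hlt (by simpa using he)
      simp only [Equiv.apply_symm_apply] at this
      exact absurd hx (not_lt.2 this.le)
  have h4 := (Finset.card_le_card h3).trans (Finset.card_union_le _ _)
  have h5 := hinv (π t)
  omega

lemma sort_cost (σ : List ℕ) (b : ℕ) (hb : ∀ x ∈ σ, x ≤ b) :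
    serviceCost σ (Tuple.sort σ.get) ≤ b := by
  set π := Tuple.sort σ.get with hπ
  have hm : Monotone (σ.get ∘ π) := Tuple.monotone_sort _
  rw [serviceCost_eq]
  have := walk_mono (pos σ π) σ.length (by
    intro i hi
    rcases i with _ | i
    · simp [pos_zero]
    · have e1 := pos_succ σ π ⟨i, by omega⟩
      have e2 := pos_succ σ π ⟨i + 1, hi⟩
      simp only at e1 e2
      rw [e1, e2]
      exact hm (by simp))
  rw [pos_zero, zero_add] at this
  rw [this]
  rcases hn : σ.length with _ | m
  · simp [pos_zero]
  · have e1 := pos_succ σ π ⟨m, by omega⟩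
    simp only at e1
    rw [e1]
    exact hb _ (List.get_mem _ _)

lemma OPT_le (k : ℕ) (σ : List ℕ) (π : Equiv.Perm (Fin σ.length))
    (h : IsServiceOrder k σ.length π) : OPT k σ ≤ serviceCost σ π :=
  Nat.sInf_le ⟨π, h, rfl⟩

lemma OPT_mem (k : ℕ) (hk : 1 ≤ k) (σ : List ℕ) :
    ∃ π : Equiv.Perm (Fin σ.length), IsServiceOrder k σ.length π ∧ serviceCost σ π = OPT k σ :=
  Nat.sInf_mem (s := {c | ∃ π : Equiv.Perm (Fin σ.length),
    IsServiceOrder k σ.length π ∧ serviceCost σ π = c})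
    ⟨_, 1, fun t => by simp only [Equiv.Perm.coe_one, id]; omega, rfl⟩

lemma OPT_ge (k : ℕ) (hk : 1 ≤ k) (σ : List ℕ) (x : ℕ) (hx : x ∈ σ) : x ≤ OPT k σ := by
  obtain ⟨π, hπ, hc⟩ := OPT_mem k hk σ
  obtain ⟨j, rfl⟩ := List.get_of_mem hx
  rw [← hc, serviceCost_eq]
  have e := pos_succ σ π (π.symm j)
  rw [Equiv.apply_symm_apply] at e
  rw [← e]
  have := walk_ge' (pos σ π) ((π.symm j : ℕ) + 1)
  rw [pos_zero, zero_add] at this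
  refine this.trans (Finset.sum_le_sum_of_subset ?_)
  exact Finset.range_subset_range.2 (π.symm j).2

end RB

namespace RB

lemma madd {m P r : ℕ} (h : r < P) : (m * P + r) % P = r := by
  rw [mul_comm, Nat.mul_add_mod, Nat.mod_eq_of_lt h]

lemma count_lt (N : ℕ) (s : ℕ → ℕ) (hs : ∀ j < N, s j < N)
    (inj : ∀ i < N, ∀ j < N, s i = s j → i = j) (T : ℕ) (hT : T ≤ N) :
    ((Finset.range N).filter (fun j => s j < T)).card = T := by
  have hinj : Set.InjOn s (Finset.range N : Finset ℕ) := by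
    intro i hi j hj h
    exact inj i (by simpa using hi) j (by simpa using hj) h
  have him : (Finset.range N).image s = Finset.range N := by
    apply Finset.eq_of_subset_of_card_le
    · intro x hx
      obtain ⟨j, hj, rfl⟩ := Finset.mem_image.1 hx
      simpa using hs j (by simpa using hj)
    · rw [Finset.card_image_of_injOn hinj]
  have h2 : ((Finset.range N).filter (fun j => s j < T)).image s = Finset.range T := by
    ext x
    simp only [Finset.mem_image, Finset.mem_filter, Finset.mem_range]
    constructor
    · rintro ⟨j, ⟨_, h⟩, rfl⟩; exact h
    · intro hx
      have : x ∈ (Finset.range N).image s := by rw [him]; simp; omega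
      obtain ⟨j, hj, rfl⟩ := Finset.mem_image.1 this
      exact ⟨j, ⟨by simpa using hj, hx⟩, rfl⟩
  rw [← Finset.card_image_of_injOn (hinj.mono ?_), h2, Finset.card_range]
  intro x hx
  have := Finset.mem_filter.1 (Finset.mem_coe.1 hx)
  exact Finset.mem_coe.2 this.1

/-- the server must visit site `p` in time -/
lemma exists_visit (a l K : ℕ) (N : ℕ) (s : ℕ → ℕ) (hs : ∀ j < N, s j < N)
    (inj : ∀ i < N, ∀ j < N, s i = s j → i = j) (hlt : ∀ j < N, j < s j + K) (hK : 0 < K)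
    (p : ℕ) (hp : (p + 1) * (a * l + K) ≤ N) :
    ∃ j, p * (a * l + K) + a * l ≤ j ∧ j < (p + 1) * (a * l + K) ∧
      s j + K ≤ (p + 1) * (a * l + K) := by
  by_contra! hcon
  have hE : (p + 1) * (a * l + K) = p * (a * l + K) + a * l + K := by ring
  rw [hE] at hcon hp
  set Q := p * (a * l + K) + a * l with hQ
  have h1 := count_lt N s hs inj (Q + 1) (by omega)
  have h2 : ((Finset.range N).filter (fun j => s j < Q + 1)) ⊆ Finset.range Q := by
    intro j hj
    simp only [Finset.mem_filter, Finset.mem_range] at hj ⊢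
    by_contra hjQ
    have := hlt j hj.1
    have := hcon j (by omega) (by omega)
    omega
  have h3 := Finset.card_le_card h2
  rw [h1, Finset.card_range] at h3
  omega

/-- few requests are pending -/
lemma pending (K : ℕ) (N : ℕ) (s : ℕ → ℕ) (hs : ∀ j < N, s j < N)
    (inj : ∀ i < N, ∀ j < N, s i = s j → i = j) (hlt : ∀ j < N, j < s j + K)
    (Q T : ℕ) (hT : T ≤ N) (hQ : Q ≤ T + K) :
    ((Finset.range Q).filter (fun j => T ≤ s j)).card ≤ K := by
  have h1 := count_lt N s hs inj T hT
  have hd : Disjoint ((Finset.range N).filter (fun j => s j < T))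
      ((Finset.range Q).filter (fun j => T ≤ s j)) := by
    rw [Finset.disjoint_left]
    intro x hx hy
    simp only [Finset.mem_filter] at hx hy
    omega
  have h2 : ((Finset.range N).filter (fun j => s j < T)) ∪
      ((Finset.range Q).filter (fun j => T ≤ s j)) ⊆ Finset.range (T + K) := by
    intro x hx
    simp only [Finset.mem_filter, Finset.mem_range, Finset.mem_union] at hx ⊢
    rcases hx with hx | hx
    · have := hlt x hx.1; omega
    · omega
  have h3 := Finset.card_le_card h2
  rw [Finset.card_union_of_disjoint hd, h1, Finset.card_range] at h3
  omega

/-- index of the `r`-th long-distance request relevant in phase `p` -/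
def gi (a l K p r : ℕ) : ℕ := (2 ^ (r % l) * (p / 2 ^ (r % l))) * (a * l + K) + r

lemma gi_lt (a l K p r : ℕ) (hr : r < a * l) : gi a l K p r < p * (a * l + K) + a * l := by
  unfold gi
  have : 2 ^ (r % l) * (p / 2 ^ (r % l)) ≤ p := Nat.mul_div_le _ _
  have := Nat.mul_le_mul_right (a * l + K) this
  omega

lemma loc_gi (a l K p r : ℕ) (hr : r < a * l) :
    loc a l K (gi a l K p r) = 2 ^ (r % l) * (p / 2 ^ (r % l)) + 2 ^ (r % l) := by
  have hP : 0 < a * l + K := by omega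
  have h1 : gi a l K p r % (a * l + K) = r := by
    unfold gi
    rw [madd]
    omega
  have h2 : gi a l K p r / (a * l + K) = 2 ^ (r % l) * (p / 2 ^ (r % l)) := by
    unfold gi
    rw [mul_comm _ (a * l + K), Nat.mul_add_div hP, Nat.div_eq_of_lt (show r < a * l + K by omega), add_zero]
  unfold loc
  rw [h1, h2, if_pos ⟨hr, Dvd.intro _ rfl⟩]

lemma gi_inj (a l K p r r' : ℕ) (hr : r < a * l) (hr' : r' < a * l)
    (h : gi a l K p r = gi a l K p r') : r = r' := by
  have h1 : ∀ r < a * l, gi a l K p r % (a * l + K) = r := by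
    intro r hr
    unfold gi
    rw [madd]
    omega
  rw [← h1 r hr, ← h1 r' hr', h]

/-- many requests are served early -/
lemma early (a l K : ℕ) (N : ℕ) (s : ℕ → ℕ) (hs : ∀ j < N, s j < N)
    (inj : ∀ i < N, ∀ j < N, s i = s j → i = j) (hlt : ∀ j < N, j < s j + K)
    (p j : ℕ) (hj : p * (a * l + K) + a * l ≤ j) (hjN : j < N) :
    a * l ≤ K + ((Finset.range (a * l)).filter (fun r => s (gi a l K p r) < s j)).card := by
  have h1 := pending K N s hs inj hlt (p * (a * l + K) + a * l) (s j) (hs j hjN).le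
    (by have := hlt j hjN; omega)
  have h2 : ((Finset.range (a * l)).filter (fun r => ¬ s (gi a l K p r) < s j)).card ≤
      ((Finset.range (p * (a * l + K) + a * l)).filter (fun i => s j ≤ s i)).card := by
    apply Finset.card_le_card_of_injOn (fun r => gi a l K p r)
    · intro r hr
      simp only [Finset.coe_filter, Finset.mem_range, Set.mem_ofPred_eq] at hr ⊢
      exact ⟨gi_lt _ _ _ _ _ hr.1, by omega⟩
    · intro r hr r' hr' h
      simp only [Finset.coe_filter, Finset.mem_range, Set.mem_ofPred_eq] at hr hr'
      exact gi_inj a l K p r r' hr.1 hr'.1 h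
  have h3 := Finset.card_filter_add_card_filter_not (s := Finset.range (a * l))
    (fun r => s (gi a l K p r) < s j)
  rw [Finset.card_range] at h3
  omega

lemma sum_mod (a l : ℕ) (g : ℕ → ℕ) :
    ∑ r ∈ Finset.range (a * l), g (r % l) = a * ∑ i ∈ Finset.range l, g i := by
  induction a with
  | zero => simp
  | succ a ih =>
    rw [add_mul, one_mul, Finset.sum_range_add, ih, add_mul, one_mul]
    congr 1
    apply Finset.sum_congr rfl
    intro x hx
    rw [madd (by simpa using hx)]

lemma near_count (B i : ℕ) :
    B * ∑ x ∈ Finset.range (2 ^ i), (if B * (2 ^ i - x) ≤ 2 ^ i then 1 else 0) ≤ 2 ^ i := by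
  rw [← Finset.sum_range_reflect]
  rcases Nat.eq_zero_or_pos B with rfl | hB
  · simp
  have : ∑ x ∈ Finset.range (2 ^ i), (if B * (2 ^ i - (2 ^ i - 1 - x)) ≤ 2 ^ i then 1 else 0)
      ≤ 2 ^ i / B := by
    rw [← Finset.card_filter]
    have : ((Finset.range (2 ^ i)).filter (fun x => B * (2 ^ i - (2 ^ i - 1 - x)) ≤ 2 ^ i)) ⊆
        Finset.range (2 ^ i / B) := by
      intro x hx
      simp only [Finset.mem_filter, Finset.mem_range] at hx ⊢
      have e : 2 ^ i - (2 ^ i - 1 - x) = x + 1 := by omega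
      rw [e] at hx
      rw [Nat.lt_iff_add_one_le, Nat.le_div_iff_mul_le hB, mul_comm]
      exact hx.2
    simpa using Finset.card_le_card this
  exact (Nat.mul_le_mul_left B this).trans (Nat.mul_div_le _ _)

lemma near_total (B l i : ℕ) (hi : i ≤ l) :
    B * ∑ p ∈ Finset.range (2 ^ l), (if B * (2 ^ i - p % 2 ^ i) ≤ 2 ^ i then 1 else 0) ≤ 2 ^ l := by
  obtain ⟨d, rfl⟩ := Nat.exists_eq_add_of_le' hi
  have := sum_mod (2 ^ d) (2 ^ i) (fun x => if B * (2 ^ i - x) ≤ 2 ^ i then 1 else 0)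
  rw [pow_add, this, mul_left_comm]
  exact Nat.mul_le_mul_left _ (near_count B i)

lemma pow_sum (l Y : ℕ) :
    ∑ i ∈ Finset.range l, (if 2 ^ i < Y then 2 ^ i else 0) ≤ 2 * Y := by
  induction l with
  | zero => simp
  | succ l ih =>
    rw [Finset.sum_range_succ]
    split_ifs with h
    · have h1 : ∑ i ∈ Finset.range l, (if 2 ^ i < Y then 2 ^ i else 0) ≤
          ∑ i ∈ Finset.range l, 2 ^ i :=
        Finset.sum_le_sum fun i _ => by split_ifs <;> simp
      have h2 : ∑ i ∈ Finset.range l, 2 ^ i < 2 ^ l := Nat.geomSum_lt (by norm_num) (by simp)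
      omega
    · simpa using ih

lemma same_node (M i q : ℕ) :
    ∑ p ∈ Finset.range M, (if p / 2 ^ i = q / 2 ^ i then 1 else 0) ≤ 2 ^ i := by
  rw [← Finset.card_filter]
  have hpos : 0 < 2 ^ i := by positivity
  have : ((Finset.range M).filter (fun p => p / 2 ^ i = q / 2 ^ i)) ⊆
      Finset.Ico (q / 2 ^ i * 2 ^ i) (q / 2 ^ i * 2 ^ i + 2 ^ i) := by
    intro x hx
    simp only [Finset.mem_filter, Finset.mem_range, Finset.mem_Ico] at hx ⊢
    rw [← hx.2]
    have := Nat.div_add_mod' x (2 ^ i)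
    have := Nat.mod_lt x hpos
    omega
  simpa using Finset.card_le_card this

/-- the charging argument -/
lemma charging (a l B L : ℕ) (hL : L = 2 ^ l) (d : ℕ → ℕ) (S : ℕ → ℕ → Prop)
    [∀ p r, Decidable (S p r)]
    (hS : ∀ p < L, ∀ r < a * l, S p r → ∃ q ≤ p, q / 2 ^ (r % l) = p / 2 ^ (r % l) ∧
      2 ^ (r % l) * (p / 2 ^ (r % l)) + 2 ^ (r % l) ≤ q + d q) :
    B * ∑ p ∈ Finset.range L, ∑ r ∈ Finset.range (a * l), (if S p r then 1 else 0)
      ≤ a * l * L + 2 * B * B * a * ∑ q ∈ Finset.range L, d q := by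
  have h1 : ∀ p ∈ Finset.range L, ∀ r ∈ Finset.range (a * l), (if S p r then 1 else 0) ≤
      (fun i => (if B * (2 ^ i - p % 2 ^ i) ≤ 2 ^ i then 1 else 0) +
        ∑ q ∈ Finset.range L, (if p / 2 ^ i = q / 2 ^ i ∧ 2 ^ i < B * d q then 1 else 0)) (r % l) := by
    intro p hp r hr
    rw [Finset.mem_range] at hp hr
    dsimp only
    set i := r % l with hi
    by_cases h : S p r
    · rw [if_pos h]
      by_cases hn : B * (2 ^ i - p % 2 ^ i) ≤ 2 ^ i
      · rw [if_pos hn]; omega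
      · rw [if_neg hn, zero_add]
        obtain ⟨q, hqp, hq, hd⟩ := hS p hp r hr h
        rw [← hi] at hq hd
        have := Nat.div_add_mod p (2 ^ i)
        have hmul := Nat.mul_le_mul_left B (show 2 ^ i - p % 2 ^ i ≤ d q by omega)
        have hc : p / 2 ^ i = q / 2 ^ i ∧ 2 ^ i < B * d q := ⟨hq.symm, by omega⟩
        have := Finset.single_le_sum
          (f := fun q => if p / 2 ^ i = q / 2 ^ i ∧ 2 ^ i < B * d q then 1 else 0)
          (s := Finset.range L) (fun _ _ => Nat.zero_le _)
          (Finset.mem_range.2 (lt_of_le_of_lt hqp hp))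
        simp only [if_pos hc] at this
        exact this
    · rw [if_neg h]; exact Nat.zero_le _
  have h2 : ∑ p ∈ Finset.range L, ∑ r ∈ Finset.range (a * l), (if S p r then 1 else 0) ≤
      ∑ p ∈ Finset.range L, a * ∑ i ∈ Finset.range l,
        ((if B * (2 ^ i - p % 2 ^ i) ≤ 2 ^ i then 1 else 0) +
        ∑ q ∈ Finset.range L, (if p / 2 ^ i = q / 2 ^ i ∧ 2 ^ i < B * d q then 1 else 0)) := by
    apply Finset.sum_le_sum
    intro p hp
    rw [← sum_mod]
    exact Finset.sum_le_sum (h1 p hp)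
  rw [← Finset.mul_sum, Finset.sum_comm (s := Finset.range L) (t := Finset.range l)] at h2
  simp only [Finset.sum_add_distrib] at h2
  have h3 : B * ∑ i ∈ Finset.range l, ∑ p ∈ Finset.range L,
      (if B * (2 ^ i - p % 2 ^ i) ≤ 2 ^ i then 1 else 0) ≤ l * L := by
    rw [Finset.mul_sum]
    refine (Finset.sum_le_card_nsmul _ _ L ?_).trans (by simp)
    intro i hi
    rw [hL]
    exact near_total B l i (Finset.mem_range.1 hi).le
  have h4 : ∑ i ∈ Finset.range l, ∑ p ∈ Finset.range L, ∑ q ∈ Finset.range L,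
      (if p / 2 ^ i = q / 2 ^ i ∧ 2 ^ i < B * d q then 1 else 0) ≤
      2 * B * ∑ q ∈ Finset.range L, d q := by
    have e : ∀ i ∈ Finset.range l, ∑ p ∈ Finset.range L, ∑ q ∈ Finset.range L,
      (if p / 2 ^ i = q / 2 ^ i ∧ 2 ^ i < B * d q then 1 else 0) ≤
        ∑ q ∈ Finset.range L, (if 2 ^ i < B * d q then 2 ^ i else 0) := by
      intro i _
      rw [Finset.sum_comm]
      apply Finset.sum_le_sum
      intro q _
      by_cases h : 2 ^ i < B * d q
      · simp only [h, and_true, if_true]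
        exact same_node L i q
      · simp [h]
    refine (Finset.sum_le_sum e).trans ?_
    rw [Finset.sum_comm, Finset.mul_sum]
    apply Finset.sum_le_sum
    intro q _
    refine (pow_sum l _).trans (by rw [mul_assoc])
  refine (Nat.mul_le_mul_left B h2).trans ?_
  have h5 := Nat.mul_le_mul_left a h3
  have h6 := Nat.mul_le_mul_left (B * a) h4
  calc _ ≤ _ := le_of_eq (by ring)
    _ ≤ _ := Nat.add_le_add h5 h6
    _ = _ := by ring

lemma core_lower (a l K B : ℕ) (ha : 0 < a) (hl : 0 < l) (hK : 0 < K) (N : ℕ)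
    (hN : N = 2 ^ l * (a * l + K)) (s : ℕ → ℕ) (hs : ∀ j < N, s j < N)
    (inj : ∀ i < N, ∀ j < N, s i = s j → i = j) (hlt : ∀ j < N, j < s j + K)
    (w : ℕ → ℕ) (hw : ∀ j < N, w (s j + 1) = loc a l K j) :
    B * (a * l * 2 ^ l) ≤ B * (K * 2 ^ l) + (a * l * 2 ^ l + 2 * B * B * a *
      ∑ t ∈ Finset.range N, natDist (w t) (w (t + 1))) := by
  set L := 2 ^ l with hL
  set P := a * l + K with hP
  have hal : 0 < a * l := Nat.mul_pos ha hl
  have hvis : ∀ p, ∃ j, p < L → p * P + a * l ≤ j ∧ j < (p + 1) * P ∧ s j + K ≤ (p + 1) * P := by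
    intro p
    by_cases hp : p < L
    · obtain ⟨j, hj⟩ := exists_visit a l K N s hs inj hlt hK p
        (by rw [hN]; exact Nat.mul_le_mul_right _ hp)
      exact ⟨j, fun _ => hj⟩
    · exact ⟨0, fun h => absurd h hp⟩
  choose J hJ using hvis
  have hJN : ∀ p < L, J p < N := by
    intro p hp
    have := (hJ p hp).2.1
    have := Nat.mul_le_mul_right P (show p + 1 ≤ L from hp)
    omega
  have hlocJ : ∀ p < L, loc a l K (J p) = p := by
    intro p hp
    obtain ⟨h1, h2, _⟩ := hJ p hp
    have hP0 : 0 < P := by omega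
    have e : J p / P = p := by
      rw [Nat.div_eq_iff hP0]
      have : (p + 1) * P = p * P + P := by ring
      omega
    have e2 : ¬ (J p % P < a * l) := by
      have := Nat.div_add_mod' (J p) P
      rw [e] at this
      omega
    unfold loc
    rw [if_neg (fun h => e2 h.1)]
    exact e
  -- cumulative cost
  set F : ℕ → ℕ := fun t => ∑ i ∈ Finset.range t, natDist (w i) (w (i + 1)) with hF
  have Fmono : Monotone F := fun x y h =>
    Finset.sum_le_sum_of_subset (Finset.range_subset_range.2 h)
  -- step relation
  have hstep : ∀ p j, p + 1 < L → (p + 1) * P ≤ j → j < N → s (J p) < s j := by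
    intro p j hp hj hjN
    have h3 := (hJ p (by omega)).2.2
    have := hlt j hjN
    by_contra hcon
    have he : s j = s (J p) := by omega
    have := inj _ hjN _ (hJN p (by omega)) he
    have := (hJ p (by omega)).2.1
    omega
  have hstep' : ∀ p, p + 1 < L → s (J p) < s (J (p + 1)) := fun p hp =>
    hstep p _ hp (by have := (hJ (p + 1) hp).1; omega) (hJN _ hp)
  have hmono : ∀ p q, p ≤ q → q < L → s (J p) ≤ s (J q) := by
    intro p q h
    induction q, h using Nat.le_induction with
    | base => intro _; exact le_rfl
    | succ q hq ih => intro hq'; exact (ih (by omega)).trans (hstep' q hq').le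
  -- boundaries
  set u : ℕ → ℕ := fun q => if q = 0 then 0 else s (J (q - 1)) + 1 with hu
  have hu1 : ∀ q, u (q + 1) = s (J q) + 1 := fun q => by simp [hu]
  have humono : ∀ q < L, u q ≤ u (q + 1) := by
    intro q hq
    rw [hu1]
    rcases q with _ | q
    · simp [hu]
    · rw [hu1]; have := hstep' q hq; omega
  set d : ℕ → ℕ := fun q => F (u (q + 1)) - F (u q) with hd
  have hsum : ∀ M ≤ L, ∑ q ∈ Finset.range M, d q ≤ F (u M) := by
    intro M
    induction M with
    | zero => simp
    | succ M ih =>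
      intro hM
      rw [Finset.sum_range_succ]
      have := ih (by omega)
      have := Fmono (humono M hM)
      have : d M = F (u (M + 1)) - F (u M) := rfl
      omega
  have hL0 : 0 < L := by positivity
  have hD : ∑ q ∈ Finset.range L, d q ≤ F N := by
    refine (hsum L le_rfl).trans (Fmono ?_)
    obtain ⟨M, hM⟩ : ∃ M, L = M + 1 := ⟨L - 1, by omega⟩
    rw [hM, hu1]
    exact hs _ (hJN _ (by omega))
  have hch := charging a l B L hL d (fun p r => s (gi a l K p r) < s (J p)) (by
    intro p hp r hr hlt'
    have hex : ∃ q, s (gi a l K p r) < s (J q) := ⟨p, hlt'⟩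
    classical
    set q := Nat.find hex with hq
    have hq1 : s (gi a l K p r) < s (J q) := Nat.find_spec hex
    have hqp : q ≤ p := Nat.find_min' hex hlt'
    set i := r % l with hi
    have hgN : gi a l K p r < N := by
      have : gi a l K p r < p * P + a * l := gi_lt a l K p r hr
      have := (hJ p hp).1
      have := hJN p hp
      omega
    have hpp : 0 < 2 ^ i := by positivity
    have hlo : 2 ^ i * (p / 2 ^ i) ≤ q := by
      by_contra hcon
      push Not at hcon
      have hle : 2 ^ i * (p / 2 ^ i) ≤ p := Nat.mul_div_le _ _
      have := hstep q (gi a l K p r) (by omega) (by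
        unfold gi
        rw [← hi]
        exact (Nat.mul_le_mul_right P hcon).trans (Nat.le_add_right _ _)) hgN
      omega
    refine ⟨q, hqp, ?_, ?_⟩
    · apply le_antisymm (Nat.div_le_div_right hqp)
      rw [Nat.le_div_iff_mul_le hpp, mul_comm]
      exact hlo
    · rw [← loc_gi a l K p r hr, ← hw _ hgN]
      have hlow : u q ≤ s (gi a l K p r) + 1 := by
        rcases hq0 : q with _ | q'
        · simp [hu]
        · rw [hu1]
          have := Nat.find_min hex (m := q') (by omega)
          omega
      have h1 := walk_ge w (s (gi a l K p r) + 1) (s (J q) + 1) (by omega)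
      rw [hw _ (hJN q (by omega)), hlocJ q (by omega)] at h1
      have h2 := Fmono hlow
      have h3 := Fmono (humono q (by omega))
      simp only [hd]
      rw [hu1] at h3 ⊢
      simp only [hF] at h2 h3 ⊢
      omega)
  have hearly : L * (a * l) ≤ L * K + ∑ p ∈ Finset.range L, ∑ r ∈ Finset.range (a * l),
      (if s (gi a l K p r) < s (J p) then 1 else 0) := by
    have : ∑ p ∈ Finset.range L, (a * l) ≤ ∑ p ∈ Finset.range L, (K +
        ∑ r ∈ Finset.range (a * l), (if s (gi a l K p r) < s (J p) then 1 else 0)) := by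
      apply Finset.sum_le_sum
      intro p hp
      rw [← Finset.card_filter]
      have hp := Finset.mem_range.1 hp
      exact early a l K N s hs inj hlt p (J p) (hJ p hp).1 (hJN p hp)
    rw [Finset.sum_add_distrib] at this
    simpa using this
  have h1 := Nat.mul_le_mul_left B hearly
  have h2 := Nat.mul_le_mul_left (2 * B * B * a) hD
  simp only [hF] at h2
  rw [mul_add] at h1
  calc B * (a * l * L) = B * (L * (a * l)) := by ring
    _ ≤ _ := h1
    _ ≤ B * (L * K) + (a * l * L + 2 * B * B * a *
      ∑ t ∈ Finset.range N, natDist (w t) (w (t + 1))) :=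
        Nat.add_le_add_left (hch.trans (Nat.add_le_add_left h2 _)) _
    _ = _ := by ring

end RB

namespace RB

lemma exists_seq (a l K k : ℕ) (ha : 0 < a) (hl : 0 < l) (hK : 0 < K) (hk : a * l + 1 ≤ k) :
    ∃ σ : List ℕ, (∀ x ∈ σ, x ≤ 2 ^ l) ∧ 0 < OPT k σ ∧ OPT k σ ≤ 2 ^ l ∧
      ∀ B, B * (a * l * 2 ^ l) ≤ B * (K * 2 ^ l) + (a * l * 2 ^ l + 2 * B * B * a * OPT K σ) := by
  obtain ⟨N, hN⟩ : ∃ N, N = 2 ^ l * (a * l + K) := ⟨_, rfl⟩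
  have hal : 0 < a * l := Nat.mul_pos ha hl
  have hN0 : 0 < N := by rw [hN]; positivity
  obtain ⟨σ, hσ⟩ : ∃ σ, σ = (List.range N).map (loc a l K) := ⟨_, rfl⟩
  have hlen : σ.length = N := by simp [hσ]
  have hget : ∀ j : Fin σ.length, σ.get j = loc a l K j := by
    subst hσ
    intro j
    simp
  have hle : ∀ x ∈ σ, x ≤ 2 ^ l := by
    intro x hx
    rw [hσ] at hx
    obtain ⟨j, hj, rfl⟩ := List.mem_map.1 hx
    exact loc_le a l K hl hK j (by rw [← hN]; simpa using hj)
  refine ⟨σ, hle, ?_, ?_, ?_⟩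
  · have h1 : 1 ∈ σ := by
      rw [hσ]
      refine List.mem_map.2 ⟨0, by simpa using hN0, ?_⟩
      simp [loc, ha, hl]
    exact OPT_ge k (by omega) σ 1 h1
  · refine (OPT_le k σ _ (sort_valid σ k (a * l) hk ?_)).trans (sort_cost σ _ hle)
    intro j
    refine le_trans ?_ (inv_count a l K hK j)
    apply Finset.card_le_card_of_injOn (fun x : Fin σ.length => (x : ℕ))
    · intro x hx
      simp only [Finset.coe_filter, Finset.mem_univ, true_and, Finset.mem_range,
        Set.mem_ofPred_eq, hget] at hx ⊢
      exact hx
    · intro x _ y _ h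
      exact Fin.ext h
  · intro B
    obtain ⟨π, hπ, hc⟩ := OPT_mem K hK σ
    rw [← hc, serviceCost_eq, hlen]
    have hsv : ∀ j (h : j < σ.length),
        (fun j => if h : j < σ.length then (π.symm ⟨j, h⟩ : ℕ) else 0) j = π.symm ⟨j, h⟩ := by
      intro j h
      simp [h]
    generalize (fun j => if h : j < σ.length then (π.symm ⟨j, h⟩ : ℕ) else 0) = s at hsv
    apply core_lower a l K B ha hl hK N hN s
    · intro j hj
      rw [hsv j (by omega)]
      exact (Fin.is_lt _).trans_eq hlen
    · intro i hi j hj h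
      rw [hsv i (by omega), hsv j (by omega)] at h
      simpa using π.symm.injective (Fin.ext h)
    · intro j hj
      rw [hsv j (by omega)]
      have := hπ (π.symm ⟨j, by omega⟩)
      rw [Equiv.apply_symm_apply] at this
      simp only at this
      omega
    · intro j hj
      rw [hsv j (by omega), pos_succ, Equiv.apply_symm_apply, hget]

end RB

/-- For every constant `δ ∈ (0,1)` there is a constant `c > 0`
(depending only on `δ`) such that for every number of sites `n ≥ 2` and every buffer
size `k` with `⌊(1-δ)·k⌋ ≥ 1`, there is a request sequence `σ` on the line of `n`
equidistant sites with `OPT(k, σ) > 0` and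
`OPT(⌊(1-δ)·k⌋, σ) ≥ c · min {k, log₂ n} · OPT(k, σ)`. -/
theorem stmt0 (δ : ℝ) (hδ : δ ∈ Set.Ioo (0 : ℝ) 1) :
    ∃ c : ℝ, 0 < c ∧
      ∀ n k : ℕ, 2 ≤ n → 1 ≤ ⌊(1 - δ) * (k : ℝ)⌋ →
        ∃ σ : List ℕ, (∀ x ∈ σ, x < n) ∧ 0 < OPT k σ ∧
          (OPT (⌊(1 - δ) * (k : ℝ)⌋).toNat σ : ℝ) ≥
            c * min (k : ℝ) (Real.logb 2 n) * (OPT k σ : ℝ) := by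
  obtain ⟨h0, h1⟩ := hδ
  obtain ⟨B, hB⟩ : ∃ B : ℕ, 4 / δ ≤ (B : ℝ) := exists_nat_ge _
  have hBδ : 4 ≤ B * δ := by rwa [div_le_iff₀ h0] at hB
  have hB0 : (0 : ℝ) < B := by
    by_contra h
    push Not at h
    nlinarith
  have hB4 : (4 : ℝ) ≤ B := by nlinarith
  refine ⟨δ ^ 2 / (32 * B), by positivity, ?_⟩
  intro n k hn hk
  set K := (⌊(1 - δ) * (k : ℝ)⌋).toNat with hKdef
  have hK1 : 1 ≤ K := by omega
  have hKr : (K : ℝ) ≤ (1 - δ) * k := by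
    have e : ((K : ℤ) : ℝ) = (⌊(1 - δ) * (k : ℝ)⌋ : ℝ) := by
      rw [hKdef, Int.toNat_of_nonneg (by omega)]
    have := Int.floor_le ((1 - δ) * (k : ℝ))
    rw [← e] at this
    exact_mod_cast this
  have hkpos : (0 : ℝ) < k := by
    have : (1 : ℝ) ≤ K := by exact_mod_cast hK1
    by_contra h
    push Not at h
    nlinarith
  have hk1 : 1 ≤ k := by exact_mod_cast hkpos
  have hlog : Real.logb 2 n ≤ Nat.log 2 n + 1 := by
    have h2 : (n : ℝ) ≤ 2 ^ ((Nat.log 2 n + 1 : ℕ) : ℝ) := by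
      rw [Real.rpow_natCast]
      exact_mod_cast (Nat.lt_pow_succ_log_self (by norm_num) n).le
    have hn0 : (0 : ℝ) < n := by positivity
    rw [← Real.logb_le_logb (b := 2) (by norm_num) hn0 (by positivity),
      Real.logb_rpow (by norm_num) (by norm_num)] at h2
    simpa using h2
  have hm0 : 0 ≤ min (k : ℝ) (Real.logb 2 n) := by
    apply le_min hkpos.le
    apply Real.logb_nonneg (by norm_num)
    exact_mod_cast (by omega : 1 ≤ n)
  set m := min (k : ℝ) (Real.logb 2 n) with hm
  obtain ⟨l, hl⟩ : ∃ l : ℕ, l = min ⌊δ * k / 2⌋₊ (Nat.log 2 n - 1) := ⟨_, rfl⟩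
  rcases Nat.eq_zero_or_pos l with hl0 | hlpos
  · -- trivial case
    have hmle : m * δ ≤ 2 := by
      rw [hl0] at hl
      rcases min_eq_iff.1 hl.symm with ⟨h, _⟩ | ⟨h, _⟩
      · rw [Nat.floor_eq_zero] at h
        have : m ≤ k := min_le_left _ _
        nlinarith
      · have h2 : m ≤ Nat.log 2 n + 1 := (min_le_right _ _).trans hlog
        have h3 : (Nat.log 2 n : ℝ) ≤ 1 := by exact_mod_cast (by omega : Nat.log 2 n ≤ 1)
        nlinarith
    refine ⟨[1], by simp; omega, RB.OPT_ge k hk1 [1] 1 (by simp), ?_⟩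
    have hO1 : (1 : ℝ) ≤ OPT K [1] := by exact_mod_cast RB.OPT_ge K hK1 [1] 1 (by simp)
    have hO2 : (OPT k [1] : ℝ) ≤ 1 := by
      have : OPT k [1] ≤ 1 := by
        refine (RB.OPT_le k [1] 1 (fun t => by simp only [Equiv.Perm.coe_one, id]; omega)).trans ?_
        simp [serviceCost, walkCost, natDist, List.finRange]
      exact_mod_cast this
    have hc : δ ^ 2 / (32 * B) * m ≤ 1 := by
      rw [div_mul_eq_mul_div, div_le_one (by positivity)]
      nlinarith
    have h0' : (0 : ℝ) ≤ OPT k [1] := Nat.cast_nonneg _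
    have : 0 ≤ δ ^ 2 / (32 * B) * m := by positivity
    nlinarith
  · -- main case
    have hlk : (l : ℝ) ≤ δ * k / 2 := by
      have : l ≤ ⌊δ * (k : ℝ) / 2⌋₊ := hl ▸ min_le_left _ _
      exact (Nat.cast_le.2 this).trans (Nat.floor_le (by positivity))
    have hlk' : l < k := by
      have : (l : ℝ) < k := by nlinarith
      exact_mod_cast this
    have hln : l ≤ Nat.log 2 n - 1 := hl ▸ min_le_right _ _
    have hlm : δ / 4 * m ≤ l := by
      rcases min_choice ⌊δ * (k : ℝ) / 2⌋₊ (Nat.log 2 n - 1) with h | h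
      · rw [h] at hl
        have h2 := Nat.lt_floor_add_one (δ * (k : ℝ) / 2)
        rw [← hl] at h2
        have h3 : (1 : ℝ) ≤ l := by exact_mod_cast hlpos
        have : m ≤ k := min_le_left _ _
        nlinarith
      · rw [h] at hl
        have h2 : m ≤ Nat.log 2 n + 1 := (min_le_right _ _).trans hlog
        have h3 : (Nat.log 2 n : ℝ) = l + 1 := by exact_mod_cast (by omega : Nat.log 2 n = l + 1)
        have h4 : (1 : ℝ) ≤ l := by exact_mod_cast hlpos
        nlinarith
    have hpow : 2 ^ l < n := by
      calc 2 ^ l < 2 ^ Nat.log 2 n := Nat.pow_lt_pow_right (by norm_num) (by omega)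
        _ ≤ n := Nat.pow_log_le_self 2 (by omega)
    obtain ⟨a, haeq⟩ : ∃ a, a = (k - 1) / l := ⟨_, rfl⟩
    have ha : 0 < a := by rw [haeq]; exact Nat.div_pos (by omega) hlpos
    have hal : a * l + 1 ≤ k := by
      have := Nat.div_mul_le_self (k - 1) l
      rw [← haeq] at this
      omega
    have hal2 : k ≤ a * l + l := by
      have := Nat.div_add_mod' (k - 1) l
      have := Nat.mod_lt (k - 1) hlpos
      rw [← haeq] at *
      omega
    obtain ⟨σ, hσ, hpos, hup, hlow⟩ := RB.exists_seq a l K k ha hlpos hK1 hal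
    refine ⟨σ, fun x hx => lt_of_le_of_lt (hσ x hx) hpow, hpos, ?_⟩
    have hlowB : (B : ℝ) * (a * l * 2 ^ l) ≤
        B * (K * 2 ^ l) + (a * l * 2 ^ l + 2 * B * B * a * OPT K σ) := by
      exact_mod_cast hlow B
    have hupR : (OPT k σ : ℝ) ≤ 2 ^ l := by exact_mod_cast hup
    have halR : (a : ℝ) * l ≤ k := by exact_mod_cast (by omega : a * l ≤ k)
    have hal2R : (k : ℝ) ≤ a * l + l := by exact_mod_cast hal2
    have haR : (0 : ℝ) < a := by exact_mod_cast ha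
    have hlR : (0 : ℝ) < l := by exact_mod_cast hlpos
    have hLpos : (0 : ℝ) < 2 ^ l := by positivity
    set L : ℝ := 2 ^ l with hL
    set O : ℝ := (OPT K σ : ℝ) with hO
    -- a l - K ≥ δ k / 2
    have e1 : δ * k / 2 ≤ a * l - K := by linarith
    have e2 : B * δ * (a * l) / 4 ≤ B * (a * l - K) - a * l := by
      have t1 : B * (δ * k / 2) ≤ B * (a * l - K) := mul_le_mul_of_nonneg_left e1 hB0.le
      have t2 : B * δ * (a * l) ≤ B * δ * k := mul_le_mul_of_nonneg_left halR (by positivity)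
      have t3 : 4 * (a * l) ≤ B * δ * (a * l) := mul_le_mul_of_nonneg_right hBδ (by positivity)
      linarith
    have e3 : L * (B * δ * (a * l) / 4) ≤ 2 * B * B * a * O := by
      have := mul_le_mul_of_nonneg_left e2 hLpos.le
      linarith
    have e4 : L * (δ * l / (8 * B)) ≤ O := by
      have hpos' : (0 : ℝ) < 2 * B * B * a := by positivity
      refine le_of_mul_le_mul_left ?_ hpos'
      calc 2 * B * B * a * (L * (δ * l / (8 * B))) = L * (B * δ * (a * l) / 4) := by
            field_simp; ring
        _ ≤ _ := e3
    calc δ ^ 2 / (32 * B) * m * (OPT k σ : ℝ) ≤ δ ^ 2 / (32 * B) * m * L :=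
          mul_le_mul_of_nonneg_left hupR (by positivity)
      _ = L * (δ * (δ / 4 * m) / (8 * B)) := by field_simp; ring
      _ ≤ L * (δ * l / (8 * B)) := by gcongr
      _ ≤ O := e4
end

section
/- Fix integers 0 < ℓ' < ℓ and a constant ε ∈ (0,1) such that ℓ' = (1−ε)·ℓ. On the line of 2^ℓ + 1 equidistant sites there exists a request sequence σ with OPT(ℓ, σ) > 0 and OPT(ℓ', σ) ≥ ℓ · ε² · (1+ε)^{−1} · (log₂(1 + 1/ε))^{−1} · OPT(ℓ, σ). -/
/-- telescoping bound -/
lemma tele (a d n : ℕ) :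
    ∑ i ∈ Finset.range n, (min d (2^i) - 2^i/2^a) ≤ a * d := by
  have h1 : ∑ i ∈ Finset.range n, (min d (2^i) - 2^i/2^a) + ∑ i ∈ Finset.range (n - a), min d (2^i)
      ≤ ∑ i ∈ Finset.range n, min d (2^i) := by
    induction n with
    | zero => simp
    | succ n ih =>
      rw [Finset.sum_range_succ, Finset.sum_range_succ (fun i => min d (2^i))]
      by_cases h : n < a
      · have e1 : n + 1 - a = 0 := by omega
        have e2 : n - a = 0 := by omega
        rw [e2] at ih
        rw [e1]
        simp only [Finset.range_zero, Finset.sum_empty] at *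
        generalize 2^n/2^a = x
        generalize 2^n = y
        omega
      · have e1 : n + 1 - a = (n - a) + 1 := by omega
        rw [e1, Finset.sum_range_succ]
        have e3 : 2^n / 2^a = 2^(n-a) := Nat.pow_div (by omega) (by norm_num)
        have e4 : 2^(n-a) ≤ 2^n := Nat.pow_le_pow_right (by norm_num) (by omega)
        rw [e3]
        omega
  have h2 : ∑ i ∈ Finset.range n, min d (2^i) ≤ ∑ i ∈ Finset.range (n - a), min d (2^i) + a * d := by
    clear h1
    by_cases h : n ≤ a
    · calc ∑ i ∈ Finset.range n, min d (2^i) ≤ ∑ i ∈ Finset.range n, d :=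
              Finset.sum_le_sum (fun i _ => min_le_left _ _)
          _ = n * d := by simp
          _ ≤ a * d := Nat.mul_le_mul_right _ h
          _ ≤ _ := by omega
    · obtain ⟨b, rfl⟩ : ∃ b, n = b + a := ⟨n - a, by omega⟩
      rw [Nat.add_sub_cancel, Finset.sum_range_add]
      apply Nat.add_le_add_left
      calc ∑ i ∈ Finset.range a, min d (2^(b+i)) ≤ ∑ i ∈ Finset.range a, d :=
              Finset.sum_le_sum (fun i _ => min_le_left _ _)
          _ = a * d := by simp
  omega

/-- tail counting in one level -/
lemma tail_count (i a n : ℕ) :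
    ((Finset.range (2^i * n)).filter (fun t => (2^i - t % 2^i) * 2^a ≤ 2^i)).card * 2^a ≤ 2^i * n := by
  induction n with
  | zero => simp
  | succ n ih =>
    have hp : 0 < 2^i := by positivity
    have hsub : (Finset.range (2^i * (n+1))).filter (fun t => (2^i - t % 2^i) * 2^a ≤ 2^i) ⊆
      (Finset.range (2^i * n)).filter (fun t => (2^i - t % 2^i) * 2^a ≤ 2^i) ∪
      (Finset.Icc 1 (2^i/2^a)).image (fun r => 2^i * (n+1) - r) := by
      intro t ht
      simp only [Finset.mem_union, Finset.mem_filter, Finset.mem_range, Finset.mem_image,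
        Finset.mem_Icc] at *
      obtain ⟨h1, h2⟩ := ht
      by_cases h : t < 2^i * n
      · exact Or.inl ⟨h, h2⟩
      · right
        have e : t % 2^i = t - 2^i * n := by
          have : t = (t - 2^i * n) + 2^i * n := by omega
          conv_lhs => rw [this]
          rw [Nat.add_mul_mod_self_left]
          apply Nat.mod_eq_of_lt
          rw [mul_add] at h1
          omega
        refine ⟨2^i - t % 2^i, ⟨?_, ?_⟩, ?_⟩
        · have := Nat.mod_lt t hp; omega
        · rw [Nat.le_div_iff_mul_le (by positivity)]; exact h2
        · rw [e]; rw [mul_add] at *; omega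
    have hc := (Finset.card_le_card hsub).trans (Finset.card_union_le _ _)
    have hc2 : ((Finset.Icc 1 (2^i/2^a)).image (fun r => 2^i * (n+1) - r)).card ≤ 2^i/2^a := by
      refine Finset.card_image_le.trans ?_
      simp
    have h3 : 2^i/2^a * 2^a ≤ 2^i := Nat.div_mul_le_self _ _
    calc _ ≤ (_ + _) * 2^a := Nat.mul_le_mul_right _ (hc.trans (Nat.add_le_add_left hc2 _))
      _ ≤ _ := by rw [add_mul, mul_add]; omega

/-- saved predicate -/
def Saved (d : ℕ → ℕ) (t i : ℕ) : Prop :=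
  ∃ j, (t/2^i)*2^i ≤ j ∧ j ≤ t ∧ (t/2^i+1)*2^i ≤ j + d j

open Classical in
lemma comb (T L a m : ℕ) (d : ℕ → ℕ) (hT : ∀ i < L, 2^i ∣ T)
    (h : ∀ t < T, m ≤ ((Finset.range L).filter (Saved d t)).card) :
    2^a * (m * T) ≤ 2^a * (a * ∑ j ∈ Finset.range T, d j) + L * T := by
  set X := (Finset.range T ×ˢ Finset.range L).filter (fun p => Saved d p.1 p.2) with hX
  have h1 : m * T ≤ X.card := by
    have : X.card = ∑ t ∈ Finset.range T, ((Finset.range L).filter (Saved d t)).card := by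
      rw [hX, Finset.card_filter, Finset.sum_product]
      exact Finset.sum_congr rfl fun t _ => (Finset.card_filter _ _).symm
    rw [this]
    calc m * T = ∑ t ∈ Finset.range T, m := by simp [mul_comm]
      _ ≤ _ := Finset.sum_le_sum (fun t ht => h t (Finset.mem_range.1 ht))
  let tail : ℕ → ℕ → Prop := fun i t => (2^i - t % 2^i) * 2^a ≤ 2^i
  let Y : Finset (ℕ × ℕ) := (Finset.range L).biUnion (fun i =>
    ((Finset.range T).filter (fun t => (2^i - t % 2^i) * 2^a ≤ 2^i)).image (fun t => (t, i)))
  let Z : Finset (ℕ × ℕ) := (Finset.range T).biUnion (fun j => (Finset.range L).biUnion (fun i =>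
    (Finset.Ioc (2^i/2^a) (min (d j) (2^i))).image (fun x => ((j/2^i+1)*2^i - x, i))))
  have hsub : X ⊆ Y ∪ Z := by
    rintro ⟨t, i⟩ hti
    simp only [hX, Finset.mem_filter, Finset.mem_product, Finset.mem_range] at hti
    obtain ⟨⟨ht, hi⟩, j, hj1, hj2, hj3⟩ := hti
    rw [Finset.mem_union]
    by_cases htl : (2^i - t % 2^i) * 2^a ≤ 2^i
    · left
      simp only [Y, Finset.mem_biUnion, Finset.mem_image, Finset.mem_filter, Finset.mem_range]
      exact ⟨i, hi, t, ⟨ht, htl⟩, rfl⟩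
    · right
      have hp : 0 < 2^i := by positivity
      have hmod := Nat.mod_lt t hp
      have hdm := Nat.div_add_mod' t (2^i)
      have hq : j / 2^i = t / 2^i := by
        apply le_antisymm (Nat.div_le_div_right hj2)
        rw [Nat.le_div_iff_mul_le hp]; exact hj1
      simp only [Z, Finset.mem_biUnion, Finset.mem_image, Finset.mem_Ioc, Finset.mem_range]
      refine ⟨j, by omega, i, hi, 2^i - t % 2^i, ⟨?_, ?_⟩, ?_⟩
      · rw [Nat.div_lt_iff_lt_mul (by positivity)]; omega
      · rw [le_min_iff]
        rw [add_mul] at hj3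
        constructor <;> omega
      · rw [hq, add_mul]
        congr 1
        omega
  have hY : 2^a * Y.card ≤ L * T := by
    have : Y.card ≤ ∑ i ∈ Finset.range L, ((Finset.range T).filter (fun t => (2^i - t % 2^i) * 2^a ≤ 2^i)).card :=
      Finset.card_biUnion_le.trans (Finset.sum_le_sum fun i _ => Finset.card_image_le)
    calc 2^a * Y.card ≤ 2^a * _ := Nat.mul_le_mul_left _ this
      _ = ∑ i ∈ Finset.range L, ((Finset.range T).filter (fun t => (2^i - t % 2^i) * 2^a ≤ 2^i)).card * 2^a := by
        rw [Finset.mul_sum]; exact Finset.sum_congr rfl fun _ _ => mul_comm _ _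
      _ ≤ ∑ i ∈ Finset.range L, T := by
        apply Finset.sum_le_sum
        intro i hi
        obtain ⟨n, rfl⟩ := hT i (Finset.mem_range.1 hi)
        exact tail_count i a n
      _ = L * T := by simp
  have hZ : Z.card ≤ a * ∑ j ∈ Finset.range T, d j := by
    rw [Finset.mul_sum]
    refine Finset.card_biUnion_le.trans (Finset.sum_le_sum fun j _ => ?_)
    refine Finset.card_biUnion_le.trans ?_
    refine le_trans (Finset.sum_le_sum fun i _ => Finset.card_image_le) ?_
    simpa using tele a (d j) L
  have h2 := (Finset.card_le_card hsub).trans (Finset.card_union_le _ _)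
  calc 2^a * (m * T) ≤ 2^a * (Y.card + Z.card) := Nat.mul_le_mul_left _ (h1.trans h2)
    _ ≤ _ := by
      rw [mul_add]
      have := Nat.mul_le_mul_left (2^a) hZ
      omega

/-- the request at arrival index `x` -/
def req (L W x : ℕ) : ℕ :=
  if x % W < L ∧ 2^(x % W) ∣ x / W then x / W + 2^(x % W) else x / W

lemma le_req (L W x : ℕ) : x / W ≤ req L W x := by
  unfold req; split_ifs <;> omega

lemma inv_count (L W y : ℕ) :
    ((Finset.range y).filter (fun x => req L W y < req L W x)).card ≤ L := by
  have key : ∀ x ∈ (Finset.range y).filter (fun x => req L W y < req L W x),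
      x % W < L ∧ x / W = (y / W) / 2^(x % W) * 2^(x % W) := by
    intro x hx
    simp only [Finset.mem_filter, Finset.mem_range] at hx
    obtain ⟨h1, h2⟩ := hx
    have h3 : x / W ≤ y / W := Nat.div_le_div_right h1.le
    have h4 := le_req L W y
    have h5 : y / W < req L W x := by omega
    unfold req at h5
    split_ifs at h5 with h
    · refine ⟨h.1, ?_⟩
      obtain ⟨c, hc⟩ := h.2
      have hp : 0 < 2^(x % W) := by positivity
      generalize 2^(x % W) = p at *
      generalize x / W = u at *
      subst hc
      have : y / W / p = c := by
        apply Nat.div_eq_of_lt_le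
        · rw [mul_comm]; exact h3
        · rw [add_mul, mul_comm c p]; omega
      rw [this, mul_comm]
    · omega
  have := Finset.card_le_card_of_injOn (s := (Finset.range y).filter (fun x => req L W y < req L W x))
    (t := Finset.range L) (fun x => x % W) (fun x hx => Finset.mem_coe.2 (Finset.mem_range.2 (key x hx).1)) (by
      intro x hx x' hx' he
      have k1 := (key x hx).2
      have k2 := (key x' hx').2
      simp only at he
      rw [he] at k1
      rw [← Nat.div_add_mod x W, ← Nat.div_add_mod x' W, k1, k2, he])
  simpa using this

lemma req_le (L W T x : ℕ) (hT : ∀ i < L, 2^i ∣ T) (hx : x < T * W) : req L W x ≤ T := by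
  have hW : 0 < W := by
    rcases Nat.eq_zero_or_pos W with h | h
    · simp [h] at hx
    · exact h
  have h1 : x / W < T := by rwa [Nat.div_lt_iff_lt_mul hW]
  unfold req
  split_ifs with h
  · obtain ⟨c, hc⟩ := h.2
    obtain ⟨e, he⟩ := hT _ h.1
    have : c < e := by
      refine lt_of_mul_lt_mul_left (a := 2^(x % W)) ?_ (Nat.zero_le _)
      rw [← hc, ← he]; exact h1
    rw [hc]
    calc _ = 2^(x % W) * (c+1) := by ring
      _ ≤ 2^(x % W) * e := Nat.mul_le_mul_left _ this
      _ = T := he.symm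
  · omega

lemma walk_sorted (T : ℕ) (l : List ℕ) : ∀ s, s ≤ T → (∀ x ∈ l, s ≤ x ∧ x ≤ T) →
    l.Pairwise (· ≤ ·) → walkCost s l + s ≤ T := by
  induction l with
  | nil => intro s hs _ _; simpa [walkCost] using hs
  | cons x l ih =>
    intro s hs h hp
    rw [List.pairwise_cons] at hp
    have hx := h x (by simp)
    have := ih x hx.2 (fun y hy => ⟨hp.1 y hy, (h y (by simp [hy])).2⟩) hp.2
    simp only [walkCost, natDist]
    omega

lemma perm_bound (N L : ℕ) (F : ℕ → ℕ)
    (h : ∀ y, ((Finset.range y).filter (fun x => F y < F x)).card ≤ L) :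
    ∀ s : Fin N, ((Tuple.sort (fun i : Fin N => F i)) s : ℕ) ≤ s + L := by
  intro s
  set π := Tuple.sort (fun i : Fin N => F i) with hπ
  obtain ⟨hm, hs⟩ := Tuple.eq_sort_iff.1 hπ
  have hsub : Finset.range (π s) ⊆
      (Finset.univ.filter (fun r : Fin N => r < s)).image (fun r => (π r : ℕ)) ∪
      (Finset.range (π s)).filter (fun x => F (π s) < F x) := by
    intro x hx
    have hx' := Finset.mem_range.1 hx
    have hxN : x < N := hx'.trans (π s).2
    rw [Finset.mem_union]
    have hr : π (π.symm ⟨x, hxN⟩) = ⟨x, hxN⟩ := by simp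
    generalize π.symm ⟨x, hxN⟩ = r at hr
    by_cases hrs : r < s
    · left
      rw [Finset.mem_image]
      exact ⟨r, by simpa using hrs, by rw [hr]⟩
    · right
      rw [Finset.mem_filter]
      refine ⟨hx, ?_⟩
      have hne : s ≠ r := by
        rintro rfl
        rw [hr] at hx'; simp at hx'
      have hlt : s < r := lt_of_le_of_ne (not_lt.1 hrs) hne
      have h1 := hm hlt.le
      simp only [Function.comp, hr] at h1
      refine lt_of_le_of_ne h1 ?_
      intro he
      have := hs s r hlt (by simp only [hr]; exact he)
      rw [hr, Fin.lt_def] at this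
      have h9 : (π s : ℕ) < x := this
      omega
  have h1 := (Finset.card_le_card hsub).trans (Finset.card_union_le _ _)
  have h2 : ((Finset.univ.filter (fun r : Fin N => r < s)).image (fun r => (π r : ℕ))).card ≤ s := by
    refine Finset.card_image_le.trans (le_of_eq ?_)
    have : Finset.univ.filter (fun r : Fin N => r < s) = Finset.Iio s := by ext; simp
    rw [this, Fin.card_Iio]
  have h3 := h (π s)
  rw [Finset.card_range] at h1
  omega

/-- the request sequence -/
def seq (L W T : ℕ) : List ℕ := (List.range (T * W)).map (req L W)

lemma seq_length (L W T : ℕ) : (seq L W T).length = T * W := by simp [seq]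

lemma seq_get (L W T : ℕ) (i : Fin (seq L W T).length) : (seq L W T).get i = req L W i := by
  rw [List.get_eq_getElem]
  simp only [seq, List.getElem_map, List.getElem_range]

lemma opt_upper (L W T : ℕ) (hT : ∀ i < L, 2^i ∣ T) : OPT (L+1) (seq L W T) ≤ T := by
  set σ := seq L W T with hσ
  let π : Equiv.Perm (Fin σ.length) := Tuple.sort (fun i => req L W i)
  have h1 : IsServiceOrder (L+1) σ.length π := by
    intro t
    exact perm_bound σ.length L (req L W) (inv_count L W) t
  have h2 : serviceCost σ π ≤ T := by
    unfold serviceCost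
    have := walk_sorted T ((List.finRange σ.length).map fun t => σ.get (π t)) 0 (Nat.zero_le _) ?_ ?_
    · omega
    · intro x hx
      simp only [List.mem_map] at hx
      obtain ⟨t, _, rfl⟩ := hx
      refine ⟨Nat.zero_le _, ?_⟩
      show (seq L W T).get _ ≤ _
      rw [seq_get]
      apply req_le _ _ _ _ hT
      have := (π t).2
      rw [← seq_length L]; exact this
    · rw [List.pairwise_map]
      have : (List.finRange σ.length).Pairwise (· < ·) := List.pairwise_lt_finRange _
      refine this.imp ?_
      intro a b hab
      have := Tuple.monotone_sort (fun i : Fin σ.length => req L W i) hab.le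
      show (seq L W T).get _ ≤ (seq L W T).get _
      rw [seq_get, seq_get]
      exact this
  have h3 : OPT (L+1) σ ≤ serviceCost σ π := Nat.sInf_le ⟨π, h1, rfl⟩
  exact h3.trans h2

lemma opt_mem (k : ℕ) (hk : 0 < k) (σ : List ℕ) :
    ∃ π : Equiv.Perm (Fin σ.length), IsServiceOrder k σ.length π ∧ serviceCost σ π = OPT k σ := by
  have : OPT k σ ∈ {c | ∃ π : Equiv.Perm (Fin σ.length), IsServiceOrder k σ.length π ∧ serviceCost σ π = c} := by
    apply Nat.sInf_mem
    refine ⟨serviceCost σ (Equiv.refl _), Equiv.refl _, ?_, rfl⟩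
    intro t
    simp; omega
  exact this

/-- path position at time `v` -/
def pathPos (x : ℕ) (l : List ℕ) (v : ℕ) : ℕ := (x :: l).getD v 0

lemma walk_eq (l : List ℕ) : ∀ x, walkCost x l =
    ∑ v ∈ Finset.range l.length, natDist (pathPos x l v) (pathPos x l (v+1)) := by
  induction l with
  | nil => intro x; simp [walkCost]
  | cons y l ih =>
    intro x
    rw [List.length_cons, Finset.sum_range_succ', walkCost, ih y, add_comm]
    rfl

lemma natDist_tri (a b c : ℕ) : natDist a c ≤ natDist a b + natDist b c := by
  unfold natDist; omega

lemma sum_dist (P : ℕ → ℕ) (x y : ℕ) (h : x ≤ y) :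
    ∑ v ∈ Finset.range x, natDist (P v) (P (v+1)) + natDist (P x) (P y) ≤
    ∑ v ∈ Finset.range y, natDist (P v) (P (v+1)) := by
  induction y, h using Nat.le_induction with
  | base => simp [natDist]
  | succ y h ih =>
    rw [Finset.sum_range_succ _ y]
    have := natDist_tri (P x) (P y) (P (y+1))
    omega

lemma path_lower (P U d : ℕ → ℕ) (T : ℕ) (hU : ∀ j < T, U j < U (j+1))
    (hP : ∀ j ≤ T, P (U j) ≤ j) (hP2 : ∀ j < T, P (U (j+1)) = j)
    (hd : ∀ j < T, d j = (Finset.Ioc (U j) (U (j+1))).sup (fun v => P v - j)) :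
    2 * ∑ j ∈ Finset.range T, d j ≤ ∑ v ∈ Finset.range (U T), natDist (P v) (P (v+1)) := by
  induction T with
  | zero => simp
  | succ T ih =>
    have ih := ih (fun j hj => hU j (by omega)) (fun j hj => hP j (by omega))
      (fun j hj => hP2 j (by omega)) (fun j hj => hd j (by omega))
    rw [Finset.sum_range_succ]
    have hu := hU T (by omega)
    obtain ⟨v, hv, hv2⟩ := Finset.exists_mem_eq_sup (Finset.Ioc (U T) (U (T+1)))
      ⟨U (T+1), by simp [hu]⟩ (fun v => P v - T)
    rw [← hd T (by omega)] at hv2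
    rw [Finset.mem_Ioc] at hv
    have h1 := sum_dist P (U T) v hv.1.le
    have h2 := sum_dist P v (U (T+1)) hv.2
    have h3 := hP T (by omega)
    have h4 := hP2 T (by omega)
    rw [h4] at h2
    unfold natDist at *
    omega

/-- in each phase, some request of the long block is served early -/
lemma block_exists (k L W T N t : ℕ) (g : ℕ → ℕ) (hW : W = L + (L + 1)) (hk : k ≤ L + 1)
    (hN : N = T * W) (ht : t < T) (hk0 : 0 < k)
    (ginj : ∀ s < N, ∀ s' < N, g s = g s' → s = s')
    (hg : ∀ s < N, g s + 1 ≤ s + k) :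
    ∃ s, s < N ∧ s + k ≤ (t + 1) * W ∧ t * W + L ≤ g s ∧ g s < (t + 1) * W := by
  by_contra hcon
  push Not at hcon
  have h1 : (t + 1) * W ≤ N := by rw [hN]; exact Nat.mul_le_mul_right _ ht
  have h2 : (t + 1) * W = t * W + L + (L + 1) := by rw [hW]; ring
  have := Finset.card_le_card_of_injOn (s := Finset.range ((t + 1) * W - k + 1))
    (t := Finset.range (t * W + L)) g (by
      intro s hs
      have hs := Finset.mem_range.1 (Finset.mem_coe.1 hs)
      apply Finset.mem_coe.2
      rw [Finset.mem_range]
      have h3 := hg s (by omega)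
      by_contra h4
      have := hcon s (by omega) (by omega) (by omega)
      omega) (by
      intro s hs s' hs' he
      have hs := Finset.mem_range.1 (Finset.mem_coe.1 hs)
      have hs' := Finset.mem_range.1 (Finset.mem_coe.1 hs')
      exact ginj s (by omega) s' (by omega) he)
  simp only [Finset.card_range] at this
  omega

lemma req_level (L W p i : ℕ) (hi : i < L) (hW : L < W) (hp : 2^i ∣ p) :
    req L W (p * W + i) = p + 2^i := by
  have h1 : (p * W + i) % W = i := by
    rw [mul_comm, Nat.mul_add_mod, Nat.mod_eq_of_lt (by omega)]
  have h2 : (p * W + i) / W = p := by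
    rw [mul_comm, Nat.mul_add_div (by omega), Nat.div_eq_of_lt (by omega)]; omega
  unfold req
  rw [h1, h2, if_pos ⟨hi, hp⟩]

lemma req_block (L W t x : ℕ) (h1 : t * W + L ≤ x) (h2 : x < (t + 1) * W) :
    req L W x = t := by
  have hW : 0 < W := by
    rcases Nat.eq_zero_or_pos W with h | h
    · simp [h] at h2
    · exact h
  have h3 : x / W = t := Nat.div_eq_of_lt_le (by omega) h2
  have h4 := Nat.div_add_mod' x W
  rw [h3] at h4
  unfold req
  rw [if_neg, h3]
  omega

open Classical in
lemma lower (k L W T N a : ℕ) (g h P : ℕ → ℕ) (hW : W = L + (L + 1)) (hk : k ≤ L + 1)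
    (hN : N = T * W) (hk0 : 0 < k) (hT : ∀ i < L, 2^i ∣ T)
    (gN : ∀ s < N, g s < N) (hhN : ∀ s < N, h s < N)
    (hgh : ∀ s < N, h (g s) = s) (hhg : ∀ s < N, g (h s) = s)
    (hg : ∀ s < N, g s + 1 ≤ s + k)
    (hP0 : P 0 = 0) (hP : ∀ s < N, P (s+1) = req L W (g s)) :
    2 * (2^a * ((L + 1 - k) * T)) ≤
      2^a * (a * ∑ v ∈ Finset.range N, natDist (P v) (P (v+1))) + 2 * (L * T) := by
  have ginj : ∀ s < N, ∀ s' < N, g s = g s' → s = s' := by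
    intro s hs s' hs' e
    rw [← hgh s hs, e, hgh s' hs']
  have hex : ∀ t, ∃ s, t < T → s < N ∧ s + k ≤ (t + 1) * W ∧ t * W + L ≤ g s ∧ g s < (t + 1) * W := by
    intro t
    by_cases ht : t < T
    · obtain ⟨s, hs⟩ := block_exists k L W T N t g hW hk hN ht hk0 ginj hg
      exact ⟨s, fun _ => hs⟩
    · exact ⟨0, fun h => absurd h ht⟩
  choose S hS using hex
  let U : ℕ → ℕ := fun j => if j = 0 then 0 else S (j-1) + 1
  have U0 : U 0 = 0 := rfl
  have US : ∀ j, U (j+1) = S j + 1 := fun j => rfl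
  let d : ℕ → ℕ := fun j => (Finset.Ioc (U j) (U (j+1))).sup (fun v => P v - j)
  have hU : ∀ j < T, U j < U (j+1) := by
    intro j hj
    rcases j with _ | j
    · rw [U0, US]; omega
    · rw [US, US]
      have h1 := hS j (by omega)
      have h2 := hS (j+1) hj
      have h3 := hg _ h2.1
      omega
  have hP2 : ∀ j < T, P (U (j+1)) = j := by
    intro j hj
    have h1 := hS j hj
    rw [US, hP _ h1.1]
    exact req_block _ _ _ _ h1.2.2.1 h1.2.2.2
  have hP1 : ∀ j ≤ T, P (U j) ≤ j := by
    intro j hj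
    rcases j with _ | j
    · rw [U0, hP0]
    · rw [hP2 j (by omega)]; omega
  have hlow := path_lower P U d T hU hP1 hP2 (fun j _ => rfl)
  have hUT : U T ≤ N := by
    rcases Nat.eq_zero_or_pos T with h0 | h0
    · rw [h0, U0]; omega
    · obtain ⟨T', rfl⟩ : ∃ T', T = T' + 1 := ⟨T - 1, by omega⟩
      rw [US]
      have := (hS T' (by omega)).1
      omega
  have hlow2 := sum_dist P (U T) N hUT
  have hcomb := comb T L a (L + 1 - k) d hT (by
    intro t ht
    obtain ⟨s1, s2, s3, s4⟩ := hS t ht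
    have s5 := hg _ s1
    let idx : ℕ → ℕ := fun i => (t / 2^i * 2^i) * W + i
    have hidx : ∀ i < L, idx i < t * W + L := by
      intro i hi
      have h1 : t / 2^i * 2^i ≤ t := Nat.div_mul_le_self _ _
      have h2 : (t / 2^i * 2^i) * W ≤ t * W := Nat.mul_le_mul_right _ h1
      simp only [idx]; omega
    have hidxN : ∀ i < L, idx i < N := by
      intro i hi
      have := hidx i hi
      have := gN _ s1
      omega
    -- served levels are saved
    have hsaved : ∀ i < L, h (idx i) < S t → Saved d t i := by
      intro i hi hlt
      have hb := hidxN i hi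
      have hv := hhN _ hb
      have hgv := hhg _ hb
      have hPv := hP _ hv
      rw [hgv, req_level L W _ i hi (by omega) (Dvd.intro_left _ rfl)] at hPv
      have hexj : ∃ j, h (idx i) + 1 ≤ U (j+1) := ⟨t, by rw [US]; omega⟩
      let j := Nat.find hexj
      have hj : h (idx i) + 1 ≤ U (j+1) := Nat.find_spec hexj
      have hjt : j ≤ t := Nat.find_min' hexj (by rw [US]; omega)
      have hj2 : U j < h (idx i) + 1 := by
        rcases hj0 : j with _ | j'
        · rw [U0]; omega
        · have := Nat.find_min hexj (m := j') (by show j' < j; omega)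
          omega
      refine ⟨j, ?_, hjt, ?_⟩
      · by_contra hlt2
        push Not at hlt2
        have q1 := hS j (by omega)
        have q2 : (j + 1) * W ≤ (t / 2^i * 2^i) * W := Nat.mul_le_mul_right _ hlt2
        have q3 := hg _ hv
        rw [hgv] at q3
        rw [US] at hj
        have q4 : (t / 2^i * 2^i) * W ≤ idx i := by simp only [idx]; omega
        omega
      · have : P (h (idx i) + 1) - j ≤ d j :=
          Finset.le_sup (f := fun v => P v - j) (Finset.mem_Ioc.2 ⟨hj2, hj⟩)
        rw [hPv] at this
        rw [add_mul, one_mul]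
        omega
    -- count of unserved levels
    have hun : ((Finset.range L).filter (fun i => ¬ h (idx i) < S t)).card ≤ k - 1 := by
      have hdis : Disjoint (((Finset.range L).filter (fun i => ¬ h (idx i) < S t)).image idx)
          ((Finset.range (S t + 1)).image g) := by
        rw [Finset.disjoint_left]
        intro x hx hx'
        simp only [Finset.mem_image, Finset.mem_filter, Finset.mem_range] at hx hx'
        obtain ⟨i, ⟨hi, hi2⟩, rfl⟩ := hx
        obtain ⟨s, hs, hs2⟩ := hx'
        have e1 : h (idx i) = s := by rw [← hs2]; exact hgh s (by omega)
        have e2 : s = S t := by omega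
        have := hidx i hi
        rw [e2] at hs2
        omega
      have hsub : (((Finset.range L).filter (fun i => ¬ h (idx i) < S t)).image idx) ∪
          ((Finset.range (S t + 1)).image g) ⊆ Finset.range (S t + k) := by
        intro x hx
        simp only [Finset.mem_union, Finset.mem_image, Finset.mem_filter, Finset.mem_range] at hx ⊢
        rcases hx with ⟨i, ⟨hi, _⟩, rfl⟩ | ⟨s, hs, rfl⟩
        · have := hidx i hi; omega
        · have := hg s (by omega); omega
      have hc := Finset.card_le_card hsub
      rw [Finset.card_union_of_disjoint hdis, Finset.card_image_of_injOn,
        Finset.card_image_of_injOn] at hc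
      · simp only [Finset.card_range] at hc
        omega
      · intro s hs s' hs' he
        have hs := Finset.mem_range.1 (Finset.mem_coe.1 hs)
        have hs' := Finset.mem_range.1 (Finset.mem_coe.1 hs')
        exact ginj s (by omega) s' (by omega) he
      · intro i hi i' hi' he
        have hi := Finset.mem_range.1 (Finset.mem_filter.1 (Finset.mem_coe.1 hi)).1
        have hi' := Finset.mem_range.1 (Finset.mem_filter.1 (Finset.mem_coe.1 hi')).1
        have h1 : idx i % W = i := by
          simp only [idx]
          rw [mul_comm, Nat.mul_add_mod, Nat.mod_eq_of_lt (by omega)]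
        have h2 : idx i' % W = i' := by
          simp only [idx]
          rw [mul_comm, Nat.mul_add_mod, Nat.mod_eq_of_lt (by omega)]
        rw [← h1, ← h2, he]
    have hsplit := Finset.card_filter_add_card_filter_not (s := Finset.range L) (fun i => h (idx i) < S t)
    rw [Finset.card_range] at hsplit
    have hle : ((Finset.range L).filter (fun i => h (idx i) < S t)).card ≤
        ((Finset.range L).filter (Saved d t)).card := by
      apply Finset.card_le_card
      intro i hi
      rw [Finset.mem_filter, Finset.mem_range] at hi ⊢
      exact ⟨hi.1, hsaved i hi.1 hi.2⟩
    omega)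
  have hfin : 2 * ∑ j ∈ Finset.range T, d j ≤ ∑ v ∈ Finset.range N, natDist (P v) (P (v+1)) := by
    omega
  calc 2 * (2^a * ((L + 1 - k) * T)) ≤ 2 * (2^a * (a * ∑ j ∈ Finset.range T, d j) + L * T) :=
        Nat.mul_le_mul_left _ hcomb
    _ = 2^a * (a * (2 * ∑ j ∈ Finset.range T, d j)) + 2 * (L * T) := by ring
    _ ≤ _ := by gcongr

lemma opt_lower (k L T a : ℕ) (hk : k ≤ L + 1) (hk0 : 0 < k) (hT : ∀ i < L, 2^i ∣ T) :
    2 * (2^a * ((L + 1 - k) * T)) ≤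
      2^a * (a * OPT k (seq L (L + (L + 1)) T)) + 2 * (L * T) := by
  set W := L + (L + 1) with hW
  obtain ⟨π, h1, h2⟩ := opt_mem k hk0 (seq L W T)
  obtain ⟨N, hN⟩ : ∃ N, N = (seq L W T).length := ⟨_, rfl⟩
  rw [← h2]
  set l := (List.finRange (seq L W T).length).map fun t => (seq L W T).get (π t) with hl
  have hlen : l.length = N := by simp [hl, hN]
  have hc : serviceCost (seq L W T) π =
      ∑ v ∈ Finset.range N, natDist (pathPos 0 l v) (pathPos 0 l (v+1)) := by
    rw [← hlen]; exact walk_eq l 0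
  rw [hc]
  refine lower k L W T N a (fun s => if hs : s < (seq L W T).length then π ⟨s, hs⟩ else s)
    (fun s => if hs : s < (seq L W T).length then π.symm ⟨s, hs⟩ else s) (pathPos 0 l) hW hk
    (by rw [hN, seq_length]) hk0 hT ?_ ?_ ?_ ?_ ?_ rfl ?_
  · intro s hs; rw [hN] at hs ⊢; simp only [hs, dif_pos]; exact (π ⟨s, hs⟩).2
  · intro s hs; rw [hN] at hs ⊢; simp only [hs, dif_pos]; exact (π.symm ⟨s, hs⟩).2
  · intro s hs
    rw [hN] at hs
    simp [hs]
  · intro s hs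
    rw [hN] at hs
    simp [hs]
  · intro s hs
    rw [hN] at hs
    have := h1 ⟨s, hs⟩
    simp only [hs, dif_pos] at this ⊢
    omega
  · intro s hs
    rw [hN] at hs
    simp only [hs, dif_pos]
    rw [← seq_get L W T (π ⟨s, hs⟩)]
    have hs' : s < l.length := by omega
    show (0 :: l).getD (s+1) 0 = _
    rw [List.getD_cons_succ, List.getD_eq_getElem _ _ hs']
    simp [hl]

lemma le_walk (l : List ℕ) : ∀ s x, x ∈ l → x ≤ s + walkCost s l := by
  induction l with
  | nil => intro s x hx; simp at hx
  | cons y l ih =>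
    intro s x hx
    simp only [walkCost]
    have hd : y ≤ s + natDist s y := by unfold natDist; omega
    rcases List.mem_cons.1 hx with rfl | hx
    · omega
    · have := ih y x hx; omega

lemma opt_pos (k : ℕ) (hk : 0 < k) (σ : List ℕ) (x : ℕ) (hx : x ∈ σ) (hx0 : 0 < x) : 0 < OPT k σ := by
  obtain ⟨π, _, h⟩ := opt_mem k hk σ
  rw [← h]
  have := le_walk ((List.finRange σ.length).map fun t => σ.get (π t)) 0 x (by
    obtain ⟨i, rfl⟩ := List.get_of_mem hx
    rw [List.mem_map]
    exact ⟨π.symm i, by simp, by simp⟩)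
  unfold serviceCost
  omega

theorem stmt1 (ℓ ℓ' : ℕ) (ε : ℝ) (hℓ'pos : 0 < ℓ') (hℓ'ℓ : ℓ' < ℓ)
    (hε : ε ∈ Set.Ioo (0 : ℝ) 1) (hℓ' : (ℓ' : ℝ) = (1 - ε) * (ℓ : ℝ)) :
    ∃ σ : List ℕ, (∀ x ∈ σ, x < 2 ^ ℓ + 1) ∧ 0 < OPT ℓ σ ∧
      (OPT ℓ' σ : ℝ) ≥
        (ℓ : ℝ) * ε ^ 2 * (1 + ε)⁻¹ * (Real.logb 2 (1 + 1 / ε))⁻¹ * (OPT ℓ σ : ℝ) := by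
  obtain ⟨L, rfl⟩ : ∃ L, ℓ = L + 1 := ⟨ℓ - 1, by omega⟩
  obtain ⟨e0, e1⟩ := hε
  have hT : ∀ i < L, 2^i ∣ 2^(L+1) := fun i hi => Nat.pow_dvd_pow 2 (by omega)
  set T := 2^(L+1) with hTdef
  have hTpos : 0 < T := by positivity
  set σ := seq L (L + (L + 1)) T with hσ
  refine ⟨σ, ?_, ?_, ?_⟩
  · intro x hx
    simp only [hσ, seq, List.mem_map, List.mem_range] at hx
    obtain ⟨y, hy, rfl⟩ := hx
    have := req_le L _ T y hT hy
    omega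
  · apply opt_pos (L+1) (by omega) σ 1 _ (by norm_num)
    simp only [hσ, seq, List.mem_map, List.mem_range]
    refine ⟨0 * (L + (L+1)) + 0, ?_, ?_⟩
    · simp only [zero_mul, add_zero]; exact Nat.mul_pos hTpos (by omega)
    · rw [req_level L _ 0 0 (by omega) (by omega) (by simp)]; norm_num
  · have hup := opt_upper L (L + (L+1)) T hT
    rw [← hσ] at hup
    set lg := Real.logb 2 (1 + 1/ε) with hlg
    have hx2 : (2:ℝ) ≤ 1 + 1/ε := by
      have : 1 ≤ 1/ε := by rw [le_div_iff₀ e0]; linarith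
      linarith
    have hlg1 : 1 ≤ lg := by
      rw [hlg, Real.le_logb_iff_rpow_le (by norm_num) (by linarith)]
      simpa using hx2
    set a := ⌈lg⌉₊ with ha
    have ha1 : lg ≤ a := Nat.le_ceil _
    have ha2 : (a:ℝ) ≤ 2 * lg := by
      have := Nat.ceil_lt_add_one (a := lg) (by linarith)
      linarith
    have ha3 : 1 + 1/ε ≤ (2:ℝ)^a := by
      rw [hlg, Real.logb_le_iff_le_rpow (by norm_num) (by linarith)] at ha1
      rwa [Real.rpow_natCast] at ha1
    have hlow := opt_lower ℓ' L T a (by omega) hℓ'pos hT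
    rw [← hσ] at hlow
    have hlowR : 2 * ((2:ℝ)^a * (ε * (L+1) * T)) ≤ 2^a * (a * OPT ℓ' σ) + 2 * (L * T) := by
      have h1 : ((L + 1 - ℓ' : ℕ) : ℝ) = ε * (L+1) := by
        rw [Nat.cast_sub (by omega), hℓ']; push_cast; ring
      rw [← h1]
      exact_mod_cast hlow
    have hTR : (0:ℝ) < T := by exact_mod_cast hTpos
    have hupR : (OPT (L+1) σ : ℝ) ≤ T := by exact_mod_cast hup
    set c : ℝ := ((OPT ℓ' σ : ℕ) : ℝ)
    have hc0 : (0:ℝ) ≤ c := Nat.cast_nonneg _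
    have hL0 : (0:ℝ) ≤ L := Nat.cast_nonneg _
    have hp : (0:ℝ) < 2^a := by positivity
    -- a * c ≥ 2 T (L+1) (ε - 1/2^a)
    have h5 : 2 * (T * (L+1) * (ε - ε/(1+ε))) ≤ a * c := by
      have h6 : 1 / (2:ℝ)^a ≤ ε/(1+ε) := by
        rw [div_le_div_iff₀ hp (by linarith)]
        have := mul_le_mul_of_nonneg_left ha3 e0.le
        have e : ε * (1 + 1/ε) = ε + 1 := by field_simp
        rw [e] at this
        linarith
      have h7 : 2 * (ε * (L+1) * T) - 2 * (L * T) * (1 / (2:ℝ)^a) ≤ a * c := by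
        rw [mul_one_div, sub_le_iff_le_add, ← sub_le_iff_le_add', le_div_iff₀ hp]
        linarith
      have h8 : 2 * (L * T) * (1 / (2:ℝ)^a) ≤ 2 * ((L+1) * T) * (ε/(1+ε)) := by
        apply mul_le_mul _ h6 (by positivity) (by positivity)
        nlinarith
      linarith
    have h9 : T * ((L+1) * (ε^2 * (1+ε)⁻¹)) ≤ lg * c := by
      have e : ε - ε/(1+ε) = ε^2 * (1+ε)⁻¹ := by field_simp; ring
      rw [e] at h5
      have := mul_le_mul_of_nonneg_right ha2 hc0
      linarith
    have hlgp : 0 < lg := by linarith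
    calc ((L+1:ℕ):ℝ) * ε ^ 2 * (1 + ε)⁻¹ * lg⁻¹ * (OPT (L+1) σ : ℝ)
        ≤ ((L+1:ℕ):ℝ) * ε ^ 2 * (1 + ε)⁻¹ * lg⁻¹ * T := by
          apply mul_le_mul_of_nonneg_left hupR
          positivity
      _ = (T * ((L+1) * (ε^2 * (1+ε)⁻¹))) * lg⁻¹ := by push_cast; ring
      _ ≤ (lg * c) * lg⁻¹ := mul_le_mul_of_nonneg_right h9 (by positivity)
      _ = c := by field_simp
end

section
/- Fix integers 0 < ℓ' < ℓ and a constant ε ∈ (0,1) such that ℓ' = (1−ε)·ℓ. Every service order with buffer size ℓ' for the phase sequence on the line of 2^ℓ + 1 sites has cost at least 2^ℓ · ℓ · ε² · (1+ε)^{−1} · (log₂(1 + 1/ε))^{−1}. -/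
/-- The requests arriving during step `j` of the phase sequence with parameter `ℓ`:
`ℓ+1` anchor requests at site `j`, and, for each integer `q` with `1 ≤ q ≤ ℓ`,
`2^q ∣ j` and `j + 2^q ≤ 2^ℓ`, one regular request at site `j + 2^q`;
requests within a step are listed in increasing order of site. -/
def stepRequests (ℓ j : ℕ) : List ℕ :=
  List.replicate (ℓ + 1) j ++
    ((((List.range ℓ).map (· + 1)).filter
      fun q => decide (2 ^ q ∣ j ∧ j + 2 ^ q ≤ 2 ^ ℓ)).map fun q => j + 2 ^ q)

/-- The phase sequence on the line of `2^ℓ + 1` sites `{0, …, 2^ℓ}`: the requests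
of steps `j = 0, 1, …, 2^ℓ - 1`, in this order. -/
def phaseSeq (ℓ : ℕ) : List ℕ := (List.range (2 ^ ℓ)).flatMap (stepRequests ℓ)

lemma walkCost_eq_sum (L : List ℕ) : ∀ s, walkCost s L =
    ∑ i ∈ Finset.range L.length, natDist ((s :: L).getD i 0) ((s :: L).getD (i + 1) 0) := by
  induction L with
  | nil => intro s; simp [walkCost]
  | cons x xs ih =>
    intro s
    rw [walkCost, ih x, List.length_cons, Finset.sum_range_succ', add_comm]
    simp

lemma dist_sum (p : ℕ → ℕ) (t t' : ℕ) (h : t ≤ t') :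
    (∑ i ∈ Finset.range t, natDist (p i) (p (i + 1))) + (p t' - p t) ≤
      ∑ i ∈ Finset.range t', natDist (p i) (p (i + 1)) ∧
    (∑ i ∈ Finset.range t, natDist (p i) (p (i + 1))) + (p t - p t') ≤
      ∑ i ∈ Finset.range t', natDist (p i) (p (i + 1)) := by
  induction t', h using Nat.le_induction with
  | base => simp
  | succ n hn ih =>
    rw [Finset.sum_range_succ]
    have : natDist (p n) (p (n+1)) = max (p n) (p (n+1)) - min (p n) (p (n+1)) := rfl
    omega

lemma block_lemma (P : ℕ → Prop) [DecidablePred P] (Q K : ℕ) (h0 : ¬ P 0) :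
    K * ((Finset.range Q).filter fun x => P (x + 1)).card ≤
      Q + K * ∑ x ∈ Finset.range Q,
        (if ¬ P x ∧ P (x + 1) ∧ Q < K * (Q - x) then Q - x else 0) := by
  by_cases h : ∃ x, x < Q ∧ P (x + 1)
  · classical
    have hs := Nat.find_spec h
    have hm : ∀ y, y < Nat.find h → ¬ (y < Q ∧ P (y+1)) := fun y hy => Nat.find_min h hy
    set x0 := Nat.find h
    have hc : ((Finset.range Q).filter fun x => P (x + 1)).card ≤ Q - x0 := by
      rw [← Nat.card_Ico]
      apply Finset.card_le_card
      intro x hx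
      simp only [Finset.mem_filter, Finset.mem_range, Finset.mem_Ico] at hx ⊢
      refine ⟨?_, hx.1⟩
      by_contra hlt
      exact hm x (by omega) hx
    have hnP : ¬ P x0 := by
      rcases Nat.eq_zero_or_pos x0 with h1 | h1
      · rw [h1]; exact h0
      · intro hp
        refine hm (x0 - 1) (by omega) ⟨by omega, ?_⟩
        rwa [Nat.sub_add_cancel h1]
    have h1 := Nat.mul_le_mul_left K hc
    by_cases hh : Q < K * (Q - x0)
    · have h2 := Finset.single_le_sum (f := fun x =>
        (if ¬ P x ∧ P (x + 1) ∧ Q < K * (Q - x) then Q - x else 0))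
        (fun _ _ => Nat.zero_le _) (Finset.mem_range.2 hs.1)
      simp only [if_pos (show ¬ P x0 ∧ P (x0 + 1) ∧ Q < K * (Q - x0) from ⟨hnP, hs.2, hh⟩)] at h2
      have h3 := Nat.mul_le_mul_left K h2
      omega
    · omega
  · have : ((Finset.range Q).filter fun x => P (x + 1)) = ∅ := by
      rw [Finset.filter_eq_empty_iff]
      intro x hx hp
      exact h ⟨x, Finset.mem_range.1 hx, hp⟩
    rw [this]; simp

lemma blocks_lemma (Q K : ℕ) (hQ : 0 < Q) (s T : ℕ → ℕ) (N : ℕ)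
    (h0 : ∀ i < N, T (i * Q) < s i) :
    K * (∑ j ∈ Finset.range (N * Q), if s (j / Q) ≤ T (j + 1) then 1 else 0) ≤
      N * Q + K * ∑ j ∈ Finset.range (N * Q),
        (if T j < s (j / Q) ∧ s (j / Q) ≤ T (j + 1) ∧ Q < K * (Q - j % Q)
          then Q - j % Q else 0) := by
  induction N with
  | zero => simp
  | succ N ih =>
    have ih := ih (fun i hi => h0 i (by omega))
    have hb := block_lemma (fun x => s N ≤ T (N * Q + x)) Q K (by simpa using h0 N (by omega))
    rw [add_mul, one_mul, Finset.sum_range_add, Finset.sum_range_add]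
    have e1 : ∀ x ∈ Finset.range Q, (N * Q + x) / Q = N := by
      intro x hx
      rw [mul_comm, Nat.mul_add_div hQ, Nat.div_eq_of_lt (Finset.mem_range.1 hx), add_zero]
    have e2 : ∀ x ∈ Finset.range Q, (N * Q + x) % Q = x := by
      intro x hx
      rw [mul_comm, Nat.mul_add_mod, Nat.mod_eq_of_lt (Finset.mem_range.1 hx)]
    have g1 : (∑ x ∈ Finset.range Q, if s ((N * Q + x) / Q) ≤ T (N * Q + x + 1) then 1 else 0) =
        ∑ x ∈ Finset.range Q, if s N ≤ T (N * Q + (x + 1)) then 1 else 0 :=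
      Finset.sum_congr rfl (fun x hx => by rw [e1 x hx, add_assoc])
    have g2 : (∑ x ∈ Finset.range Q,
        if T (N * Q + x) < s ((N * Q + x) / Q) ∧ s ((N * Q + x) / Q) ≤ T (N * Q + x + 1) ∧
          Q < K * (Q - (N * Q + x) % Q) then Q - (N * Q + x) % Q else 0) =
        ∑ x ∈ Finset.range Q, if ¬ (s N ≤ T (N * Q + x)) ∧ s N ≤ T (N * Q + (x + 1)) ∧
          Q < K * (Q - x) then Q - x else 0 :=
      Finset.sum_congr rfl (fun x hx => by simp only [e1 x hx, e2 x hx, not_le, add_assoc])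
    rw [g1, g2]
    rw [Finset.card_filter] at hb
    simp only [← add_assoc] at hb ⊢
    rw [mul_add, mul_add]
    omega

lemma level_sum (ℓ m j : ℕ) (B : Finset ℕ) (hB : B ⊆ Finset.Icc 1 ℓ) (d : ℕ)
    (hd : ∀ q ∈ B, 2 ^ q - j % 2 ^ q ≤ d)
    (hd' : B.Nonempty → ∃ q ∈ B, 2 ^ q - j % 2 ^ q = d)
    (hh : ∀ q ∈ B, 2 ^ q < 2 ^ m * (2 ^ q - j % 2 ^ q)) :
    ∑ q ∈ B, (2 ^ q - j % 2 ^ q) ≤ (m + 1) * d := by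
  classical
  rcases B.eq_empty_or_nonempty with rfl | hne
  · simp
  obtain ⟨r, hr, hrd⟩ := hd' hne
  have hd1 : 1 ≤ d := by
    have := Nat.mod_lt j (show 2 ^ r > 0 by positivity)
    omega
  have hsmall : ∑ q ∈ B.filter (fun q => 2 ^ q < d), (2 ^ q - j % 2 ^ q) ≤ d := by
    rcases Nat.lt_or_ge d 3 with h3 | h3
    · rw [Finset.sum_eq_zero]
      · omega
      · intro q hq
        exfalso
        simp only [Finset.mem_filter] at hq
        have := (Finset.mem_Icc.1 (hB hq.1)).1
        have : 2 ^ 1 ≤ 2 ^ q := Nat.pow_le_pow_right (by norm_num) this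
        omega
    · set p := Nat.log 2 (d - 1) with hp
      have hp1 : 2 ^ p ≤ d - 1 := Nat.pow_log_le_self 2 (by omega)
      have hp2 : d - 1 < 2 ^ (p + 1) := Nat.lt_pow_succ_log_self (by norm_num) _
      have hp0 : 1 ≤ p := by
        by_contra hc
        have : p = 0 := by omega
        rw [this] at hp2; omega
      have hsub : B.filter (fun q => 2 ^ q < d) ⊆ Finset.range (p + 1) \ {0} := by
        intro q hq
        simp only [Finset.mem_filter] at hq
        have := (Finset.mem_Icc.1 (hB hq.1)).1
        have h2 : 2 ^ q < 2 ^ (p + 1) := by omega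
        have := (Nat.pow_lt_pow_iff_right (by norm_num : 1 < 2)).1 h2
        simp; omega
      have hpr : p + 1 ≤ r := by
        have : 2 ^ p < 2 ^ r := by omega
        have := (Nat.pow_lt_pow_iff_right (by norm_num : 1 < 2)).1 this
        omega
      -- level p
      have hep : 2 ^ p - j % 2 ^ p ≤ d - 2 ^ p := by
        obtain ⟨c, hc⟩ := Nat.pow_dvd_pow 2 (show p ≤ r by omega)
        have hrr : (j % 2 ^ r) % 2 ^ p = j % 2 ^ p := Nat.mod_mod_of_dvd _ (Nat.pow_dvd_pow 2 (by omega))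
        have hlt := Nat.mod_lt j (show 2 ^ r > 0 by positivity)
        have hdm := Nat.div_add_mod (j % 2 ^ r) (2 ^ p)
        rw [hrr] at hdm
        have hpos : 0 < 2 ^ p := by positivity
        have hlt2 := Nat.mod_lt j hpos
        set a := (j % 2 ^ r) / 2 ^ p
        -- d = 2^p*c - 2^p*a - x
        have hca : a + 2 ≤ c := by
          by_contra hcon
          have : c ≤ a + 1 := by omega
          have := Nat.mul_le_mul_left (2 ^ p) this
          rw [mul_add] at this
          omega
        have := Nat.mul_le_mul_left (2 ^ p) hca
        rw [mul_add] at this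
        omega
      have hgeom : ∀ p : ℕ, ∑ q ∈ Finset.range p \ {0}, (2 ^ q - j % 2 ^ q) ≤ 2 ^ p - 1 := by
        intro p
        calc _ ≤ ∑ q ∈ Finset.range p, (2 ^ q - j % 2 ^ q) :=
              Finset.sum_le_sum_of_subset Finset.sdiff_subset
          _ ≤ ∑ q ∈ Finset.range p, 2 ^ q := Finset.sum_le_sum (fun _ _ => Nat.sub_le _ _)
          _ = 2 ^ p - 1 := by
              have := Nat.geomSum_eq (le_refl 2) p
              simpa using this
      calc _ ≤ ∑ q ∈ Finset.range (p + 1) \ {0}, (2 ^ q - j % 2 ^ q) :=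
            Finset.sum_le_sum_of_subset hsub
        _ = (2 ^ p - j % 2 ^ p) + ∑ q ∈ Finset.range p \ {0}, (2 ^ q - j % 2 ^ q) := by
            rw [Finset.range_add_one, Finset.insert_sdiff_of_notMem, Finset.sum_insert]
            · simp
            · simp; omega
        _ ≤ d := by have := hgeom p; omega
  have hbig : ∑ q ∈ B.filter (fun q => ¬ 2 ^ q < d), (2 ^ q - j % 2 ^ q) ≤ m * d := by
    have hcard : (B.filter (fun q => ¬ 2 ^ q < d)).card ≤ m := by
      set F := B.filter (fun q => ¬ 2 ^ q < d)
      rcases F.eq_empty_or_nonempty with hF | hF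
      · rw [hF]; simp
      · set q0 := F.min' hF
        have hq0 : q0 ∈ F := F.min'_mem hF
        have : F ⊆ Finset.Ico q0 (q0 + m) := by
          intro q hq
          rw [Finset.mem_Ico]
          refine ⟨F.min'_le q hq, ?_⟩
          have h1 := (Finset.mem_filter.1 hq).1
          have h2 := (Finset.mem_filter.1 hq0).2
          have : 2 ^ q < 2 ^ (q0 + m) := by
            calc 2 ^ q < 2 ^ m * (2 ^ q - j % 2 ^ q) := hh q h1
              _ ≤ 2 ^ m * 2 ^ q0 := Nat.mul_le_mul_left _ (by have := hd q h1; omega)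
              _ = _ := by rw [pow_add, mul_comm]
          exact (Nat.pow_lt_pow_iff_right (by norm_num : 1 < 2)).1 this
        simpa using Finset.card_le_card this
    calc _ ≤ (B.filter (fun q => ¬ 2 ^ q < d)).card • d :=
          Finset.sum_le_card_nsmul _ _ _ (fun q hq => hd q (Finset.mem_filter.1 hq).1)
      _ ≤ m * d := by rw [smul_eq_mul]; exact Nat.mul_le_mul_right _ hcard
  rw [← Finset.sum_filter_add_sum_filter_not B (fun q => 2 ^ q < d)]
  rw [add_mul, one_mul]; omega

lemma core (ℓ k : ℕ) (hk : 1 ≤ k) (hkℓ : k ≤ ℓ) (p C T W : ℕ → ℕ) (s : ℕ → ℕ → ℕ)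
    (hC : ∀ t t', t ≤ t' → C t + (p t' - p t) ≤ C t' ∧ C t + (p t - p t') ≤ C t')
    (hT0 : T 0 = 0) (hp0 : p 0 = 0) (hpT : ∀ j < 2 ^ ℓ, p (T (j + 1)) = j)
    (hTW : ∀ j < 2 ^ ℓ, T (j + 1) ≤ W (j + 1)) (hWT : ∀ j < 2 ^ ℓ, W j < T (j + 1))
    (hs : ∀ q i, 1 ≤ q → q ≤ ℓ → i < 2 ^ (ℓ - q) → W (i * 2 ^ q) < s q i)
    (hps : ∀ q i, 1 ≤ q → q ≤ ℓ → i < 2 ^ (ℓ - q) → p (s q i) = (i + 1) * 2 ^ q)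
    (hW : ∀ j < 2 ^ ℓ,
      ((Finset.Icc 1 ℓ).filter fun q => W (j + 1) < s q (j / 2 ^ q)).card ≤ k - 1) (m : ℕ) :
    2 * (2 ^ m * ((ℓ - k) * 2 ^ ℓ)) ≤ 2 * (ℓ * 2 ^ ℓ) + 2 ^ m * ((m + 1) * C (T (2 ^ ℓ))) := by
  classical
  have hsplit : ∀ q ∈ Finset.Icc 1 ℓ, 2 ^ (ℓ - q) * 2 ^ q = 2 ^ ℓ := by
    intro q hq
    rw [← pow_add, Nat.sub_add_cancel (Finset.mem_Icc.1 hq).2]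
  have hdiv : ∀ q ∈ Finset.Icc 1 ℓ, ∀ j < 2 ^ ℓ, j / 2 ^ q < 2 ^ (ℓ - q) := by
    intro q hq j hj
    rw [Nat.div_lt_iff_lt_mul (by positivity), hsplit q hq]; exact hj
  have hTWle : ∀ j ≤ 2 ^ ℓ, T j ≤ W j := by
    intro j hj
    cases j with
    | zero => omega
    | succ j => exact hTW j (by omega)
  have hWmono : ∀ i j, i ≤ j → j ≤ 2 ^ ℓ → W i ≤ W j := by
    intro i j hij
    induction j, hij using Nat.le_induction with
    | base => intro; rfl
    | succ j hj ih =>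
      intro h
      have := ih (by omega); have := hWT j (by omega); have := hTW j (by omega)
      omega
  have hTlt : ∀ j < 2 ^ ℓ, T j ≤ T (j + 1) := fun j hj =>
    (hTWle j hj.le).trans (hWT j hj).le
  -- d
  let B : ℕ → Finset ℕ := fun j => (Finset.Icc 1 ℓ).filter fun q =>
    T j < s q (j / 2 ^ q) ∧ s q (j / 2 ^ q) ≤ T (j + 1) ∧ 2 ^ q < 2 ^ m * (2 ^ q - j % 2 ^ q)
  let d : ℕ → ℕ := fun j => (B j).sup fun q => 2 ^ q - j % 2 ^ q
  have hcost : ∀ j ≤ 2 ^ ℓ, 2 * ∑ i ∈ Finset.range j, d i ≤ C (T j) := by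
    intro j
    induction j with
    | zero => simp
    | succ j ih =>
      intro hj
      have ih := ih (by omega)
      rw [Finset.sum_range_succ, mul_add]
      suffices h : C (T j) + 2 * d j ≤ C (T (j + 1)) by omega
      rcases (B j).eq_empty_or_nonempty with hB | hB
      · have : d j = 0 := by simp [d, hB]
        have := hC (T j) (T (j + 1)) (hTlt j (by omega))
        omega
      · obtain ⟨q, hq, hqd⟩ := Finset.exists_mem_eq_sup (B j) hB (fun q => 2 ^ q - j % 2 ^ q)
        have hqd : d j = 2 ^ q - j % 2 ^ q := hqd
        obtain ⟨hqI, h1, h2, -⟩ := Finset.mem_filter.1 hq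
        have hI := Finset.mem_Icc.1 hqI
        have c1 := (hC _ _ h1.le).1
        have c2 := (hC _ _ h2).2
        rw [hps q _ hI.1 hI.2 (hdiv q hqI j (by omega))] at c1 c2
        rw [hpT j (by omega)] at c2
        have hpj : p (T j) ≤ j := by
          cases j with
          | zero => simp [hT0, hp0]
          | succ j => rw [hpT j (by omega)]; omega
        have hdm := Nat.div_add_mod j (2 ^ q)
        have hlt := Nat.mod_lt j (show 2 ^ q > 0 by positivity)
        rw [add_mul, one_mul, mul_comm] at c1 c2
        omega
  have hlev : ∀ j, ∑ q ∈ B j, (2 ^ q - j % 2 ^ q) ≤ (m + 1) * d j := by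
    intro j
    apply level_sum ℓ m j (B j) (Finset.filter_subset _ _)
    · intro q hq; exact Finset.le_sup (f := fun q => 2 ^ q - j % 2 ^ q) hq
    · intro hB
      obtain ⟨q, hq, hqd⟩ := Finset.exists_mem_eq_sup (B j) hB (fun q => 2 ^ q - j % 2 ^ q)
      exact ⟨q, hq, hqd.symm⟩
    · intro q hq; exact (Finset.mem_filter.1 hq).2.2.2
  -- coverage
  have hU : ∀ j ∈ Finset.range (2 ^ ℓ), (ℓ - k) + 1 ≤
      (∑ q ∈ Finset.Icc 1 ℓ, if s q (j / 2 ^ q) ≤ T (j + 1) then 1 else 0) +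
      ∑ q ∈ Finset.Icc 1 ℓ, if T (j + 1) < s q (j / 2 ^ q) ∧ s q (j / 2 ^ q) ≤ W (j + 1)
        then 1 else 0 := by
    intro j hj
    have h1 := hW j (Finset.mem_range.1 hj)
    rw [Finset.card_filter] at h1
    have h2 : ∑ q ∈ Finset.Icc 1 ℓ, 1 ≤ (∑ q ∈ Finset.Icc 1 ℓ, if W (j + 1) < s q (j / 2 ^ q) then 1 else 0) + ((∑ q ∈ Finset.Icc 1 ℓ, if s q (j / 2 ^ q) ≤ T (j + 1) then 1 else 0) +
      ∑ q ∈ Finset.Icc 1 ℓ, if T (j + 1) < s q (j / 2 ^ q) ∧ s q (j / 2 ^ q) ≤ W (j + 1)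
        then 1 else 0) := by
      rw [← Finset.sum_add_distrib, ← Finset.sum_add_distrib]
      apply Finset.sum_le_sum
      intro q _
      split_ifs <;> omega
    simp at h2
    simp at h1 ⊢
    omega
  have hloss : ∀ q ∈ Finset.Icc 1 ℓ, (∑ j ∈ Finset.range (2 ^ ℓ),
      if T (j + 1) < s q (j / 2 ^ q) ∧ s q (j / 2 ^ q) ≤ W (j + 1) then 1 else 0) ≤ 2 ^ (ℓ - q) := by
    intro q hq
    rw [← Finset.card_filter, ← Finset.card_range (2 ^ (ℓ - q))]
    apply Finset.card_le_card_of_injOn (fun j => j / 2 ^ q)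
    · intro j hj
      simp only [Finset.coe_filter, Finset.mem_range, Set.mem_ofPred_eq] at hj
      simpa using hdiv q hq j hj.1
    · have key : ∀ j j', j < j' → j' < 2 ^ ℓ → T (j' + 1) < s q (j' / 2 ^ q) →
          s q (j / 2 ^ q) ≤ W (j + 1) → j / 2 ^ q = j' / 2 ^ q → False := by
        intro j j' h1 h2 h3 h4 h5
        rw [h5] at h4
        have := hWmono (j + 1) j' h1 h2.le
        have := hWT j' h2
        omega
      intro j hj j' hj' hjj
      simp only [Finset.coe_filter, Finset.mem_range, Set.mem_ofPred_eq] at hj hj'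
      rcases lt_trichotomy j j' with h | h | h
      · exact (key j j' h hj'.1 hj'.2.1 hj.2.2 hjj).elim
      · exact h
      · exact (key j' j h hj.1 hj.2.1 hj'.2.2 hjj.symm).elim
  have hgeo : ∑ q ∈ Finset.Icc 1 ℓ, 2 ^ (ℓ - q) ≤ 2 ^ ℓ := by
    have h1 : ∑ q ∈ Finset.Icc 1 ℓ, 2 ^ (ℓ - q) = ∑ i ∈ Finset.range ℓ, 2 ^ i := by
      apply Finset.sum_nbij' (fun q => ℓ - q) (fun i => ℓ - i)
      all_goals
        intro a ha
        simp only [Finset.mem_Icc, Finset.mem_range] at ha ⊢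
        try omega
    have h2 : ∑ i ∈ Finset.range ℓ, 2 ^ i = 2 ^ ℓ - 1 := by
      simpa using Nat.geomSum_eq (le_refl 2) ℓ
    rw [h1, h2]
    exact Nat.sub_le _ _
  have hA : (ℓ - k) * 2 ^ ℓ ≤ ∑ q ∈ Finset.Icc 1 ℓ, ∑ j ∈ Finset.range (2 ^ ℓ),
      if s q (j / 2 ^ q) ≤ T (j + 1) then 1 else 0 := by
    have h1 := Finset.sum_le_sum hU
    have h2 := (Finset.sum_le_sum hloss).trans hgeo
    rw [Finset.sum_const, Finset.card_range, smul_eq_mul, mul_add, mul_one, mul_comm,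
      Finset.sum_add_distrib, Finset.sum_comm] at h1
    rw [Finset.sum_comm] at h2
    omega
  have hq : ∀ q ∈ Finset.Icc 1 ℓ, 2 ^ m * (∑ j ∈ Finset.range (2 ^ ℓ),
      if s q (j / 2 ^ q) ≤ T (j + 1) then 1 else 0) ≤ 2 ^ ℓ + 2 ^ m * ∑ j ∈ Finset.range (2 ^ ℓ),
        (if T j < s q (j / 2 ^ q) ∧ s q (j / 2 ^ q) ≤ T (j + 1) ∧
          2 ^ q < 2 ^ m * (2 ^ q - j % 2 ^ q) then 2 ^ q - j % 2 ^ q else 0) := by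
    intro q hq
    have hI := Finset.mem_Icc.1 hq
    have := blocks_lemma (2 ^ q) (2 ^ m) (by positivity) (s q) T (2 ^ (ℓ - q)) (by
      intro i hi
      refine (hTWle _ ?_).trans_lt (hs q i hI.1 hI.2 hi)
      rw [← hsplit q hq]
      exact Nat.mul_le_mul_right _ hi.le)
    rw [hsplit q hq] at this
    exact this
  have hsum := Finset.sum_le_sum hq
  rw [← Finset.mul_sum, Finset.sum_add_distrib, ← Finset.mul_sum, Finset.sum_const,
    Nat.card_Icc, smul_eq_mul, Nat.add_sub_cancel, Finset.sum_comm (s := Finset.Icc 1 ℓ) (t := Finset.range (2 ^ ℓ)) (f := fun q j => (if T j < s q (j / 2 ^ q) ∧ s q (j / 2 ^ q) ≤ T (j + 1) ∧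
          2 ^ q < 2 ^ m * (2 ^ q - j % 2 ^ q) then 2 ^ q - j % 2 ^ q else 0))] at hsum
  simp only [← Finset.sum_filter] at hsum
  have hfin : ∑ j ∈ Finset.range (2 ^ ℓ), ∑ q ∈ B j, (2 ^ q - j % 2 ^ q) ≤
      (m + 1) * ∑ j ∈ Finset.range (2 ^ ℓ), d j := by
    rw [Finset.mul_sum]
    exact Finset.sum_le_sum fun j _ => hlev j
  have hc := hcost _ le_rfl
  have hA' := Nat.mul_le_mul_left (2 ^ m) hA
  have hfin' := Nat.mul_le_mul_left (2 ^ m) hfin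
  have hc' := Nat.mul_le_mul_left (2 ^ m) (Nat.mul_le_mul_left (m + 1) hc)
  simp only [← Finset.sum_filter] at hA'
  have e : 2 ^ m * ((m + 1) * (2 * ∑ j ∈ Finset.range (2 ^ ℓ), d j)) =
    2 * (2 ^ m * ((m + 1) * ∑ j ∈ Finset.range (2 ^ ℓ), d j)) := by ring
  have hsum' := hA'.trans (hsum.trans (Nat.add_le_add_left hfin' _))
  omega

lemma final_real (ε n L C : ℝ) (h0 : 0 < ε) (h1 : ε < 1) (hn : 0 ≤ n) (hL : 0 ≤ L)
    (h : ∀ m : ℕ, 2 * (2 ^ m * (ε * L * n)) ≤ 2 * (L * n) + 2 ^ m * ((m + 1) * C)) :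
    C ≥ n * L * ε ^ 2 * (1 + ε)⁻¹ * (Real.logb 2 (1 + 1 / ε))⁻¹ := by
  have hlog2 : 0 < Real.log 2 := Real.log_pos (by norm_num)
  have hlog2' : Real.log 2 ≤ 1 := by have := Real.log_two_lt_d9; linarith
  have hx : (2:ℝ) < 1 + 1 / ε := by
    have : 1 < 1 / ε := by rw [lt_div_iff₀ h0]; linarith
    linarith
  set x := 1 + 1 / ε with hxd
  set lam := Real.logb 2 x with hlam
  have hl1 : 1 < lam := by
    rw [hlam, Real.lt_logb_iff_rpow_lt (by norm_num) (by linarith)]; simpa using hx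
  have hL' : 0 ≤ n * L := mul_nonneg hn hL
  -- per m
  have hm : ∀ m : ℕ, 2 * (ε - 1 / 2 ^ m) * (n * L) ≤ (m + 1) * C := by
    intro m
    have h2 : (0:ℝ) < 2 ^ m := by positivity
    have := h m
    rw [← mul_le_mul_iff_right₀ h2]
    calc 2 ^ m * (2 * (ε - 1 / 2 ^ m) * (n * L)) = 2 * (2 ^ m * (ε * L * n)) - 2 * (L * n) := by
          field_simp
      _ ≤ _ := by linarith
  suffices hsuf : ∃ m : ℕ, ε ^ 2 * (1 + ε)⁻¹ * lam⁻¹ * (m + 1) ≤ 2 * (ε - 1 / 2 ^ m) by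
    obtain ⟨m, hm1⟩ := hsuf
    have h3 := mul_le_mul_of_nonneg_right hm1 hL'
    have h4 := h3.trans (hm m)
    have h5 : (0:ℝ) < m + 1 := by positivity
    have : (m + 1) * (n * L * ε ^ 2 * (1 + ε)⁻¹ * lam⁻¹) ≤ (m + 1) * C := by
      refine le_trans (le_of_eq ?_) h4
      ring
    exact le_of_mul_le_mul_left this h5
  have hid : ε ^ 2 * (1 + ε)⁻¹ = ε - 1 / x := by
    rw [hxd]; field_simp; ring
  rcases le_or_gt 2 lam with h2 | h2
  · refine ⟨⌈lam⌉₊, ?_⟩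
    have hc1 := Nat.le_ceil lam
    have hc2 := Nat.ceil_lt_add_one (by linarith : 0 ≤ lam)
    have hxm : x ≤ 2 ^ ⌈lam⌉₊ := by
      have h3 : x = (2:ℝ) ^ lam := (Real.rpow_logb (by norm_num) (by norm_num) (by linarith)).symm
      rw [h3, ← Real.rpow_natCast]
      exact Real.rpow_le_rpow_of_exponent_le (by norm_num) hc1
    have h4 : 1 / (2:ℝ) ^ ⌈lam⌉₊ ≤ 1 / x := one_div_le_one_div_of_le (by linarith) hxm
    have h5 : lam⁻¹ * (⌈lam⌉₊ + 1) ≤ 2 := by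
      rw [inv_mul_le_iff₀ (by linarith)]; linarith
    have h6 : 0 ≤ ε ^ 2 * (1 + ε)⁻¹ := by positivity
    calc _ = ε ^ 2 * (1 + ε)⁻¹ * (lam⁻¹ * (⌈lam⌉₊ + 1)) := by ring
      _ ≤ ε ^ 2 * (1 + ε)⁻¹ * 2 := mul_le_mul_of_nonneg_left h5 h6
      _ ≤ _ := by rw [hid]; linarith
  · refine ⟨2, ?_⟩
    have hx4 : x < 4 := by
      rw [hlam, Real.logb_lt_iff_lt_rpow (by norm_num) (by linarith)] at h2
      norm_num at h2; exact h2
    have he3 : 1 / 3 < ε := by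
      have : 1 / ε < 3 := by linarith
      rw [div_lt_iff₀ h0] at this; linarith
    -- lam ≥ 2 - 2/x
    have hlb : 2 - 2 / x ≤ lam := by
      have hh : 1 - 2 / x ≤ Real.log (x / 2) := by
        have := Real.one_sub_inv_le_log_of_pos (show 0 < x / 2 by linarith)
        simpa using this
      rw [Real.log_div (by linarith) (by norm_num)] at hh
      have hnn : 0 ≤ 1 - 2 / x := by
        have : 2 / x ≤ 1 := by rw [div_le_one (by linarith)]; linarith
        linarith
      rw [hlam, Real.logb, le_div_iff₀ hlog2]
      nlinarith
    have hlb2 : 2 / (1 + ε) ≤ lam := by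
      refine le_trans (le_of_eq ?_) hlb
      rw [hxd]; field_simp; ring
    have h7 : lam⁻¹ ≤ (1 + ε) / 2 := by
      rw [inv_le_comm₀ (by linarith) (by positivity), inv_div]; exact hlb2
    have h6 : 0 ≤ ε ^ 2 * (1 + ε)⁻¹ := by positivity
    calc _ ≤ ε ^ 2 * (1 + ε)⁻¹ * ((1 + ε) / 2) * (((2:ℕ):ℝ) + 1) := by gcongr
      _ = 3 / 2 * ε ^ 2 := by field_simp; push_cast; ring
      _ ≤ _ := by push_cast; nlinarith

def stepStart (ℓ j : ℕ) : ℕ := ((List.range j).flatMap (stepRequests ℓ)).length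

lemma stepStart_succ (ℓ j : ℕ) :
    stepStart ℓ (j + 1) = stepStart ℓ j + (stepRequests ℓ j).length := by
  simp [stepStart, List.range_succ]

lemma step_len (ℓ j : ℕ) : ℓ + 1 ≤ (stepRequests ℓ j).length := by
  simp [stepRequests]

lemma stepStart_mono (ℓ : ℕ) : Monotone (stepStart ℓ) :=
  monotone_nat_of_le_succ fun j => by rw [stepStart_succ]; omega

lemma flat_get (ℓ j r m : ℕ) (hj : j < m) (hr : r < (stepRequests ℓ j).length) :
    ((List.range m).flatMap (stepRequests ℓ))[stepStart ℓ j + r]? = (stepRequests ℓ j)[r]? := by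
  induction m, hj using Nat.le_induction with
  | base =>
    rw [List.range_succ, List.flatMap_append, List.getElem?_append_right (by simp [stepStart])]
    simp [stepStart]
  | succ m hm ih =>
    rw [List.range_succ, List.flatMap_append, List.getElem?_append_left, ih]
    change _ < stepStart ℓ m
    have h1 := stepStart_mono ℓ hm
    have h2 := stepStart_succ ℓ j
    simp only [Nat.succ_eq_add_one] at h1
    omega

lemma anchor_get (ℓ j r : ℕ) (hj : j < 2 ^ ℓ) (hr : r < ℓ + 1) :
    (phaseSeq ℓ)[stepStart ℓ j + r]? = some j := by
  rw [phaseSeq, flat_get ℓ j r _ hj (by have := step_len ℓ j; omega), stepRequests,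
    List.getElem?_append_left (by simpa using hr)]
  simp [hr]

lemma regular_get (ℓ j q : ℕ) (hj : j < 2 ^ ℓ) (h1 : 1 ≤ q) (h2 : q ≤ ℓ) (hd : 2 ^ q ∣ j)
    (hle : j + 2 ^ q ≤ 2 ^ ℓ) :
    ∃ x, stepStart ℓ j ≤ x ∧ x < stepStart ℓ (j + 1) ∧ (phaseSeq ℓ)[x]? = some (j + 2 ^ q) := by
  have hmem : j + 2 ^ q ∈ stepRequests ℓ j := by
    unfold stepRequests
    rw [List.mem_append]
    right
    rw [List.mem_map]
    refine ⟨q, ?_, rfl⟩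
    rw [List.mem_filter]
    refine ⟨?_, by simp [hd, hle]⟩
    rw [List.mem_map]
    exact ⟨q - 1, by simp; omega, by omega⟩
  obtain ⟨r, hr, hrr⟩ := List.mem_iff_getElem.1 hmem
  refine ⟨stepStart ℓ j + r, by omega, by rw [stepStart_succ]; omega, ?_⟩
  rw [phaseSeq, flat_get ℓ j r _ hj hr, List.getElem?_eq_getElem hr, hrr]

lemma unserved_card (k N M : ℕ) (hk : 1 ≤ k) (hM : M ≤ N) (hkM : k ≤ M)
    (π : Equiv.Perm (Fin N)) (hπ : IsServiceOrder k N π) :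
    (Finset.univ.filter fun x : Fin N => (x : ℕ) < M ∧ M < (π.symm x : ℕ) + k).card ≤ k - 1 := by
  classical
  have h1 : (Finset.univ.filter fun x : Fin N => (x : ℕ) < M).card = M := by
    rw [Fin.card_filter_val_lt]; omega
  have h2 : (Finset.univ.filter fun t : Fin N => (t : ℕ) < M - k + 1).card = M - k + 1 := by
    rw [Fin.card_filter_val_lt]; omega
  have h3 : (Finset.univ.filter fun t : Fin N => (t : ℕ) < M - k + 1).card ≤
      (Finset.univ.filter fun x : Fin N => (x : ℕ) < M ∧ ¬ M < (π.symm x : ℕ) + k).card := by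
    apply Finset.card_le_card_of_injOn π _ π.injective.injOn
    intro t ht
    simp at ht ⊢
    have := hπ t
    omega
  have h4 := Finset.card_filter_add_card_filter_not (s := Finset.univ.filter fun x : Fin N => (x : ℕ) < M) (fun x => M < (π.symm x : ℕ) + k)
  rw [Finset.filter_filter, Finset.filter_filter] at h4
  omega

lemma nat_bound (ℓ k : ℕ) (hk : 1 ≤ k) (hkℓ : k ≤ ℓ)
    (π : Equiv.Perm (Fin (phaseSeq ℓ).length))
    (hπ : IsServiceOrder k (phaseSeq ℓ).length π) (m : ℕ) :
    2 * (2 ^ m * ((ℓ - k) * 2 ^ ℓ)) ≤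
      2 * (ℓ * 2 ^ ℓ) + 2 ^ m * ((m + 1) * serviceCost (phaseSeq ℓ) π) := by
  classical
  let L : List ℕ := (List.finRange (phaseSeq ℓ).length).map fun t => (phaseSeq ℓ).get (π t)
  have hLlen : L.length = (phaseSeq ℓ).length := by simp [L]
  let p : ℕ → ℕ := fun i => (0 :: L).getD i 0
  let C : ℕ → ℕ := fun t => ∑ i ∈ Finset.range t, natDist (p i) (p (i + 1))
  have hCN : serviceCost (phaseSeq ℓ) π = C (phaseSeq ℓ).length := by
    have := walkCost_eq_sum L 0
    rw [hLlen] at this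
    exact this
  have hp : ∀ (x : Fin (phaseSeq ℓ).length) (v : ℕ), (phaseSeq ℓ)[(x : ℕ)]? = some v →
      p ((π.symm x : ℕ) + 1) = v := by
    intro x v hv
    have hlt : (π.symm x : ℕ) < L.length := by rw [hLlen]; exact (π.symm x).2
    have : p ((π.symm x : ℕ) + 1) = (phaseSeq ℓ).get x := by
      simp [p, L]
    rw [this]
    rw [List.getElem?_eq_getElem x.2] at hv
    simpa using hv
  have hge : ∀ x : Fin (phaseSeq ℓ).length, (x : ℕ) + 1 ≤ (π.symm x : ℕ) + k := by
    intro x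
    have := hπ (π.symm x)
    rw [Equiv.apply_symm_apply] at this
    omega
  have hSle : ∀ j ≤ 2 ^ ℓ, stepStart ℓ j ≤ (phaseSeq ℓ).length := fun j hj => stepStart_mono ℓ hj
  have hS1 : ∀ j, stepStart ℓ j + (ℓ + 1) ≤ stepStart ℓ (j + 1) := by
    intro j; rw [stepStart_succ]; have := step_len ℓ j; omega
  -- anchors
  have hanchor : ∀ j, j < 2 ^ ℓ → ∃ x : Fin (phaseSeq ℓ).length, stepStart ℓ j ≤ x ∧
      (phaseSeq ℓ)[(x : ℕ)]? = some j ∧ (π.symm x : ℕ) + k ≤ stepStart ℓ (j + 1) := by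
    intro j hj
    by_contra hcon
    push Not at hcon
    have hu := unserved_card k (phaseSeq ℓ).length (stepStart ℓ (j + 1)) hk (hSle _ hj)
      (by have := hS1 j; omega) π hπ
    have hSj := hS1 j
    have hSN := hSle (j + 1) hj
    have : ℓ + 1 ≤ (Finset.univ.filter fun x : Fin (phaseSeq ℓ).length => (x : ℕ) < stepStart ℓ (j + 1) ∧
        stepStart ℓ (j + 1) < (π.symm x : ℕ) + k).card := by
      rw [← Fintype.card_fin (ℓ + 1), ← Finset.card_univ]
      apply Finset.card_le_card_of_injOn
        (fun r : Fin (ℓ + 1) => (⟨stepStart ℓ j + r, by omega⟩ : Fin (phaseSeq ℓ).length))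
      · intro r _
        have := hcon ⟨stepStart ℓ j + r, by omega⟩ (by simp) (anchor_get ℓ j r hj r.2)
        simp
        exact ⟨by omega, this⟩
      · intro r _ r' _ h
        simp at h
        exact Fin.ext h
    omega
  have hN0 : 0 < (phaseSeq ℓ).length := by
    have := hS1 0
    have h2 := hSle 1 Nat.one_le_two_pow
    simp only [zero_add] at this
    omega
  have : NeZero (phaseSeq ℓ).length := ⟨hN0.ne'⟩
  choose! ax hax1 hax2 hax3 using hanchor
  have hreg : ∀ q i, 1 ≤ q ∧ q ≤ ℓ ∧ i < 2 ^ (ℓ - q) → ∃ x : Fin (phaseSeq ℓ).length,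
      stepStart ℓ (i * 2 ^ q) ≤ x ∧ (x : ℕ) < stepStart ℓ (i * 2 ^ q + 1) ∧
      (phaseSeq ℓ)[(x : ℕ)]? = some (i * 2 ^ q + 2 ^ q) := by
    rintro q i ⟨h1, h2, h3⟩
    have hle : i * 2 ^ q + 2 ^ q ≤ 2 ^ ℓ := by
      calc i * 2 ^ q + 2 ^ q = (i + 1) * 2 ^ q := by ring
        _ ≤ 2 ^ (ℓ - q) * 2 ^ q := Nat.mul_le_mul_right _ h3
        _ = 2 ^ ℓ := by rw [← pow_add, Nat.sub_add_cancel h2]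
    have hpos : 0 < 2 ^ q := by positivity
    obtain ⟨x, hx1, hx2, hx3⟩ := regular_get ℓ (i * 2 ^ q) q (by omega) h1 h2
      (Dvd.intro_left i rfl) hle
    exact ⟨⟨x, by rw [List.getElem?_eq_some_iff] at hx3; exact hx3.1⟩, hx1, hx2, hx3⟩
  choose! rx hrx1 hrx2 hrx3 using hreg
  let T : ℕ → ℕ := fun j => if j = 0 then 0 else (π.symm (ax (j - 1)) : ℕ) + 1
  have hTs : ∀ j, T (j + 1) = (π.symm (ax j) : ℕ) + 1 := fun j => by simp [T]
  have hcore := core ℓ k hk hkℓ p C T (fun j => stepStart ℓ j + 1 - k)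
    (fun q i => (π.symm (rx q i) : ℕ) + 1) (fun t t' h => dist_sum p t t' h) (by simp [T])
    (by simp [p]) (fun j hj => by rw [hTs]; exact hp _ _ (hax2 j hj))
    (fun j hj => by
      rw [hTs]
      have := hax3 j hj
      show _ ≤ stepStart ℓ (j + 1) + 1 - k
      omega)
    (fun j hj => by
      rw [hTs]
      have := hge (ax j)
      have := hax1 j hj
      show stepStart ℓ j + 1 - k < _
      omega)
    (fun q i h1 h2 h3 => by
      have := hge (rx q i)
      have := hrx1 q i ⟨h1, h2, h3⟩
      show stepStart ℓ (i * 2 ^ q) + 1 - k < (π.symm (rx q i) : ℕ) + 1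
      omega)
    (fun q i h1 h2 h3 => by
      have := hp _ _ (hrx3 q i ⟨h1, h2, h3⟩)
      rw [this]; ring)
    (fun j hj => by
      have hSj := hS1 j
      have hu := unserved_card k (phaseSeq ℓ).length (stepStart ℓ (j + 1)) hk (hSle _ hj) (by omega) π hπ
      refine le_trans ?_ hu
      have hdiv : ∀ q ∈ Finset.Icc 1 ℓ, 1 ≤ q ∧ q ≤ ℓ ∧ j / 2 ^ q < 2 ^ (ℓ - q) := by
        intro q hq
        have hq := Finset.mem_Icc.1 hq
        refine ⟨hq.1, hq.2, ?_⟩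
        rw [Nat.div_lt_iff_lt_mul (by positivity), ← pow_add, Nat.sub_add_cancel hq.2]
        exact hj
      apply Finset.card_le_card_of_injOn (fun q => rx q (j / 2 ^ q))
      · intro q hq
        rw [Finset.mem_coe, Finset.mem_filter] at hq
        have h2 := hrx2 q _ (hdiv q hq.1)
        have h3 := stepStart_mono ℓ (show j / 2 ^ q * 2 ^ q + 1 ≤ j + 1 from
          Nat.succ_le_succ (Nat.div_mul_le_self _ _))
        have h4 : stepStart ℓ (j + 1) + 1 - k < (π.symm (rx q (j / 2 ^ q)) : ℕ) + 1 := hq.2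
        simp
        omega
      · intro q hq q' hq' he
        rw [Finset.mem_coe, Finset.mem_filter] at hq hq'
        have he : rx q (j / 2 ^ q) = rx q' (j / 2 ^ q') := he
        have a1 := hrx1 q _ (hdiv q hq.1)
        have a2 := hrx2 q _ (hdiv q hq.1)
        have a3 := hrx3 q _ (hdiv q hq.1)
        have b1 := hrx1 q' _ (hdiv q' hq'.1)
        have b2 := hrx2 q' _ (hdiv q' hq'.1)
        have b3 := hrx3 q' _ (hdiv q' hq'.1)
        rw [he] at a1 a2 a3
        have hsame : j / 2 ^ q * 2 ^ q = j / 2 ^ q' * 2 ^ q' := by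
          rcases lt_trichotomy (j / 2 ^ q * 2 ^ q) (j / 2 ^ q' * 2 ^ q') with h | h | h
          · have := stepStart_mono ℓ (Nat.succ_le_of_lt h)
            simp only [Nat.succ_eq_add_one] at this
            omega
          · exact h
          · have := stepStart_mono ℓ (Nat.succ_le_of_lt h)
            simp only [Nat.succ_eq_add_one] at this
            omega
        rw [a3, Option.some_inj] at b3
        exact Nat.pow_right_injective (le_refl 2) (by show 2 ^ q = 2 ^ q'; omega)) m
  refine hcore.trans ?_
  have hTN : T (2 ^ ℓ) ≤ (phaseSeq ℓ).length := by
    obtain ⟨n, hn⟩ : ∃ n, 2 ^ ℓ = n + 1 := ⟨2 ^ ℓ - 1, by have := Nat.one_le_two_pow (n := ℓ); omega⟩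
    rw [hn, hTs]
    exact (π.symm (ax n)).2
  have : C (T (2 ^ ℓ)) ≤ serviceCost (phaseSeq ℓ) π := by
    rw [hCN]
    exact le_trans (Nat.le_add_right _ _) (dist_sum p _ _ hTN).1
  gcongr

/-- Fix integers `0 < ℓ' < ℓ` and a constant `ε ∈ (0,1)` such that
`ℓ' = (1-ε)·ℓ`. Every service order with buffer size `ℓ'` for the phase sequence on the
line of `2^ℓ + 1` sites has cost at least
`2^ℓ · ℓ · ε² · (1+ε)⁻¹ · (log₂(1 + 1/ε))⁻¹`. -/
theorem stmt3 (ℓ ℓ' : ℕ) (ε : ℝ) (hℓ'pos : 0 < ℓ') (hℓ'ℓ : ℓ' < ℓ)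
    (hε : ε ∈ Set.Ioo (0 : ℝ) 1) (hℓ' : (ℓ' : ℝ) = (1 - ε) * (ℓ : ℝ))
    (π : Equiv.Perm (Fin (phaseSeq ℓ).length))
    (hπ : IsServiceOrder ℓ' (phaseSeq ℓ).length π) :
    (serviceCost (phaseSeq ℓ) π : ℝ) ≥
      2 ^ ℓ * (ℓ : ℝ) * ε ^ 2 * (1 + ε)⁻¹ * (Real.logb 2 (1 + 1 / ε))⁻¹ := by
  have hb := nat_bound ℓ ℓ' hℓ'pos hℓ'ℓ.le π hπ
  refine final_real ε (2 ^ ℓ) ℓ _ hε.1 hε.2 (by positivity) (by positivity) ?_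
  intro m
  have h := hb m
  have h' : (2 : ℝ) * (2 ^ m * (((ℓ : ℝ) - ℓ') * 2 ^ ℓ)) ≤
      2 * (ℓ * 2 ^ ℓ) + 2 ^ m * ((m + 1) * (serviceCost (phaseSeq ℓ) π : ℝ)) := by
    rw [← Nat.cast_sub hℓ'ℓ.le]
    exact_mod_cast h
  have e : (ℓ : ℝ) - ℓ' = ε * ℓ := by rw [hℓ']; ring
  rw [e] at h'
  exact h'
end

section
/- Fix η ∈ (0,1). Let T : ℕ × {q ∈ ℕ : q ≥ 1} × ℕ → ℝ be any function satisfying: (i) T(p,q,r) ≥ 2^q − 1 for all p, r ≥ 0 and q ≥ 1; (ii) for all q ≥ 2, r ≥ 0 and p ≥ 1, T(p,q,r) ≥ min{ 2^q + 2·T(p+r, q−1, 0), T(p−1, q−1, 0) + T(p−1, q−1, r+1) }; and (iii) for all q ≥ 2 and r ≥ 0, T(0,q,r) ≥ 2^q + 2·T(r, q−1, 0). Then T(p,q,r) ≥ τ(p,q,r) for all integers p ≥ 0, q ≥ 1, r ≥ 0. -/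
open Real

/-- `a = (1+η)·log₂(1 + 1/η)`. -/
noncomputable def aConst (η : ℝ) : ℝ := (1 + η) * Real.logb 2 (1 + 1 / η)

/-- `b_r = 2·(2^r - 1)·η`. -/
noncomputable def bConst (η : ℝ) (r : ℕ) : ℝ := 2 * ((2 : ℝ) ^ r - 1) * η

/-- `τ(p,q,r) = (2^q / a) · (q - (1+η)·p - b_r)`. -/
noncomputable def tau (η : ℝ) (p q r : ℕ) : ℝ :=
  (2 : ℝ) ^ q / aConst η * ((q : ℝ) - (1 + η) * (p : ℝ) - bConst η r)

lemma aux_a (η : ℝ) (h0 : 0 < η) (h1 : η < 1) : 2 ≤ aConst η := by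
  have hl : 0 < Real.log 2 := Real.log_pos (by norm_num)
  have hl1 : Real.log 2 < 1 := by linarith [Real.log_two_lt_d9]
  have hx : Real.log (2 * η / (1 + η)) ≤ 2 * η / (1 + η) - 1 :=
    Real.log_le_sub_one_of_pos (by positivity)
  have he : (1 + 1 / η) = 2 / (2 * η / (1 + η)) := by field_simp; ring
  have hM : Real.log (1 + 1 / η) = Real.log 2 - Real.log (2 * η / (1 + η)) := by
    rw [he, Real.log_div (by norm_num) (by positivity)]
  unfold aConst Real.logb
  rw [← mul_div_assoc, le_div_iff₀ hl, hM]
  have h2 : (1 + η) * (2 * η / (1 + η)) = 2 * η := by field_simp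
  nlinarith [mul_le_mul_of_nonneg_left hx (by linarith : 0 ≤ 1 + η),
    mul_nonneg (by linarith : 0 ≤ 1 - η) (by linarith : 0 ≤ 1 - Real.log 2)]

lemma aux_log (x : ℝ) (hx : 0 < x) : Real.log x / Real.log 2 + 1 / 2 ≤ x := by
  have hl : 0 < Real.log 2 := Real.log_pos (by norm_num)
  have hl6 : 0.69 < Real.log 2 := by linarith [Real.log_two_gt_d9]
  have hl1 : Real.log 2 < 0.7 := by linarith [Real.log_two_lt_d9]
  have e1 := Real.log_le_sub_one_of_pos (mul_pos hx hl)
  rw [Real.log_mul hx.ne' hl.ne'] at e1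
  have e2 := Real.one_sub_inv_le_log_of_pos hl
  have e3 : (Real.log 2)⁻¹ ≤ 2 - Real.log 2 / 2 := by
    rw [inv_le_iff_one_le_mul₀ hl]
    nlinarith
  have e4 : Real.log x ≤ (x - 1 / 2) * Real.log 2 := by linarith
  have := (div_le_iff₀ hl).2 e4
  linarith

lemma aux_key (η : ℝ) (h0 : 0 < η) (h1 : η < 1) (r : ℕ) :
    0 ≤ aConst η - 1 - (1 + η) * r + bConst η r := by
  have hl : 0 < Real.log 2 := Real.log_pos (by norm_num)
  have h := aux_log (2 * 2 ^ r / (1 + 1 / η)) (by positivity)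
  rw [Real.log_div (by positivity) (by positivity), Real.log_mul (by norm_num) (by positivity),
    Real.log_pow] at h
  have e : (Real.log 2 + r * Real.log 2 - Real.log (1 + 1 / η)) / Real.log 2
      = 1 + r - Real.logb 2 (1 + 1 / η) := by
    unfold Real.logb; field_simp
  rw [e] at h
  have h3 := mul_le_mul_of_nonneg_left h (by linarith : 0 ≤ 1 + η)
  have e2 : (1 + η) * (2 * 2 ^ r / (1 + 1 / η)) = 2 * 2 ^ r * η := by field_simp; ring
  rw [e2] at h3
  unfold aConst bConst
  nlinarith

lemma aux_b (η : ℝ) (h0 : 0 < η) (r : ℕ) : 0 ≤ bConst η r := by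
  have : (1 : ℝ) ≤ 2 ^ r := one_le_pow₀ (by norm_num)
  unfold bConst
  have : (0 : ℝ) ≤ 2 ^ r - 1 := by linarith
  positivity

lemma aux_first (η : ℝ) (h0 : 0 < η) (h1 : η < 1) (p q r : ℕ) :
    tau η p (q + 1) r ≤ 2 ^ (q + 1) + 2 * tau η (p + r) q 0 := by
  have ha : 0 < aConst η := by linarith [aux_a η h0 h1]
  have hk := aux_key η h0 h1 r
  have hd : (2 : ℝ) ^ (q + 1) + 2 * tau η (p + r) q 0 - tau η p (q + 1) r
      = 2 ^ (q + 1) / aConst η * (aConst η - 1 - (1 + η) * r + bConst η r) := by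
    have hb : bConst η 0 = 0 := by simp [bConst]
    unfold tau
    rw [hb]
    push_cast
    field_simp
    ring
  have : 0 ≤ 2 ^ (q + 1) / aConst η * (aConst η - 1 - (1 + η) * r + bConst η r) := by positivity
  linarith

lemma aux_second (η : ℝ) (p q r : ℕ) :
    tau η (p + 1) (q + 1) r = tau η p q 0 + tau η p q (r + 1) := by
  unfold tau bConst
  push_cast
  ring

/-- **Lemma 5.** Fix `η ∈ (0,1)`. Let `T` be any function satisfying
(i) `T(p,q,r) ≥ 2^q - 1` for all `p, r ≥ 0`, `q ≥ 1`;
(ii) for all `q ≥ 2`, `r ≥ 0`, `p ≥ 1`,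
`T(p,q,r) ≥ min { 2^q + 2·T(p+r, q-1, 0), T(p-1, q-1, 0) + T(p-1, q-1, r+1) }`;
(iii) for all `q ≥ 2`, `r ≥ 0`, `T(0,q,r) ≥ 2^q + 2·T(r, q-1, 0)`.
Then `T(p,q,r) ≥ τ(p,q,r)` for all `p ≥ 0`, `q ≥ 1`, `r ≥ 0`. -/
theorem stmt4 (η : ℝ) (hη : η ∈ Set.Ioo (0 : ℝ) 1) (T : ℕ → ℕ → ℕ → ℝ)
    (h1 : ∀ p q r : ℕ, 1 ≤ q → T p q r ≥ (2 : ℝ) ^ q - 1)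
    (h2 : ∀ p q r : ℕ, 2 ≤ q → 1 ≤ p →
      T p q r ≥ min ((2 : ℝ) ^ q + 2 * T (p + r) (q - 1) 0)
        (T (p - 1) (q - 1) 0 + T (p - 1) (q - 1) (r + 1)))
    (h3 : ∀ q r : ℕ, 2 ≤ q → T 0 q r ≥ (2 : ℝ) ^ q + 2 * T r (q - 1) 0) :
    ∀ p q r : ℕ, 1 ≤ q → T p q r ≥ tau η p q r := by
  obtain ⟨h0, hlt⟩ := hη
  intro p q r hq
  induction q, hq using Nat.le_induction generalizing p r with
  | base =>
    have ha := aux_a η h0 hlt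
    have hb := aux_b η h0 r
    have ht := h1 p 1 r le_rfl
    have hp : 0 ≤ (1 + η) * (p : ℝ) := by positivity
    have : tau η p 1 r ≤ 1 := by
      unfold tau
      rw [div_mul_eq_mul_div, div_le_one (by linarith)]
      push_cast
      linarith
    norm_num at ht
    linarith
  | succ q hq ih =>
    have hf := aux_first η h0 hlt p q r
    rcases p with _ | p
    · have h := h3 (q + 1) r (by omega)
      have i := ih r 0
      simp only [Nat.add_sub_cancel, Nat.zero_add] at h hf
      linarith
    · have h := h2 (p + 1) (q + 1) r (by omega) (by omega)
      have i1 := ih (p + 1 + r) 0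
      have i2 := ih p 0
      have i3 := ih p (r + 1)
      have hs := aux_second η p q r
      simp only [Nat.add_sub_cancel] at h
      refine le_trans (le_min ?_ ?_) h <;> linarith
end

section
/- Fix ε ∈ (0,1) and an integer ℓ ≥ 1 such that ℓ' = (1−ε)·ℓ is a positive integer. Let T : ℕ × {q ∈ ℕ : q ≥ 1} × ℕ → ℝ be any function satisfying: (i) T(p,q,r) ≥ 2^q − 1 for all p, r ≥ 0 and q ≥ 1; (ii) for all q ≥ 2, r ≥ 0 and p ≥ 1, T(p,q,r) ≥ min{ 2^q + 2·T(p+r, q−1, 0), T(p−1, q−1, 0) + T(p−1, q−1, r+1) }; and (iii) for all q ≥ 2 and r ≥ 0, T(0,q,r) ≥ 2^q + 2·T(r, q−1, 0). Then T(ℓ', ℓ, 0) ≥ 2^ℓ · ℓ · ε² / ((1+ε)·log₂(1 + 1/ε)). -/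
theorem aux_key_s5 (L g : ℝ) (hL : 1 ≤ L) (hg : g = Real.exp (-(L * Real.log 2))) (hg2 : g ≤ 1/2) (m : ℕ) :
    (m : ℝ) - L ≤ g * 2 ^ m - g := by
  have a := Real.log_two_gt_d9
  have b := Real.log_two_lt_d9
  have e : g * 2 ^ m = Real.exp (((m:ℝ) - L) * Real.log 2) := by
    have : (2:ℝ)^m = Real.exp (m * Real.log 2) := by
      rw [Real.exp_nat_mul, Real.exp_log (by norm_num)]
    rw [this, hg, ← Real.exp_add]; congr 1; ring
  rw [e]
  generalize (m:ℝ) - L = x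
  rcases le_total 0 x with hx | hx
  · have h : Real.exp (x * Real.log 2) = 2 * Real.exp ((x-1) * Real.log 2) := by
      nth_rewrite 2 [← Real.exp_log (show (0:ℝ) < 2 by norm_num)]
      rw [← Real.exp_add]; congr 1; ring
    have := Real.add_one_le_exp ((x-1) * Real.log 2)
    nlinarith
  · have := Real.add_one_le_exp (x * Real.log 2)
    nlinarith

theorem aux_base (L g : ℝ) (hL : 1 ≤ L) (hg : g = Real.exp (-(L * Real.log 2))) :
    2 * (1 - g) ≤ L := by
  have b := Real.log_two_lt_d9
  have h : 2 * g = Real.exp ((1 - L) * Real.log 2) := by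
    nth_rewrite 1 [← Real.exp_log (show (0:ℝ) < 2 by norm_num)]
    rw [hg, ← Real.exp_add]; congr 1; ring
  have := Real.add_one_le_exp ((1 - L) * Real.log 2)
  nlinarith

theorem aux_main (L g : ℝ) (hL : 1 ≤ L) (hg0 : 0 < g) (hb : 2 * (1 - g) ≤ L)
    (hk : ∀ m : ℕ, (m : ℝ) - L ≤ g * 2 ^ m - g)
    (T : ℕ → ℕ → ℕ → ℝ)
    (h1 : ∀ p q r : ℕ, 1 ≤ q → T p q r ≥ (2 : ℝ) ^ q - 1)
    (h2 : ∀ p q r : ℕ, 2 ≤ q → 1 ≤ p →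
      T p q r ≥ min ((2 : ℝ) ^ q + 2 * T (p + r) (q - 1) 0)
        (T (p - 1) (q - 1) 0 + T (p - 1) (q - 1) (r + 1)))
    (h3 : ∀ q r : ℕ, 2 ≤ q → T 0 q r ≥ (2 : ℝ) ^ q + 2 * T r (q - 1) 0)
    (q : ℕ) (hq : 1 ≤ q) : ∀ p r : ℕ,
    2 ^ q * ((1 - g) * q - p - 2 * g * (2 ^ r - 1)) ≤ L * T p q r := by
  induction q, hq using Nat.le_induction with
  | base =>
    intro p r
    have h := h1 p 1 r le_rfl
    have hr : (1:ℝ) ≤ 2 ^ r := one_le_pow₀ (by norm_num)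
    have hp : (0:ℝ) ≤ p := Nat.cast_nonneg p
    have : 0 ≤ g * (2 ^ r - 1) := mul_nonneg hg0.le (by linarith)
    push_cast
    norm_num at h ⊢
    nlinarith
  | succ q hq ih =>
    intro p r
    have hQ : (0:ℝ) < 2 ^ q := by positivity
    have A : ∀ p r : ℕ, 2 ^ (q+1) * ((1 - g) * ((q+1 : ℕ):ℝ) - p - 2 * g * (2 ^ r - 1)) ≤
        L * ((2:ℝ) ^ (q+1) + 2 * T (p + r) q 0) := by
      intro p r
      have i := ih (p + r) 0
      have k := mul_le_mul_of_nonneg_left (hk (r+1)) hQ.le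
      push_cast at i k ⊢
      rw [pow_succ] at k ⊢
      nlinarith
    rcases Nat.eq_zero_or_pos p with rfl | hp
    · have h := h3 (q+1) r (by omega)
      have a := A 0 r
      simp only [Nat.add_sub_cancel, zero_add] at h a
      exact a.trans (mul_le_mul_of_nonneg_left h (by linarith))
    · have h := h2 p (q+1) r (by omega) hp
      simp only [Nat.add_sub_cancel] at h
      refine le_trans ?_ (mul_le_mul_of_nonneg_left h (by linarith))
      rcases min_choice ((2 : ℝ) ^ (q+1) + 2 * T (p + r) q 0) (T (p - 1) q 0 + T (p - 1) q (r + 1)) with e | e <;> rw [e]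
      · exact A p r
      · have i := ih (p-1) 0
        have j := ih (p-1) (r+1)
        obtain ⟨p, rfl⟩ : ∃ k, p = k + 1 := ⟨p-1, by omega⟩
        simp only [Nat.add_sub_cancel] at i j ⊢
        push_cast at i j ⊢
        rw [pow_succ] at j ⊢
        nlinarith

/-- Fix `ε ∈ (0,1)` and an integer `ℓ ≥ 1` such that `ℓ' = (1-ε)·ℓ`
is a positive integer. Let `T` be any function satisfying
(i) `T(p,q,r) ≥ 2^q - 1` for all `p, r ≥ 0`, `q ≥ 1`;
(ii) for all `q ≥ 2`, `r ≥ 0`, `p ≥ 1`,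
`T(p,q,r) ≥ min { 2^q + 2·T(p+r, q-1, 0), T(p-1, q-1, 0) + T(p-1, q-1, r+1) }`;
(iii) for all `q ≥ 2`, `r ≥ 0`, `T(0,q,r) ≥ 2^q + 2·T(r, q-1, 0)`.
Then `T(ℓ', ℓ, 0) ≥ 2^ℓ · ℓ · ε² / ((1+ε)·log₂(1 + 1/ε))`. -/
theorem stmt5 (ε : ℝ) (hε : ε ∈ Set.Ioo (0 : ℝ) 1) (ℓ ℓ' : ℕ) (hℓ : 1 ≤ ℓ)
    (hℓ'pos : 0 < ℓ') (hℓ' : (ℓ' : ℝ) = (1 - ε) * (ℓ : ℝ))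
    (T : ℕ → ℕ → ℕ → ℝ)
    (h1 : ∀ p q r : ℕ, 1 ≤ q → T p q r ≥ (2 : ℝ) ^ q - 1)
    (h2 : ∀ p q r : ℕ, 2 ≤ q → 1 ≤ p →
      T p q r ≥ min ((2 : ℝ) ^ q + 2 * T (p + r) (q - 1) 0)
        (T (p - 1) (q - 1) 0 + T (p - 1) (q - 1) (r + 1)))
    (h3 : ∀ q r : ℕ, 2 ≤ q → T 0 q r ≥ (2 : ℝ) ^ q + 2 * T r (q - 1) 0) :
    T ℓ' ℓ 0 ≥ 2 ^ ℓ * (ℓ : ℝ) * ε ^ 2 / ((1 + ε) * Real.logb 2 (1 + 1 / ε)) := by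
  obtain ⟨e0, e1⟩ := hε
  have hl2 : 0 < Real.log 2 := Real.log_pos (by norm_num)
  set L := Real.logb 2 (1 + 1 / ε) with hLd
  have hpos : 0 < 1 + 1 / ε := by positivity
  have hL : 1 ≤ L := by
    rw [hLd, Real.le_logb_iff_rpow_le (by norm_num) hpos]
    have : 1 ≤ 1 / ε := by rw [le_div_iff₀ e0]; linarith
    norm_num at this ⊢
    linarith
  have hg : ε / (1 + ε) = Real.exp (-(L * Real.log 2)) := by
    rw [hLd, Real.logb, div_mul_cancel₀ _ hl2.ne', Real.exp_neg, Real.exp_log hpos]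
    field_simp
    ring
  have hg2 : ε / (1 + ε) ≤ 1 / 2 := by
    rw [div_le_div_iff₀ (by linarith) (by norm_num)]; linarith
  have M := aux_main L (ε / (1 + ε)) hL (by positivity) (aux_base L _ hL hg)
    (aux_key_s5 L _ hL hg hg2) T h1 h2 h3 ℓ hℓ ℓ' 0
  rw [ge_iff_le, div_le_iff₀ (by positivity)]
  have e : 2 ^ ℓ * (ℓ : ℝ) * ε ^ 2 = (1 + ε) * (2 ^ ℓ * ((1 - ε / (1 + ε)) * ℓ - ℓ' - 2 * (ε / (1 + ε)) * (2 ^ 0 - 1))) := by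
    rw [hℓ']; field_simp; ring
  rw [e]
  calc _ ≤ (1 + ε) * (L * T ℓ' ℓ 0) := mul_le_mul_of_nonneg_left M (by linarith)
    _ = _ := by ring
end

section
/- For every η ∈ (0,1) and every real r ≥ 0, (1+η)·r − 2·(2^r − 1)·η + 1 ≤ (1+η)·log₂(1 + 1/η). -/
/-- For every `η ∈ (0,1)` and every real `r ≥ 0`,
`(1+η)·r - 2·(2^r - 1)·η + 1 ≤ (1+η)·log₂(1 + 1/η)`.
Here `2^r` is the real exponential with base 2. -/
theorem stmt6 (η : ℝ) (hη : η ∈ Set.Ioo (0 : ℝ) 1) (r : ℝ) (hr : 0 ≤ r) :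
    (1 + η) * r - 2 * ((2 : ℝ) ^ r - 1) * η + 1 ≤ (1 + η) * Real.logb 2 (1 + 1 / η) := by
  obtain ⟨h0, h1⟩ := hη
  have hL1 := Real.log_two_gt_d9
  have hL2 := Real.log_two_lt_d9
  have hx : (0 : ℝ) < 2 ^ r := Real.rpow_pos_of_pos (by norm_num) r
  have hlx : Real.log ((2 : ℝ) ^ r) = r * Real.log 2 := Real.log_rpow (by norm_num) r
  have hz : 0 < 1 + 1 / η := by positivity
  have hzz : (1 + 1 / η) * η = 1 + η := by field_simp; ring
  rw [Real.logb]
  set x := (2 : ℝ) ^ r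
  set z := 1 + 1 / η
  set L := Real.log 2 with hL
  have hLp : 0 < L := by linarith
  have a1 : Real.log (2 * L * (x / z)) = L + Real.log L + (r * L - Real.log z) := by
    rw [Real.log_mul (by positivity) (by positivity), Real.log_mul (by norm_num) hLp.ne',
      Real.log_div hx.ne' hz.ne', hlx]
  have a2 := Real.log_le_sub_one_of_pos (show 0 < 2 * L * (x / z) by positivity)
  have a3 := Real.one_sub_inv_le_log_of_pos hLp
  have a4 : L⁻¹ ≤ 3 / 2 := by
    rw [inv_le_comm₀ hLp (by norm_num)]; norm_num; linarith
  have a5 : r * L - Real.log z ≤ (2 * (x / z) - 3 / 2) * L := by nlinarith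
  have a6 : r - Real.log z / L ≤ 2 * (x / z) - 3 / 2 := by
    have : r - Real.log z / L = (r * L - Real.log z) / L := by field_simp
    rw [this, div_le_iff₀ hLp]; exact a5
  have a7 : (1 + η) * (x / z) = x * η := by
    rw [← hzz]; field_simp
  have a8 := mul_le_mul_of_nonneg_left a6 (show 0 ≤ 1 + η by linarith)
  nlinarith
end

section
/- Fix η ∈ (0,1). For all integers p ≥ 0 and r ≥ 0, τ(p,1,r) ≤ 1; that is, (2/a)·(1 − (1+η)·p − b_r) ≤ 1. -/
open Real

/-- Fix `η ∈ (0,1)`. For all integers `p ≥ 0` and `r ≥ 0`,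
`τ(p,1,r) ≤ 1`; that is, `(2/a)·(1 - (1+η)·p - b_r) ≤ 1`. -/
theorem stmt9 (η : ℝ) (hη : η ∈ Set.Ioo (0 : ℝ) 1) (p r : ℕ) :
    2 / aConst η * (1 - (1 + η) * (p : ℝ) - bConst η r) ≤ 1 := by
  obtain ⟨h0, h1⟩ := hη
  have hl2 : 0 < Real.log 2 := Real.log_pos (by norm_num)
  have hl2' : Real.log 2 < 1 := by linarith [Real.log_two_lt_d9]
  have ha : 2 ≤ aConst η := by
    have e : (1 + 1 / η) = 2 * ((1 + η) / (2 * η)) := by field_simp; ring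
    have h2 := Real.one_sub_inv_le_log_of_pos (x := (1 + η) / (2 * η)) (by positivity)
    have h3 : Real.log (1 + 1 / η) = Real.log 2 + Real.log ((1 + η) / (2 * η)) := by
      rw [e, Real.log_mul (by norm_num) (by positivity)]
    have h4 : (1 + η) * (1 - ((1 + η) / (2 * η))⁻¹) = 1 - η := by
      field_simp; ring
    have h5 := mul_le_mul_of_nonneg_left h2 (by linarith : (0:ℝ) ≤ 1 + η)
    unfold aConst Real.logb
    rw [← mul_div_assoc, le_div_iff₀ hl2, h3]
    nlinarith [mul_pos (sub_pos.2 h1) (sub_pos.2 hl2')]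
  have hb : 0 ≤ bConst η r := by
    have : (1:ℝ) ≤ 2 ^ r := one_le_pow₀ (by norm_num)
    unfold bConst
    exact mul_nonneg (mul_nonneg (by norm_num) (by linarith)) h0.le
  have hp : 0 ≤ (1 + η) * (p : ℝ) := by positivity
  rw [div_mul_eq_mul_div, div_le_one (by linarith)]
  linarith
end

section
/- Fix η ∈ (0,1). For all integers q ≥ 2, p ≥ 0 and r ≥ 0, 2^q + 2·τ(p+r, q−1, 0) ≥ τ(p, q, r). -/
open Real

/-- Fix `η ∈ (0,1)`. For all integers `q ≥ 2`, `p ≥ 0` and `r ≥ 0`,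
`2^q + 2·τ(p+r, q-1, 0) ≥ τ(p, q, r)`. -/
theorem stmt10 (η : ℝ) (hη : η ∈ Set.Ioo (0 : ℝ) 1) (q p r : ℕ) (hq : 2 ≤ q) :
    (2 : ℝ) ^ q + 2 * tau η (p + r) (q - 1) 0 ≥ tau η p q r := by
  obtain ⟨h0, h1⟩ := hη
  have hl1 := Real.log_two_gt_d9
  have hl2 := Real.log_two_lt_d9
  have hl : 0 < Real.log 2 := by linarith
  have hpos : 0 < 1 + η := by linarith
  have hgt : 1 < 1 + 1 / η := by
    have : 0 < 1 / η := by positivity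
    linarith
  have hL : 0 < Real.log (1 + 1 / η) := Real.log_pos hgt
  have ha : 0 < aConst η := by
    unfold aConst Real.logb
    positivity
  have hR : (0 : ℝ) < 2 ^ r := by positivity
  have key : 0 ≤ aConst η - 1 - (1 + η) * r + bConst η r := by
    have h32 : Real.log (3 / 2) ≤ 3 / 2 - 1 := Real.log_le_sub_one_of_pos (by norm_num)
    have e1 : (4 / 3 * 2 ^ r * (η / (1 + η)) : ℝ) = 2 ^ r * 2 / (1 + 1 / η) / (3 / 2) := by
      field_simp
      ring
    have h3 : Real.log (4 / 3 * 2 ^ r * (η / (1 + η))) ≤ 4 / 3 * 2 ^ r * (η / (1 + η)) - 1 :=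
      Real.log_le_sub_one_of_pos (by positivity)
    have e2 : Real.log (4 / 3 * 2 ^ r * (η / (1 + η)))
        = r * Real.log 2 + Real.log 2 - Real.log (1 + 1 / η) - Real.log (3 / 2) := by
      rw [e1, Real.log_div (by positivity) (by norm_num), Real.log_div (by positivity) (by positivity),
        Real.log_mul (by positivity) (by norm_num), Real.log_pow]
    rw [e2] at h3
    set u := η / (1 + η) with hu
    have hu0 : 0 < u := by positivity
    have hu1 : u < 1 / 2 := by
      rw [hu, div_lt_div_iff₀ hpos (by norm_num)]
      linarith
    have hη' : η = (1 + η) * u := by rw [hu]; field_simp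
    have hy : 0 < 2 ^ r * u := by positivity
    have h4 : 0 ≤ Real.log (1 + 1 / η) / Real.log 2 - 1 - u - r + 2 * (2 ^ r * u) := by
      have : 0 ≤ Real.log (1 + 1 / η) - (1 + u + r - 2 * (2 ^ r * u)) * Real.log 2 := by
        nlinarith [mul_pos hy (sub_pos.2 hl1), mul_pos (sub_pos.2 hu1) hl]
      have h5 : 1 + u + r - 2 * (2 ^ r * u) ≤ Real.log (1 + 1 / η) / Real.log 2 := by
        rw [le_div_iff₀ hl]
        linarith
      linarith
    have h6 := mul_nonneg hpos.le h4
    unfold aConst bConst Real.logb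
    have e3 : (1 + η) * (Real.log (1 + 1 / η) / Real.log 2 - 1 - u - r + 2 * (2 ^ r * u))
      = (1 + η) * (Real.log (1 + 1 / η) / Real.log 2) - (1 + η) - (1 + η) * u - (1 + η) * r
        + 2 * 2 ^ r * ((1 + η) * u) := by ring
    rw [e3, ← hη'] at h6
    linarith
  obtain ⟨k, rfl⟩ : ∃ k, q = k + 1 := ⟨q - 1, by omega⟩
  have hid : (2 : ℝ) ^ (k + 1) + 2 * tau η (p + r) (k + 1 - 1) 0 - tau η p (k + 1) r
      = 2 ^ (k + 1) / aConst η * (aConst η - 1 - (1 + η) * r + bConst η r) := by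
    have hb : bConst η 0 = 0 := by simp [bConst]
    unfold tau
    rw [hb, Nat.add_sub_cancel]
    push_cast
    field_simp
    ring
  have : 0 ≤ (2 : ℝ) ^ (k + 1) / aConst η * (aConst η - 1 - (1 + η) * r + bConst η r) :=
    mul_nonneg (by positivity) key
  linarith
end

section
/- Fix a constant ε ∈ (0,1). There exists a constant c > 0 (depending only on ε) such that for all positive integers ℓ and β and every n ≥ 2^ℓ + 1, there exists a request sequence σ on the line of n equidistant sites such that for every integer h ≥ β·ℓ and every integer h' with 1 ≤ h' ≤ β·(1−ε)·ℓ, one has OPT(h, σ) > 0 and OPT(h', σ) ≥ c·ℓ·OPT(h, σ). -/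
namespace RB

lemma natDist_tri (a b c : ℕ) : natDist a c ≤ natDist a b + natDist b c := by
  unfold natDist; omega

lemma walk_eq (pos : ℕ → ℕ) (n : ℕ) :
    walkCost (pos 0) ((List.range n).map (fun t => pos (t+1))) =
      ∑ t ∈ Finset.range n, natDist (pos t) (pos (t+1)) := by
  induction n generalizing pos with
  | zero => simp [walkCost]
  | succ n ih =>
    rw [List.range_succ_eq_map, Finset.sum_range_succ']
    simp only [List.map_cons, List.map_map, walkCost]
    have := ih (fun t => pos (t+1))
    simp only [zero_add] at this ⊢
    rw [← this, add_comm]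
    rfl

lemma walk_seg (pos : ℕ → ℕ) (a b : ℕ) (h : a ≤ b) :
    natDist (pos a) (pos b) ≤ ∑ t ∈ Finset.Ico a b, natDist (pos t) (pos (t+1)) := by
  induction b, h using Nat.le_induction with
  | base => simp [natDist]
  | succ b h ih =>
    rw [Finset.sum_Ico_succ_top h]
    exact (natDist_tri _ (pos b) _).trans (by omega)

lemma cost_eq (σ : List ℕ) (f : ℕ → ℕ) (hf : ∀ t : Fin σ.length, σ.get t = f t)
    (π : Equiv.Perm (Fin σ.length)) (pos P : ℕ → ℕ) (h0 : pos 0 = 0)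
    (hP : ∀ t : Fin σ.length, P t = π t)
    (hpos : ∀ t, pos (t+1) = f (P t)) :
    serviceCost σ π = ∑ t ∈ Finset.range σ.length, natDist (pos t) (pos (t+1)) := by
  rw [← walk_eq, h0, serviceCost]
  congr 1
  rw [← List.map_coe_finRange_eq_range, List.map_map]
  apply List.map_congr_left
  intro t _
  simp [hpos, hP, ← hf]

lemma exists_ext (N : ℕ) (π : Equiv.Perm (Fin N)) :
    ∃ P : Equiv.Perm ℕ, (∀ t : Fin N, P t = π t) ∧ ∀ t, N ≤ t → P t = t := by
  refine ⟨π.extendDomain Fin.equivSubtype, ?_, ?_⟩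
  · intro t
    exact Equiv.Perm.extendDomain_apply_image π Fin.equivSubtype t
  · intro t ht
    exact Equiv.Perm.extendDomain_apply_not_subtype π Fin.equivSubtype (by omega)

/-- unserved count -/
lemma pending_s12 (P : Equiv.Perm ℕ) (k : ℕ) (hk : 1 ≤ k) (hP : ∀ t, P t ≤ t + k - 1) (t : ℕ)
    (U : Finset ℕ) (hU : ∀ q ∈ U, q < t + k ∧ t < P.symm q) : U.card < k := by
  have h1 : Disjoint U ((Finset.range (t+1)).image P) := by
    rw [Finset.disjoint_left]
    intro q hq hq'
    obtain ⟨s, hs, rfl⟩ := Finset.mem_image.1 hq'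
    have := (hU _ hq).2
    simp at this hs
    omega
  have h2 : U ∪ ((Finset.range (t+1)).image P) ⊆ Finset.range (t+k) := by
    intro q hq
    rcases Finset.mem_union.1 hq with hq | hq
    · simpa using (hU _ hq).1
    · obtain ⟨s, hs, rfl⟩ := Finset.mem_image.1 hq
      have := hP s
      simp at hs ⊢
      omega
  have h3 := Finset.card_le_card h2
  rw [Finset.card_union_of_disjoint h1, Finset.card_image_of_injective _ P.injective] at h3
  simp at h3
  omega

lemma barrier (P : Equiv.Perm ℕ) (k : ℕ) (hk : 1 ≤ k) (hP : ∀ t, P t ≤ t + k - 1)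
    (p L : ℕ) (hL : k ≤ L) : ∃ u, p ≤ u ∧ u < p + L ∧ P.symm u + k ≤ p + L := by
  by_contra! hcon
  have h2 : ((Finset.range (p+L-k+1)).image P) ⊆ Finset.range p := by
    intro q hq
    obtain ⟨s, hs, rfl⟩ := Finset.mem_image.1 hq
    have := hP s
    have h3 := hcon (P s)
    simp at hs h3 ⊢
    by_contra hc
    have := h3 (by omega) (by omega)
    omega
  have h3 := Finset.card_le_card h2
  rw [Finset.card_image_of_injective _ P.injective] at h3
  simp at h3
  omega

lemma sum_pow (m C : ℕ) : ∑ i ∈ (Finset.range m).filter (fun i => 2^i < C), 2^i ≤ 2*C := by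
  induction m with
  | zero => simp
  | succ m ih =>
    by_cases h : 2^m < C
    · calc _ ≤ ∑ i ∈ Finset.range (m+1), 2^i := Finset.sum_le_sum_of_subset (Finset.filter_subset _ _)
        _ ≤ 2^(m+1) := by rw [Nat.geomSum_eq (le_refl _)]; simp
        _ ≤ _ := by rw [pow_succ]; omega
    · rw [Finset.range_add_one, Finset.filter_insert, if_neg h]; exact ih

lemma count_mod (p : ℕ → Prop) [DecidablePred p] (c n : ℕ) :
    ((Finset.range (n*c)).filter (fun x => p (x % c))).card =
      n * ((Finset.range c).filter p).card := by
  rw [← Nat.count_eq_card_filter_range, ← Nat.count_eq_card_filter_range]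
  induction n with
  | zero => simp
  | succ n ih =>
    rw [Nat.succ_mul, Nat.count_add, ih, Nat.succ_mul]
    congr 1
    rw [Nat.count_eq_card_filter_range, Nat.count_eq_card_filter_range]
    congr 1
    apply Finset.filter_congr
    intro x hx
    have e : (n*c+x) % c = x % c := by rw [mul_comm, Nat.mul_add_mod]
    rw [e, Nat.mod_eq_of_lt (by simpa using hx)]

lemma deep_count (m i W : ℕ) (hi : i < m) (hW : 0 < W) :
    W * ((Finset.range (2^m)).filter (fun x => W * (2^i - x % 2^i) ≤ 2^i)).card ≤ 2^m := by
  have h : 2^m = 2^(m-i) * 2^i := by rw [← pow_add]; congr 1; omega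
  rw [h, count_mod (fun r => W * (2^i - r) ≤ 2^i)]
  have : W * ((Finset.range (2^i)).filter (fun r => W * (2^i - r) ≤ 2^i)).card ≤ 2^i := by
    calc _ ≤ W * (2^i / W) := by
          gcongr
          have : ((Finset.range (2^i)).filter (fun r => W * (2^i - r) ≤ 2^i)) ⊆
              Finset.Ico (2^i - 2^i/W) (2^i) := by
            intro r hr
            simp at hr ⊢
            have := (Nat.le_div_iff_mul_le hW).2 (show (2^i - r) * W ≤ 2^i by rw [mul_comm]; exact hr.2)
            omega
          have := Finset.card_le_card this
          rw [Nat.card_Ico] at this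
          exact this.trans (Nat.sub_sub_self (Nat.div_le_self _ _)).le
      _ ≤ _ := Nat.mul_div_le _ _
  calc _ = 2^(m-i) * (W * ((Finset.range (2^i)).filter (fun r => W * (2^i - r) ≤ 2^i)).card) := by ring
    _ ≤ _ := by gcongr

lemma block_count (m i y : ℕ) :
    ((Finset.range (2^m)).filter (fun x => x / 2^i = y / 2^i)).card ≤ 2^i := by
  have : (Finset.range (2^m)).filter (fun x => x / 2^i = y / 2^i) ⊆
      Finset.Ico (y/2^i*2^i) (y/2^i*2^i+2^i) := by
    intro x hx
    simp at hx ⊢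
    rw [← hx.2]
    have := Nat.div_add_mod x (2^i)
    have := Nat.mod_lt x (Nat.two_pow_pos i)
    rw [mul_comm]
    omega
  simpa using Finset.card_le_card this

def site (m x i : ℕ) : ℕ := if i < m ∧ 2^i ∣ x then x + 2^i else x

def req (m M β q : ℕ) : ℕ := site m (q/β/M) (q/β%M)

lemma idx_div {β g j : ℕ} (hj : j < β) : (g*β+j)/β = g := by
  rw [mul_comm, Nat.mul_add_div (by omega), Nat.div_eq_of_lt hj, add_zero]

lemma idx_mod {β g j : ℕ} (hj : j < β) : (g*β+j)%β = j := by
  rw [mul_comm, Nat.mul_add_mod, Nat.mod_eq_of_lt hj]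

lemma req_idx {m M β a i j : ℕ} (hi : i < M) (hj : j < β) :
    req m M β ((a*M+i)*β+j) = site m a i := by
  rw [req, idx_div hj, idx_div hi, idx_mod hi]

lemma req_block {m M β x u : ℕ} (hβ : 0 < β) (h1 : (x*M+m)*β ≤ u) (h2 : u < (x+1)*M*β) :
    req m M β u = x := by
  have g1 : x*M+m ≤ u/β := (Nat.le_div_iff_mul_le hβ).2 h1
  have g2 : u/β < (x+1)*M := (Nat.div_lt_iff_lt_mul hβ).2 h2
  rw [req]
  generalize u/β = g at *
  obtain ⟨r, rfl⟩ : ∃ r, g = x*M+r := ⟨g - x*M, by omega⟩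
  have hr : r < M := by rw [add_mul] at g2; omega
  rw [idx_div hr, idx_mod hr, site, if_neg (by omega)]

lemma key_unfreed (P : Equiv.Perm ℕ) (m M β k : ℕ) (hk1 : 1 ≤ k) (hm : m ≤ M)
    (hP : ∀ t, P t ≤ t + k - 1) (x u : ℕ) (hu1 : (x*M+m)*β ≤ u) (I : Finset ℕ)
    (hI : ∀ i ∈ I, i < m ∧ ∀ j < β, P.symm u ≤ P.symm ((x/2^i*2^i*M+i)*β+j)) :
    β * I.card ≤ k := by
  have h := pending_s12 P k hk1 hP (P.symm u)
    ((I ×ˢ Finset.range β).image (fun z => (x/2^z.1*2^z.1*M+z.1)*β+z.2)) (by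
      intro q hq
      simp only [Finset.mem_image, Finset.mem_product, Finset.mem_range, Prod.exists] at hq
      obtain ⟨i, j, ⟨hi, hj⟩, rfl⟩ := hq
      obtain ⟨him, hi2⟩ := hI i hi
      have h1 := hi2 j hj
      have h2 := hP (P.symm u)
      simp only [Equiv.apply_symm_apply] at h2
      have h3 : (x/2^i*2^i*M+i)*β+j < u := by
        calc _ < (x/2^i*2^i*M+i)*β+β := by omega
          _ = (x/2^i*2^i*M+(i+1))*β := by ring
          _ ≤ (x*M+m)*β := by
            gcongr
            · exact Nat.div_mul_le_self _ _
            · omega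
          _ ≤ u := hu1
      refine ⟨by omega, lt_of_le_of_ne h1 ?_⟩
      intro h
      have := P.symm.injective h
      omega)
  rw [Finset.card_image_of_injOn] at h
  · rw [Finset.card_product, Finset.card_range, mul_comm] at h
    exact h.le
  · rintro ⟨i, j⟩ h1 ⟨i', j'⟩ h2 heq
    simp only [Finset.coe_product, Set.mem_prod, Finset.mem_coe, Finset.mem_range] at h1 h2
    simp only at heq
    have e1 : j = j' := by
      have := congrArg (· % β) heq
      simpa only [idx_mod h1.2, idx_mod h2.2] using this
    have e2 := congrArg (· / β) heq
    simp only [idx_div h1.2, idx_div h2.2] at e2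
    have e3 := congrArg (· % M) e2
    simp only [idx_mod ((hI i h1.1).1.trans_le hm), idx_mod ((hI i' h2.1).1.trans_le hm)] at e3
    rw [e1, e3]

lemma pair_count (m W : ℕ) (hW : 0 < W) (B C : ℕ) (β : ℕ) (F : ℕ → ℕ → Prop) (D : ℕ → ℕ)
    (hF : ∀ x < 2^m, ∀ I : Finset ℕ, (∀ i ∈ I, i < m ∧ ¬ F x i) → β * I.card ≤ B)
    (hD : ∑ y ∈ Finset.range (2^m), D y ≤ C)
    (hk : ∀ x < 2^m, ∀ i < m, F x i → ∃ y < 2^m, x/2^i = y/2^i ∧ 2^i - x % 2^i ≤ D y) :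
    W*(β*(m*2^m)) ≤ W*β*(2*W*C) + W*(2^m*B) + β*(m*2^m) := by
  classical
  set A := Finset.range (2^m) ×ˢ Finset.range m with hA
  have hAc : A.card = m*2^m := by simp [hA, mul_comm]
  set UF := A.filter (fun z => ¬ F z.1 z.2)
  set DP := A.filter (fun z => W * (2^z.2 - z.1 % 2^z.2) ≤ 2^z.2)
  set G := (Finset.range (2^m)).biUnion (fun y =>
    A.filter (fun z => z.1/2^z.2 = y/2^z.2 ∧ 2^z.2 < W * D y))
  have hsub : A ⊆ (UF ∪ DP) ∪ G := by
    rintro ⟨x, i⟩ hz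
    have hz' := hz
    simp only [hA, Finset.mem_product, Finset.mem_range] at hz'
    by_cases h1 : F x i
    · by_cases h2 : W * (2^i - x % 2^i) ≤ 2^i
      · apply Finset.mem_union_left; apply Finset.mem_union_right
        exact Finset.mem_filter.2 ⟨hz, h2⟩
      · apply Finset.mem_union_right
        obtain ⟨y, hy, h3, h4⟩ := hk x hz'.1 i hz'.2 h1
        refine Finset.mem_biUnion.2 ⟨y, Finset.mem_range.2 hy, Finset.mem_filter.2 ⟨hz, h3, ?_⟩⟩
        exact lt_of_lt_of_le (not_le.1 h2) (Nat.mul_le_mul_left _ h4)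
    · apply Finset.mem_union_left; apply Finset.mem_union_left
      exact Finset.mem_filter.2 ⟨hz, h1⟩
  have c0 : m*2^m ≤ UF.card + DP.card + G.card := by
    rw [← hAc]
    exact (Finset.card_le_card hsub).trans ((Finset.card_union_le _ _).trans
      (Nat.add_le_add_right (Finset.card_union_le _ _) _))
  have c1 : β * UF.card ≤ 2^m*B := by
    have : UF.card = ∑ x ∈ Finset.range (2^m), ((Finset.range m).filter (fun i => ¬ F x i)).card := by
      simp only [UF, hA, Finset.card_filter, Finset.sum_product]
    rw [this, Finset.mul_sum]
    calc _ ≤ ∑ x ∈ Finset.range (2^m), B := by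
          apply Finset.sum_le_sum
          intro x hx
          apply hF x (Finset.mem_range.1 hx)
          intro i hi
          simpa using hi
      _ = _ := by simp
  have c2 : W * DP.card ≤ m*2^m := by
    have : DP.card = ∑ i ∈ Finset.range m, ((Finset.range (2^m)).filter
        (fun x => W * (2^i - x % 2^i) ≤ 2^i)).card := by
      simp only [DP, hA, Finset.card_filter, Finset.sum_product_right]
    rw [this, Finset.mul_sum]
    calc _ ≤ ∑ x ∈ Finset.range m, 2^m := by
          apply Finset.sum_le_sum
          intro i hi
          exact deep_count m i W (Finset.mem_range.1 hi) hW
      _ = _ := by simp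
  have c3 : G.card ≤ 2*W*C := by
    calc _ ≤ ∑ y ∈ Finset.range (2^m), (A.filter
            (fun z => z.1/2^z.2 = y/2^z.2 ∧ 2^z.2 < W * D y)).card := Finset.card_biUnion_le
      _ ≤ ∑ y ∈ Finset.range (2^m), 2*W*D y := by
          apply Finset.sum_le_sum
          intro y _
          have : (A.filter (fun z => z.1/2^z.2 = y/2^z.2 ∧ 2^z.2 < W * D y)).card =
              ∑ i ∈ (Finset.range m).filter (fun i => 2^i < W * D y),
                ((Finset.range (2^m)).filter (fun x => x/2^i = y/2^i)).card := by
            simp only [hA, Finset.card_filter, Finset.sum_product_right]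
            rw [Finset.sum_filter]
            apply Finset.sum_congr rfl
            intro i _
            split_ifs with h <;> simp [h]
          rw [this]
          calc _ ≤ ∑ i ∈ (Finset.range m).filter (fun i => 2^i < W * D y), 2^i :=
                Finset.sum_le_sum (fun i _ => block_count m i y)
            _ ≤ 2 * (W * D y) := sum_pow _ _
            _ = _ := by ring
      _ = 2*W*∑ y ∈ Finset.range (2^m), D y := by rw [Finset.mul_sum]
      _ ≤ _ := by gcongr
  calc W*(β*(m*2^m)) ≤ W*(β*(UF.card + DP.card + G.card)) := by gcongr
    _ = W*β*G.card + W*(β*UF.card) + β*(W*DP.card) := by ring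
    _ ≤ _ := by gcongr

lemma lower (m ℓ β k W N : ℕ) (hβ : 0 < β) (hk1 : 1 ≤ k) (hk : k ≤ ℓ*β)
    (hW : 0 < W) (P : Equiv.Perm ℕ) (hP : ∀ t, P t ≤ t + k - 1) (pos : ℕ → ℕ)
    (hpos : ∀ t, pos (t+1) = req m (m+ℓ) β (P t)) (hN : N = 2^m*(m+ℓ)*β)
    (hPN : ∀ t, N ≤ t → P t = t) :
    W*(β*(m*2^m)) ≤ W*β*(2*W*(∑ t ∈ Finset.range N, natDist (pos t) (pos (t+1))))
      + W*(2^m*k) + β*(m*2^m) := by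
  classical
  set M := m+ℓ with hM
  have hℓ : 0 < ℓ := by
    rcases Nat.eq_zero_or_pos ℓ with h | h
    · subst h; omega
    · exact h
  choose u hu1 hu2 hu3 using fun x => barrier P k hk1 hP ((x*M+m)*β) (ℓ*β) hk
  have hend : ∀ x, (x*M+m)*β+ℓ*β = (x+1)*M*β := by intro x; rw [hM]; ring
  simp only [hend] at hu2 hu3
  set τ : ℕ → ℕ := fun x => P.symm (u x) with hτ
  have hPτ : ∀ x, P (τ x) = u x := by intro x; simp [hτ]
  have hafter : ∀ x q, (x+1)*M*β ≤ q → τ x < P.symm q := by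
    intro x q hq
    have h1 := hP (P.symm q)
    have h2 := hu3 x
    simp only [Equiv.apply_symm_apply] at h1
    simp only [hτ]
    omega
  have hmono : StrictMono τ := by
    apply strictMono_nat_of_lt_succ
    intro x
    apply hafter
    refine le_trans ?_ (hu1 (x+1))
    gcongr
    omega
  have hposτ : ∀ x, pos (τ x+1) = x := by
    intro x
    rw [hpos, hPτ]
    exact req_block hβ (hu1 x) (hu2 x)
  set T : ℕ → ℕ := fun y => if y = 0 then 0 else τ (y-1) + 1 with hT
  have hT1 : ∀ y, T (y+1) = τ y + 1 := by intro y; simp [hT]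
  have hTle : ∀ y, T y ≤ T (y+1) := by
    intro y
    rw [hT1]
    rcases y with _ | y
    · simp [hT]
    · rw [hT1]; have := hmono (Nat.lt_add_one y); omega
  set d : ℕ → ℕ := fun t => natDist (pos t) (pos (t+1)) with hd
  set D : ℕ → ℕ := fun y => ∑ t ∈ Finset.Ico (T y) (T (y+1)), d t with hD
  have hsum : ∀ Y, ∑ y ∈ Finset.range Y, D y = ∑ t ∈ Finset.range (T Y), d t := by
    intro Y
    induction Y with
    | zero => simp [hT]
    | succ Y ih =>
      rw [Finset.sum_range_succ, ih, hD]
      exact Finset.sum_range_add_sum_Ico _ (hTle Y)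
  have hTN : T (2^m) ≤ N := by
    obtain ⟨y, hy⟩ : ∃ y, 2^m = y+1 := ⟨2^m-1, by have := Nat.two_pow_pos m; omega⟩
    rw [hy, hT1]
    by_contra hc
    have h1 := hPN (τ y) (by omega)
    rw [hPτ] at h1
    have h2 := hu2 y
    rw [← hy, ← hN] at h2
    omega
  apply pair_count m W hW k _ β
    (fun x i => ∃ j < β, P.symm ((x/2^i*2^i*M+i)*β+j) < τ x) D
  · intro x hx I hI
    apply key_unfreed P m M β k hk1 (by omega) hP x (u x) (hu1 x) I
    intro i hi
    obtain ⟨h1, h2⟩ := hI i hi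
    push Not at h2
    exact ⟨h1, h2⟩
  · rw [hsum]
    exact Finset.sum_le_sum_of_subset (Finset.range_mono hTN)
  · rintro x hx i hi ⟨j, hj, hlt⟩
    set a := x/2^i*2^i with ha
    set q := (a*M+i)*β+j with hq
    have hex : ∃ y, P.symm q < τ y := ⟨x, hlt⟩
    set y := Nat.find hex with hy
    have hy1 : P.symm q < τ y := Nat.find_spec hex
    have hyx : y ≤ x := Nat.find_min' hex hlt
    have hay : a ≤ y := by
      by_contra hc
      have h1 : (y+1)*M*β ≤ q := by
        calc (y+1)*M*β ≤ a*M*β := by gcongr; omega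
          _ ≤ (a*M+i)*β := by gcongr; omega
          _ ≤ q := by omega
      have := hafter y q h1
      omega
    have hTy : T y ≤ P.symm q + 1 := by
      rcases Nat.eq_zero_or_pos y with h0 | h0
      · rw [h0]; simp [hT]
      · have h1 : ¬ (P.symm q < τ (y-1)) := Nat.find_min hex (by omega)
        have h2 : T y = τ (y-1) + 1 := by simp only [hT]; rw [if_neg (by omega)]
        omega
    have hxa : a + x % 2^i = x := by rw [ha, mul_comm]; exact Nat.div_add_mod x (2^i)
    have hxm : x % 2^i < 2^i := Nat.mod_lt _ (Nat.two_pow_pos i)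
    refine ⟨y, by omega, ?_, ?_⟩
    · symm
      rw [Nat.div_eq_iff (Nat.two_pow_pos i)]
      constructor
      · rw [← ha]; exact hay
      · rw [← ha]; omega
    · have hpq : pos (P.symm q + 1) = a + 2^i := by
        rw [hpos, Equiv.apply_symm_apply, hq, req_idx (by omega) hj, site, if_pos]
        exact ⟨hi, Dvd.intro_left _ rfl⟩
      have hseg := walk_seg pos (P.symm q + 1) (τ y + 1) (by omega)
      rw [hpq, hposτ] at hseg
      have h1 : 2^i - x % 2^i ≤ natDist (a+2^i) y := by
        unfold natDist; omega
      refine h1.trans (hseg.trans ?_)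
      rw [hD]
      apply Finset.sum_le_sum_of_subset
      rw [hT1]
      exact Finset.Ico_subset_Ico_left hTy

lemma opt_le {k : ℕ} {σ : List ℕ} (π : Equiv.Perm (Fin σ.length))
    (h : IsServiceOrder k σ.length π) : OPT k σ ≤ serviceCost σ π :=
  Nat.sInf_le ⟨π, h, rfl⟩

lemma opt_spec {k : ℕ} (hk : 1 ≤ k) (σ : List ℕ) :
    ∃ π : Equiv.Perm (Fin σ.length), IsServiceOrder k σ.length π ∧ serviceCost σ π = OPT k σ := by
  have : {c | ∃ π : Equiv.Perm (Fin σ.length),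
      IsServiceOrder k σ.length π ∧ serviceCost σ π = c}.Nonempty :=
    ⟨_, Equiv.refl _, fun t => by simp; omega, rfl⟩
  exact Nat.sInf_mem this

lemma opt_mono {k k' : ℕ} (hk : 1 ≤ k) (h : k ≤ k') (σ : List ℕ) : OPT k' σ ≤ OPT k σ := by
  obtain ⟨π, h1, h2⟩ := opt_spec hk σ
  rw [← h2]
  exact opt_le π (fun t => (h1 t).trans (by omega))

/-- position function of a service order. -/
def posOf (f : ℕ → ℕ) (P : ℕ → ℕ) : ℕ → ℕ
  | 0 => 0
  | t+1 => f (P t)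

lemma opt_pos {k : ℕ} (hk : 1 ≤ k) (σ : List ℕ) (f : ℕ → ℕ)
    (hf : ∀ t : Fin σ.length, σ.get t = f t) (q : ℕ) (hq : q < σ.length) (hs : 0 < f q) :
    0 < OPT k σ := by
  obtain ⟨π, h1, h2⟩ := opt_spec hk σ
  obtain ⟨P, hP1, hP2⟩ := exists_ext _ π
  rw [← h2, cost_eq σ f hf π (posOf f P) P rfl hP1 (fun t => rfl)]
  set t := π.symm ⟨q, hq⟩ with ht
  have h3 := walk_seg (posOf f P) 0 (t+1) (by omega)
  have h4 : posOf f P (t+1) = f q := by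
    change f (P t) = f q
    rw [hP1, ht]; simp
  have h5 : natDist (posOf f P 0) (posOf f P (t+1)) = f q := by
    rw [h4]; change natDist 0 (f q) = f q; simp [natDist]
  rw [h5] at h3
  refine lt_of_lt_of_le hs (h3.trans ?_)
  apply Finset.sum_le_sum_of_subset
  intro s hs
  have := t.2
  simp at hs ⊢
  omega

lemma opt_upper {h : ℕ} (σ : List ℕ) (f : ℕ → ℕ)
    (hf : ∀ t : Fin σ.length, σ.get t = f t) (Bd : ℕ) (hB : ∀ q < σ.length, f q ≤ Bd)
    (hov : ∀ j < σ.length, ((Finset.range j).filter (fun q => f j < f q)).card + 1 ≤ h) :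
    OPT h σ ≤ Bd := by
  set N := σ.length with hN
  let g : Fin N → ℕ := fun q => f q * N + q
  have hginj : Function.Injective g := by
    intro a b hab
    have := congrArg (· % N) hab
    simp only [g, idx_mod a.2, idx_mod b.2] at this
    exact Fin.ext this
  have hgf : ∀ a b : Fin N, g a ≤ g b → f a ≤ f b := by
    intro a b hab
    have := Nat.div_le_div_right (c := N) hab
    simpa only [g, idx_div a.2, idx_div b.2] using this
  let π : Equiv.Perm (Fin N) := Tuple.sort g
  have hmono : Monotone (g ∘ π) := Tuple.monotone_sort g
  have hvalid : IsServiceOrder h N π := by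
    intro t
    have hsub : Finset.range (π t : ℕ) ⊆
        ((Finset.range (π t : ℕ)).filter (fun q => f (π t) < f q)) ∪
        (Finset.univ.filter (fun s : Fin N => s < t)).image (fun s => (π s : ℕ)) := by
      intro q hq
      rw [Finset.mem_range] at hq
      by_cases hc : f (π t) < f q
      · apply Finset.mem_union_left
        simp [hq, hc]
      · apply Finset.mem_union_right
        have hqN : q < N := hq.trans (π t).2
        refine Finset.mem_image.2 ⟨π.symm ⟨q, hqN⟩, ?_, by simp⟩
        simp only [Finset.mem_filter, Finset.mem_univ, true_and]
        by_contra hle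
        have h1 := hmono (not_lt.1 hle)
        simp only [Function.comp, Equiv.apply_symm_apply, g] at h1
        have : f q * N ≤ f (π t) * N := Nat.mul_le_mul_right _ (not_lt.1 hc)
        omega
    have hc := (Finset.card_le_card hsub).trans (Finset.card_union_le _ _)
    have hi : ((Finset.univ.filter (fun s : Fin N => s < t)).image (fun s => (π s : ℕ))).card ≤ t := by
      refine Finset.card_image_le.trans ?_
      rw [Finset.filter_gt_eq_Iio, Fin.card_Iio]
    have := hov (π t) (π t).2
    rw [Finset.card_range] at hc
    omega
  refine (opt_le π hvalid).trans ?_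
  obtain ⟨P, hP1, hP2⟩ := exists_ext _ π
  rw [cost_eq σ f hf π (posOf f P) P rfl hP1 (fun t => rfl)]
  have key : ∀ n ≤ N, ∑ t ∈ Finset.range n, natDist (posOf f P t) (posOf f P (t+1)) = posOf f P n := by
    intro n hn
    induction n with
    | zero => simp [posOf]
    | succ n ih =>
      rw [Finset.sum_range_succ, ih (by omega)]
      have : posOf f P n ≤ posOf f P (n+1) := by
        rcases n with _ | n
        · simp [posOf]
        · simp only [posOf]
          have e1 := hP1 ⟨n, by omega⟩
          have e2 := hP1 ⟨n+1, by omega⟩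
          simp only at e1 e2
          rw [e1, e2]
          apply hgf
          apply hmono
          simp
      unfold natDist
      omega
  rw [key N le_rfl]
  rcases hn : N with _ | n
  · simp [posOf]
  · simp only [posOf]
    have e1 := hP1 ⟨n, by omega⟩
    simp only at e1
    rw [e1]
    exact hB _ (π _).2

lemma le_site (m x i : ℕ) : x ≤ site m x i := by
  unfold site; split_ifs <;> omega

lemma overtake (m M β j : ℕ) (hβ : 0 < β) :
    ((Finset.range j).filter (fun q => req m M β j < req m M β q)).card ≤ m * β := by
  set x := j/β/M with hx
  have : (Finset.range j).filter (fun q => req m M β j < req m M β q) ⊆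
      (Finset.range m ×ˢ Finset.range β).image
        (fun z => (x/2^z.1*2^z.1*M+z.1)*β+z.2) := by
    intro q hq
    simp only [Finset.mem_filter, Finset.mem_range] at hq
    obtain ⟨hqj, hlt⟩ := hq
    have h1 : x ≤ req m M β j := le_site _ _ _
    have h2 : q/β/M ≤ x := Nat.div_le_div_right (Nat.div_le_div_right hqj.le)
    have h3 : x < req m M β q := by omega
    rw [req, site] at h3
    split_ifs at h3 with hc
    · obtain ⟨hi, hdvd⟩ := hc
      refine Finset.mem_image.2 ⟨(q/β%M, q%β), ?_, ?_⟩
      · simp [hi, Nat.mod_lt _ hβ]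
      · simp only
        have e : x/2^(q/β%M) * 2^(q/β%M) = q/β/M := by
          obtain ⟨c, hc⟩ := hdvd
          have : x/2^(q/β%M) = c := by
            rw [Nat.div_eq_iff (Nat.two_pow_pos _)]
            have := Nat.two_pow_pos (q/β%M)
            rw [mul_comm c, ← hc]
            omega
          rw [this, mul_comm, ← hc]
        rw [e, Nat.div_add_mod', Nat.div_add_mod']
    · omega
  refine (Finset.card_le_card this).trans (Finset.card_image_le.trans ?_)
  simp

lemma lower' (m ℓ β k W : ℕ) (hβ : 0 < β) (hk1 : 1 ≤ k) (hk : k ≤ ℓ*β) (hW : 0 < W)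
    (σ : List ℕ) (hlen : σ.length = 2^m*(m+ℓ)*β)
    (hf : ∀ t : Fin σ.length, σ.get t = req m (m+ℓ) β t) :
    W*(β*(m*2^m)) ≤ W*β*(2*W*OPT k σ) + W*(2^m*k) + β*(m*2^m) := by
  obtain ⟨π, h1, h2⟩ := opt_spec hk1 σ
  obtain ⟨P, hP1, hP2⟩ := exists_ext _ π
  rw [← h2, cost_eq σ _ hf π (posOf (req m (m+ℓ) β) P) P rfl hP1 (fun t => rfl)]
  apply lower m ℓ β k W σ.length hβ hk1 hk hW P _ _ (fun t => rfl) hlen hP2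
  intro t
  rcases lt_or_ge t σ.length with ht | ht
  · have e := hP1 ⟨t, ht⟩
    have e' := h1 ⟨t, ht⟩
    simp only at e e'
    rw [e]; exact e'
  · rw [hP2 t ht]; omega

lemma req_lt (m ℓ β q : ℕ) (hm : 0 < m) (hq : q < 2^m*(m+ℓ)*β) :
    req m (m+ℓ) β q < 2^(m+1) := by
  have h0 : q/β < 2^m*(m+ℓ) := Nat.div_lt_of_lt_mul (by rw [mul_comm]; exact hq)
  have h1 : q/β/(m+ℓ) < 2^m := Nat.div_lt_of_lt_mul (by rw [mul_comm]; exact h0)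
  rw [req, site, pow_succ]
  split_ifs with h
  · have : 2^(q/β%(m+ℓ)) ≤ 2^m := Nat.pow_le_pow_right (by norm_num) h.1.le
    omega
  · omega

end RB

/-- **Lemma 6, scaled-up construction.** Fix a constant `ε ∈ (0,1)`.
There exists a constant `c > 0` (depending only on `ε`) such that for all positive
integers `ℓ` and `β` and every number of sites `n ≥ 2^ℓ + 1`, there exists a request
sequence `σ` on the line of `n` equidistant sites such that for every integer
`h ≥ β·ℓ` and every integer `h'` with `1 ≤ h' ≤ β·(1-ε)·ℓ`, one has `OPT(h, σ) > 0`
and `OPT(h', σ) ≥ c·ℓ·OPT(h, σ)`. -/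
theorem stmt12 (ε : ℝ) (hε : ε ∈ Set.Ioo (0 : ℝ) 1) :
    ∃ c : ℝ, 0 < c ∧
      ∀ ℓ β n : ℕ, 0 < ℓ → 0 < β → 2 ^ ℓ + 1 ≤ n →
        ∃ σ : List ℕ, (∀ x ∈ σ, x < n) ∧
          ∀ h h' : ℕ, β * ℓ ≤ h → 1 ≤ h' → (h' : ℝ) ≤ (β : ℝ) * (1 - ε) * (ℓ : ℝ) →
            0 < OPT h σ ∧ (OPT h' σ : ℝ) ≥ c * (ℓ : ℝ) * (OPT h σ : ℝ) := by
  obtain ⟨hε0, hε1⟩ := hε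
  obtain ⟨W, hW⟩ := exists_nat_ge (4/ε)
  have hWε : 4 ≤ (W:ℝ) * ε := by rwa [div_le_iff₀ hε0] at hW
  have hW1 : (1:ℝ) ≤ W := by
    by_contra hc
    nlinarith
  have hWpos : 0 < W := by exact_mod_cast (zero_lt_one.trans_le hW1)
  refine ⟨ε/(16*W), by positivity, ?_⟩
  intro ℓ β n hℓ hβ hn
  have hkle : ∀ h' : ℕ, (h' : ℝ) ≤ (β : ℝ) * (1 - ε) * (ℓ : ℝ) → h' ≤ ℓ * β := by
    intro h' hh
    have h1 : (0:ℝ) ≤ β * ℓ * ε := by positivity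
    have : (h' : ℝ) ≤ ((ℓ * β : ℕ) : ℝ) := by push_cast; nlinarith
    exact_mod_cast this
  by_cases hsmall : ε * ℓ < 2
  · refine ⟨[1], ?_, ?_⟩
    · intro x hx
      have := Nat.two_pow_pos ℓ
      simp at hx
      omega
    · intro h h' hh h1 h2
      have hle := hkle h' h2
      have hβℓ : h' ≤ h := hle.trans (by rw [mul_comm]; exact hh)
      refine ⟨RB.opt_pos (by omega) [1] (fun _ => 1) (by simp) 0 (by simp) (by simp), ?_⟩
      have hm : (OPT h [1] : ℝ) ≤ OPT h' [1] := by exact_mod_cast RB.opt_mono h1 hβℓ [1]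
      have h3 : ε/(16*W) * ℓ ≤ 1 := by
        rw [div_mul_eq_mul_div, div_le_one (by positivity)]
        linarith
      have h4 : (0:ℝ) ≤ OPT h [1] := by positivity
      nlinarith
  · push Not at hsmall
    have hℓ2 : 2 < ℓ := by
      have h1 : (0:ℝ) < ℓ := by exact_mod_cast hℓ
      have : (2:ℝ) < ℓ := by nlinarith
      exact_mod_cast this
    obtain ⟨m, rfl⟩ : ∃ m, ℓ = m + 1 := ⟨ℓ - 1, by omega⟩
    set N := 2^m*(m+(m+1))*β with hN
    set f := RB.req m (m+(m+1)) β with hfd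
    set σ := (List.range N).map f with hσ
    have hlen : σ.length = N := by simp [hσ]
    have hf : ∀ t : Fin σ.length, σ.get t = f t := by intro t; simp [hσ]
    have hflt : ∀ q < N, f q < 2^(m+1) := fun q hq => RB.req_lt m (m+1) β q (by omega) hq
    refine ⟨σ, ?_, ?_⟩
    · intro x hx
      simp only [hσ, List.mem_map, List.mem_range] at hx
      obtain ⟨q, hq, rfl⟩ := hx
      have := hflt q hq
      omega
    · intro h h' hh h1 h2
      have hle := hkle h' h2
      have hβℓ : h' ≤ h := hle.trans (by rw [mul_comm]; exact hh)
      constructor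
      · have h0N : 0 < N := by
          have := Nat.two_pow_pos m
          rw [hN]; positivity
        refine RB.opt_pos (by omega) σ f hf 0 (by rw [hlen]; exact h0N) ?_
        rw [hfd, RB.req, RB.site, if_pos]
        · positivity
        · simp; omega
      · have hup : OPT h σ ≤ 2^(m+1) := by
          apply RB.opt_upper σ f hf
          · intro q hq; rw [hlen] at hq; exact (hflt q hq).le
          · intro j _
            have := RB.overtake m (m+(m+1)) β j hβ
            have h3 : β * (m+1) = m*β + β := by ring
            rw [← hfd] at this
            omega
        have hlow := RB.lower' m (m+1) β h' W hβ h1 hle hWpos σ hlen hf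
        have hup' : (OPT h σ : ℝ) ≤ 2 * 2^m := by
          have : ((OPT h σ : ℕ) : ℝ) ≤ ((2^(m+1) : ℕ) : ℝ) := by exact_mod_cast hup
          rw [pow_succ] at this
          push_cast at this
          linarith
        have hlow' : (W:ℝ)*(β*(m*2^m)) ≤ W*β*(2*W*OPT h' σ) + W*(2^m*h') + β*(m*2^m) := by
          exact_mod_cast hlow
        generalize (OPT h' σ : ℝ) = C at *
        generalize (OPT h σ : ℝ) = B at *
        push_cast at *
        have hX : (0:ℝ) < 2^m := by positivity
        generalize (2:ℝ)^m = X at *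
        have hβ' : (0:ℝ) < β := by exact_mod_cast hβ
        have hm0 : (0:ℝ) ≤ m := by positivity
        have hWp : (0:ℝ) < W := by linarith
        have s1 : (W:ℝ)*(β*(m*X)) ≤ W*β*(2*W*C) + W*(X*(β*(1-ε)*(m+1))) + β*(m*X) := by
          refine hlow'.trans ?_
          gcongr
        have s2 : (W:ℝ)*(m*X) ≤ 2*W*W*C + W*X*(1-ε)*(m+1) + m*X := by
          have : (β:ℝ)*(W*(m*X)) ≤ β*(2*W*W*C + W*X*(1-ε)*(m+1) + m*X) := by linarith
          exact le_of_mul_le_mul_left this hβ'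
        have s3 : X * (W*ε*(m+1)/4) ≤ 2*W*W*C := by
          have t1 : (m:ℝ) ≤ W*ε*(m+1)/4 := by nlinarith
          have t2 : (W:ℝ) ≤ W*ε*(m+1)/2 := by nlinarith
          have t3 : W*ε*(m+1)/4 ≤ W*m - W*(1-ε)*(m+1) - m := by nlinarith
          have := mul_le_mul_of_nonneg_left t3 hX.le
          linarith
        have s4 : X * (ε*(m+1)) ≤ 8*W*C := by
          have : (W:ℝ) * (X * (ε*(m+1))) ≤ W*(8*W*C) := by linarith
          exact le_of_mul_le_mul_left this hWp
        have s5 : ε/(16*W)*(m+1)*B ≤ ε/(16*W)*(m+1)*(2*X) := by gcongr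
        refine s5.trans ?_
        rw [div_mul_eq_mul_div, div_mul_eq_mul_div, div_le_iff₀ (by positivity)]
        linarith
end

section
/- Let b ≥ 1 and N be positive integers and let π be a permutation of {1,…,N} satisfying π(t) ≤ t + b − 1 for every t. Then for every m ≥ 1 with m + b ≤ N: (i) at least two indices i ∈ {m, m+1, …, m+b} satisfy π^{−1}(i) ≤ m + 1; and (ii) every index i' > m + b satisfies π^{−1}(i') ≥ m + 2. In particular, at least one of the b+1 indices m, …, m+b is served strictly before every index greater than m+b (where index i is 'served' at position π^{−1}(i)). -/
/-- Let `b ≥ 1` and `N` be positive integers and let `π` be a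
permutation of `{1,…,N}` (modeled as `Equiv.Perm (Fin N)`, where `i : Fin N`
represents the 1-based index `i + 1`) satisfying `π(t) ≤ t + b - 1` for every `t`.
Then for every `m ≥ 1` with `m + b ≤ N`:
(i) at least two indices `i ∈ {m, m+1, …, m+b}` satisfy `π⁻¹(i) ≤ m + 1`; and
(ii) every index `i' > m + b` satisfies `π⁻¹(i') ≥ m + 2`.
In particular, at least one of the `b+1` indices `m, …, m+b` is served strictly
before every index greater than `m + b` (index `i` is served at position `π⁻¹(i)`). -/
theorem stmt14 (b N : ℕ) (hb : 1 ≤ b) (hN : 0 < N) (π : Equiv.Perm (Fin N))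
    (hπ : ∀ t : Fin N, (π t : ℕ) + 1 ≤ ((t : ℕ) + 1) + b - 1)
    (m : ℕ) (hm : 1 ≤ m) (hmb : m + b ≤ N) :
    2 ≤ (Finset.univ.filter fun i : Fin N =>
        m ≤ (i : ℕ) + 1 ∧ (i : ℕ) + 1 ≤ m + b ∧ (π.symm i : ℕ) + 1 ≤ m + 1).card ∧
    (∀ i' : Fin N, m + b < (i' : ℕ) + 1 → m + 2 ≤ (π.symm i' : ℕ) + 1) ∧
    ∃ i : Fin N, m ≤ (i : ℕ) + 1 ∧ (i : ℕ) + 1 ≤ m + b ∧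
      ∀ i' : Fin N, m + b < (i' : ℕ) + 1 → (π.symm i : ℕ) < (π.symm i' : ℕ) := by
  have h2 : ∀ i' : Fin N, m + b < (i' : ℕ) + 1 → m + 2 ≤ (π.symm i' : ℕ) + 1 := by
    intro i' hi
    have h := hπ (π.symm i')
    rw [Equiv.apply_symm_apply] at h
    omega
  have h1 : 2 ≤ (Finset.univ.filter fun i : Fin N =>
        m ≤ (i : ℕ) + 1 ∧ (i : ℕ) + 1 ≤ m + b ∧ (π.symm i : ℕ) + 1 ≤ m + 1).card := by
    have hA : ((Finset.Iic (⟨m, by omega⟩ : Fin N)).map π.toEmbedding).card = m + 1 := by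
      rw [Finset.card_map, Fin.card_Iic]
    have hB : (Finset.Iio (⟨m - 1, by omega⟩ : Fin N)).card = m - 1 := by
      rw [Fin.card_Iio]
    have hd := Finset.le_card_sdiff (Finset.Iio (⟨m - 1, by omega⟩ : Fin N))
      ((Finset.Iic (⟨m, by omega⟩ : Fin N)).map π.toEmbedding)
    rw [hA, hB] at hd
    refine le_trans (by omega) (le_trans hd (Finset.card_le_card ?_))
    intro i hi
    rw [Finset.mem_sdiff, Finset.mem_map_equiv, Finset.mem_Iic, Finset.mem_Iio,
      Fin.le_def, Fin.lt_def] at hi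
    obtain ⟨ha, hb'⟩ := hi
    simp only at ha hb'
    rw [Finset.mem_filter]
    have := h2 i
    refine ⟨Finset.mem_univ _, by omega, by omega, by omega⟩
  refine ⟨h1, h2, ?_⟩
  obtain ⟨i, hi⟩ := Finset.card_pos.mp (lt_of_lt_of_le (by norm_num) h1)
  rw [Finset.mem_filter] at hi
  refine ⟨i, hi.2.1, hi.2.2.1, fun i' hi' => ?_⟩
  have := h2 i' hi'
  have := hi.2.2.2
  omega
end
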